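/- Let g be an infinite game on a countable pruned tree T over a countable set Σ, with players in A, outcomes in O, Borel-measurable outcome function v, and strict linear preferences <_a for a ∈ A whose inverses are well-founded (no infinite strictly <_a-ascending chains). Suppose there exist a partition {O_i}_{i∈I} of O and a strict linear order < on I such that: (a) i < j implies x <_a y for all a ∈ A, x ∈ O_i and y ∈ O_j; and (b) for all a,b ∈ A and i ∈ I, the restriction of <_b to O_i equals the restriction of <_a to O_i or equals its inverse. Suppose further that for every i ∈ I the set of plays with outcome in ∪_{j<i} O_j is a quasi-difference set of [T]. Then g has a global-Pareto subgame perfect equilibrium. -/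

import Mathlib

/-! Basic setup: trees of finite sequences, their branches, the topology on the set of
branches, the Hausdorff difference hierarchy, quasi-difference sets, and infinite
games in extensive form. -/

/-- `T` is a tree over `α`: a set of finite sequences closed under taking prefixes. -/
def IsTree {α : Type*} (T : Set (List α)) : Prop :=
  ∀ ⦃γ δ : List α⦄, γ <+: δ → δ ∈ T → γ ∈ T

/-- `succ(T, γ)`: the nodes of `T` extending `γ` and of length `|γ| + 1`. -/
def treeSucc {α : Type*} (T : Set (List α)) (γ : List α) : Set (List α) :=
  {δ | δ ∈ T ∧ γ <+: δ ∧ δ.length = γ.length + 1}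

/-- `T` is pruned if every node has a successor. -/
def IsPruned {α : Type*} (T : Set (List α)) : Prop :=
  ∀ γ ∈ T, (treeSucc T γ).Nonempty

/-- The finite prefix of length `n` of an infinite sequence `p`. -/
def playPrefix {α : Type*} (p : ℕ → α) (n : ℕ) : List α :=
  List.ofFn fun i : Fin n => p i

/-- `[T]`: the infinite sequences all of whose finite prefixes lie in `T`. -/
def Body {α : Type*} (T : Set (List α)) : Set (ℕ → α) :=
  {p | ∀ n : ℕ, playPrefix p n ∈ T}

/-- `γ[T_γ]`: the elements of `[T]` extending the node `γ`. -/
def cylinder {α : Type*} (T : Set (List α)) (γ : List α) : Set (ℕ → α) :=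
  {p | p ∈ Body T ∧ playPrefix p γ.length = γ}

/-- Open subsets of `[T]`: the unions of basic sets `γ[T_γ]`, `γ ∈ T`. -/
def IsOpenIn {α : Type*} (T : Set (List α)) (A : Set (ℕ → α)) : Prop :=
  ∃ S ⊆ T, A = ⋃ γ ∈ S, cylinder T γ

/-- Closed subsets of `[T]`: complements in `[T]` of open subsets of `[T]`. -/
def IsClosedIn {α : Type*} (T : Set (List α)) (A : Set (ℕ → α)) : Prop :=
  A ⊆ Body T ∧ IsOpenIn T (Body T \ A)

/-- Borel subsets of `[T]`: members of the σ-algebra generated by the open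
subsets of `[T]` that are themselves included in `[T]`. -/
def IsBorelIn {α : Type*} (T : Set (List α)) (X : Set (ℕ → α)) : Prop :=
  X ⊆ Body T ∧
    @MeasurableSet (ℕ → α) (MeasurableSpace.generateFrom {A | IsOpenIn T A}) X

/-- `D_θ((A_η)_{η<θ})`: the set of `x ∈ ⋃_{η<θ} A_η` such that the least `η < θ`
with `x ∈ A_η` has parity opposite to that of `θ`. -/
noncomputable def Dset {α : Type*} (θ : Ordinal.{0}) (A : Ordinal.{0} → Set (ℕ → α)) :
    Set (ℕ → α) :=
  {x | (∃ η < θ, x ∈ A η) ∧ sInf {η | η < θ ∧ x ∈ A η} % 2 ≠ θ % 2}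

/-- `D_θ([T])`: all sets of the form `D_θ((A_η)_{η<θ})` for an `⊆`-increasing family
of open subsets of `[T]`. -/
def Dclass {α : Type*} (T : Set (List α)) (θ : Ordinal.{0}) : Set (Set (ℕ → α)) :=
  {X | ∃ A : Ordinal.{0} → Set (ℕ → α),
        (∀ η < θ, IsOpenIn T (A η)) ∧
        (∀ η₁ η₂, η₁ ≤ η₂ → η₂ < θ → A η₁ ⊆ A η₂) ∧
        X = Dset θ A}

/-- The quasi-difference sets `𝒟([T])`: open sets, unions of quasi-difference sets
placed below pairwise `⊑`-incomparable nodes, and complements in `[T]`. -/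
inductive QuasiDiff {α : Type*} (T : Set (List α)) : Set (ℕ → α) → Prop
  | isOpen : ∀ A, IsOpenIn T A → QuasiDiff T A
  | iUnion : ∀ (S : Set (List α)) (D : List α → Set (ℕ → α)),
      S ⊆ T → (S.Pairwise fun γ δ => ¬ γ <+: δ) →
      (∀ γ ∈ S, QuasiDiff T (D γ)) →
      (∀ γ ∈ S, D γ ⊆ cylinder T γ) →
      QuasiDiff T (⋃ γ ∈ S, D γ)
  | compl : ∀ A, QuasiDiff T A → QuasiDiff T (Body T \ A)

/-- An infinite game in extensive form: a tree `T` of finite plays, an owner function `d`,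
an outcome function `v` on infinite plays, and a preference relation for each player. -/
structure Game (α A O : Type*) where
  T : Set (List α)
  d : List α → A
  v : (ℕ → α) → O
  pref : A → O → O → Prop

/-- The infinite sequence starting with `γ` and continuing with `p`. -/
def listExtend {α : Type*} (γ : List α) (p : ℕ → α) : ℕ → α :=
  fun n => if h : n < γ.length then γ.get ⟨n, h⟩ else p (n - γ.length)

/-- The subgame `g_γ` of `g` at a node `γ`. -/
def Game.sub {α A O : Type*} (g : Game α A O) (γ : List α) : Game α A O where
  T := {δ | γ ++ δ ∈ g.T}
  d := fun δ => g.d (γ ++ δ)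
  v := fun p => g.v (listExtend γ p)
  pref := g.pref

/-- A strategy profile on `T`: it maps each node of `T` to a successor. -/
def IsProfile {α : Type*} (T : Set (List α)) (s : List α → List α) : Prop :=
  ∀ γ ∈ T, s γ ∈ treeSucc T γ

/-- The sequence of nodes obtained from `γ` by repeatedly applying `s`. -/
def iterNode {α : Type*} (s : List α → List α) (γ : List α) : ℕ → List α
  | 0 => γ
  | n + 1 => s (iterNode s γ n)

/-- The play `p^ε(s)` induced by `s` at the root. -/
def inducedPlay {α : Type*} [Inhabited α] (s : List α → List α) : ℕ → α :=
  fun n => (iterNode s [] (n + 1)).getD n default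

/-- The subprofile `s_γ`, defined by `γ s_γ(δ) = s(γδ)`. -/
def subProfile {α : Type*} (γ : List α) (s : List α → List α) : List α → List α :=
  fun δ => (s (γ ++ δ)).drop γ.length

/-- `s` is a Nash equilibrium of `g`: no player `a` has a profitable deviation `s'`
differing from `s` only at nodes owned by `a`. -/
def IsNE {α A O : Type*} [Inhabited α] (g : Game α A O) (s : List α → List α) : Prop :=
  ¬ ∃ (a : A) (s' : List α → List α), IsProfile g.T s' ∧
      (∀ γ ∈ g.T, s γ ≠ s' γ → g.d γ = a) ∧
      g.pref a (g.v (inducedPlay s)) (g.v (inducedPlay s'))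

/-- `s` is a subgame perfect equilibrium of `g`: `s_γ` is an NE of `g_γ` for all `γ ∈ T`. -/
def IsSPE {α A O : Type*} [Inhabited α] (g : Game α A O) (s : List α → List α) : Prop :=
  ∀ γ ∈ g.T, IsNE (g.sub γ) (subProfile γ s)

/-- The outcomes occurring in `g`. -/
def OutcomesOf {α A O : Type*} (g : Game α A O) : Set O := g.v '' Body g.T

/-- `x ∈ Os` is Pareto-optimal in `Os`. -/
def ParetoOpt {A O : Type*} (pref : A → O → O → Prop) (Os : Set O) (x : O) : Prop :=
  x ∈ Os ∧ ∀ y ∈ Os, ∀ a, pref a x y → ∃ b, pref b y x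

/-- The outcome induced by the subprofile `s_γ` in the subgame `g_γ`. -/
def subOutcome {α A O : Type*} [Inhabited α] (g : Game α A O) (s : List α → List α)
    (γ : List α) : O :=
  (g.sub γ).v (inducedPlay (subProfile γ s))

/-- Global-Pareto SPE: an SPE inducing in every subgame an outcome that is
Pareto-optimal among the outcomes occurring in that subgame. -/
def IsGPSPE {α A O : Type*} [Inhabited α] (g : Game α A O) (s : List α → List α) : Prop :=
  IsSPE g s ∧ ∀ γ ∈ g.T, ParetoOpt g.pref (OutcomesOf (g.sub γ)) (subOutcome g s γ)

/-- An `x`-pseudo-leaf: a shortest node `γ ∈ T` such that only `x` occurs in `g_γ`. -/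
def IsPseudoLeaf {α A O : Type*} (g : Game α A O) (x : O) (γ : List α) : Prop :=
  γ ∈ g.T ∧ OutcomesOf (g.sub γ) = {x} ∧
    ∀ δ, δ <+: γ → δ ≠ γ → OutcomesOf (g.sub δ) ≠ {x}

/-- A strict weak order: irreflexive, transitive, with transitive complement. -/
def IsSWO {O : Type*} (r : O → O → Prop) : Prop :=
  (∀ x, ¬ r x x) ∧ (∀ x y z, r x y → r y z → r x z) ∧
  (∀ x y z, ¬ r x y → ¬ r y z → ¬ r x z)

/-- The SPE killer does not occur in the family of preferences `lt`. -/
def NoSPEKiller {A O : Type*} (lt : A → O → O → Prop) : Prop :=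
  ∀ a b : A, ∀ x y z : O, ¬ (lt a z y ∧ lt a y x ∧ lt b x z ∧ lt b z y)

namespace BD
universe u

/-! ### Games on trees (positions are reversed lists) -/

/-- The initial segment of length `n` of `x`, in reversed order. -/
def pre {α : Type u} (x : ℕ → α) : ℕ → List α
  | 0 => []
  | n + 1 => x n :: pre x n

theorem pre_length {α : Type u} (x : ℕ → α) (n : ℕ) : (pre x n).length = n := by
  induction n with
  | zero => rfl
  | succ n ih => simp [pre, ih]

theorem pre_suffix {α : Type u} (x : ℕ → α) {m n : ℕ} (h : m ≤ n) : pre x m <:+ pre x n := by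
  induction n with
  | zero => obtain rfl : m = 0 := by omega
            exact List.suffix_refl _
  | succ n ih =>
    rcases Nat.lt_or_ge n m with h1 | h1
    · obtain rfl : m = n + 1 := by omega
      exact List.suffix_refl _
    · exact (ih h1).trans (List.suffix_cons _ _)

theorem suffix_pre {α : Type u} (x : ℕ → α) {p : List α} {n : ℕ} (h : p <:+ pre x n) :
    p = pre x p.length := by
  have h1 : p.length ≤ n := by simpa [pre_length] using h.length_le
  have h2 := List.suffix_of_suffix_length_le h (pre_suffix x h1) (by simp [pre_length])
  exact h2.eq_of_length (by simp [pre_length])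

theorem pre_drop {α : Type u} (x : ℕ → α) {m n : ℕ} (h : m ≤ n) :
    (pre x n).drop ((pre x n).length - m) = pre x m := by
  have h1 := suffix_pre x (List.drop_suffix ((pre x n).length - m) (pre x n))
  rw [h1]; congr 1; simp [pre_length]; omega

theorem pre_map {α β : Type u} (f : α → β) (x : ℕ → α) (n : ℕ) :
    (pre x n).map f = pre (f ∘ x) n := by
  induction n with
  | zero => rfl
  | succ n ih => simp [pre, ih]

theorem pre_congr {α : Type u} {x y : ℕ → α} {n : ℕ} (h : pre x n = pre y n) {m : ℕ} (hm : m ≤ n) :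
    pre x m = pre y m := by
  have h1 : pre x m <:+ pre y n := h ▸ pre_suffix x hm
  have := suffix_pre y h1
  rwa [pre_length] at this

theorem pre_val {α : Type u} {x y : ℕ → α} {n : ℕ} (h : pre x n = pre y n) {m : ℕ} (hm : m < n) :
    x m = y m := by
  have := pre_congr h (show m + 1 ≤ n from hm)
  simp only [pre, List.cons.injEq] at this
  exact this.1

structure GT where
  α : Type u
  T : Set (List α)
  nil_mem : [] ∈ T
  tail_mem : ∀ a p, a :: p ∈ T → p ∈ T
  pruned : ∀ p ∈ T, ∃ a, a :: p ∈ T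

def GBody (G : GT.{u}) : Set (ℕ → G.α) := {x | ∀ n, pre x n ∈ G.T}

def Legal (G : GT.{u}) (σ : List G.α → G.α) : Prop := ∀ p ∈ G.T, σ p :: p ∈ G.T

def Cons {α : Type u} (b : ℕ) (σ : List α → α) (x : ℕ → α) : Prop :=
  ∀ n, n % 2 = b → x n = σ (pre x n)

theorem GT.suffix_mem (G : GT.{u}) {p q : List G.α} (h : p <:+ q) (hq : q ∈ G.T) : p ∈ G.T := by
  induction q with
  | nil => rw [List.suffix_nil] at h; exact h ▸ hq
  | cons a q ih =>
    rcases List.suffix_cons_iff.1 h with h | h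
    · exact h ▸ hq
    · exact ih h (G.tail_mem _ _ hq)

open Classical in
/-- replace an illegal move by a legal one -/
noncomputable def GT.fix (G : GT.{u}) (p : List G.α) (a : G.α) : G.α :=
  if a :: p ∈ G.T then a else if h : p ∈ G.T then (G.pruned p h).choose else a

theorem GT.fix_legal (G : GT.{u}) (σ : List G.α → G.α) : Legal G (fun p => G.fix p (σ p)) := by
  intro p hp
  simp only [GT.fix]
  split_ifs with h
  · exact h
  · exact (G.pruned p hp).choose_spec

theorem GT.fix_eq (G : GT.{u}) {p : List G.α} {a : G.α} (h : a :: p ∈ G.T) : G.fix p a = a := by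
  simp [GT.fix, h]

theorem GT.nonempty (G : GT.{u}) : Nonempty G.α := ⟨(G.pruned _ G.nil_mem).choose⟩

/-! ### Attractors -/

inductive WinO {α : Type u} (b : ℕ) (M U : Set (List α)) : Ordinal.{u} → List α → Prop
  | tgt (o p) : p ∈ U → WinO b M U o p
  | own (o o' p a) : p.length % 2 = b → a :: p ∈ M → o' < o → WinO b M U o' (a :: p) →
      WinO b M U o p
  | opp (o p) (f : α → Ordinal.{u}) : p.length % 2 ≠ b → (∀ a, a :: p ∈ M → f a < o) →
      (∀ a, a :: p ∈ M → WinO b M U (f a) (a :: p)) → WinO b M U o p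

def Win {α : Type u} (b : ℕ) (M U : Set (List α)) (p : List α) : Prop := ∃ o, WinO b M U o p

noncomputable def wrank {α : Type u} (b : ℕ) (M U : Set (List α)) (p : List α) : Ordinal.{u} :=
  sInf {o | WinO b M U o p}

theorem WinO_wrank {α : Type u} {b : ℕ} {M U : Set (List α)} {p : List α} (h : Win b M U p) :
    WinO b M U (wrank b M U p) p := csInf_mem (s := {o | WinO b M U o p}) h

theorem Win.of_tgt {α : Type u} {b : ℕ} {M U : Set (List α)} {p : List α} (h : p ∈ U) :
    Win b M U p := ⟨0, .tgt _ _ h⟩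

theorem Win.of_own {α : Type u} {b : ℕ} {M U : Set (List α)} {p : List α} {a : α}
    (hb : p.length % 2 = b) (hM : a :: p ∈ M) (h : Win b M U (a :: p)) : Win b M U p := by
  obtain ⟨o, ho⟩ := h
  exact ⟨Order.succ o, .own _ o p a hb hM (Order.lt_succ o) ho⟩

theorem Win.of_opp {α : Type u} {b : ℕ} {M U : Set (List α)} {p : List α}
    (hb : p.length % 2 ≠ b) (h : ∀ a, a :: p ∈ M → Win b M U (a :: p)) : Win b M U p := by
  refine ⟨Order.succ (⨆ a, wrank b M U (a :: p)), .opp _ p (fun a => wrank b M U (a :: p)) hb ?_ ?_⟩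
  · intro a _
    exact Order.lt_succ_of_le (Ordinal.le_iSup (fun a => wrank b M U (a :: p)) a)
  · intro a ha
    exact WinO_wrank (h a ha)

theorem Win.own_step {α : Type u} {b : ℕ} {M U : Set (List α)} {p : List α} (h : Win b M U p)
    (hU : p ∉ U) (hb : p.length % 2 = b) :
    ∃ a, a :: p ∈ M ∧ Win b M U (a :: p) ∧ wrank b M U (a :: p) < wrank b M U p := by
  have h1 := WinO_wrank h
  cases h1 with
  | tgt _ _ h => exact absurd h hU
  | own _ o' _ a _ hM hlt hw => exact ⟨a, hM, ⟨_, hw⟩, lt_of_le_of_lt (csInf_le' hw) hlt⟩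
  | opp _ _ f hb' => exact absurd hb hb'

theorem Win.opp_step {α : Type u} {b : ℕ} {M U : Set (List α)} {p : List α} (h : Win b M U p)
    (hU : p ∉ U) (hb : p.length % 2 ≠ b) {a : α} (ha : a :: p ∈ M) :
    Win b M U (a :: p) ∧ wrank b M U (a :: p) < wrank b M U p := by
  have h1 := WinO_wrank h
  cases h1 with
  | tgt _ _ h => exact absurd h hU
  | own _ o' _ a hb' hM hlt hw => exact absurd hb' hb
  | opp _ _ f _ hf hw => exact ⟨⟨_, hw a ha⟩, lt_of_le_of_lt (csInf_le' (hw a ha)) (hf a ha)⟩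

open Classical in
noncomputable def att {α : Type u} [Nonempty α] (b : ℕ) (M U : Set (List α)) (p : List α) : α :=
  Classical.epsilon fun a =>
    a :: p ∈ M ∧ Win b M U (a :: p) ∧ wrank b M U (a :: p) < wrank b M U p

theorem att_spec {α : Type u} [Nonempty α] {b : ℕ} {M U : Set (List α)} {p : List α}
    (h : Win b M U p) (hU : p ∉ U) (hb : p.length % 2 = b) :
    att b M U p :: p ∈ M ∧ Win b M U (att b M U p :: p) ∧
      wrank b M U (att b M U p :: p) < wrank b M U p :=
  Classical.epsilon_spec (h.own_step hU hb)

/-- a play that follows the attractor strategy and never reaches the target is never winning -/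
theorem not_win_of_att {α : Type u} [Nonempty α] {b : ℕ} {M U : Set (List α)} {x : ℕ → α} {N : ℕ}
    (hU : ∀ n, N ≤ n → pre x n ∉ U)
    (hopp : ∀ n, N ≤ n → n % 2 ≠ b → pre x n ∈ M → pre x (n + 1) ∈ M)
    (hown : ∀ n, N ≤ n → n % 2 = b → pre x n ∈ M → Win b M U (pre x n) →
      x n = att b M U (pre x n)) :
    ∀ n, N ≤ n → pre x n ∈ M → ¬ Win b M U (pre x n) := by
  suffices H : ∀ o : Ordinal.{u}, ∀ n, N ≤ n → pre x n ∈ M → wrank b M U (pre x n) = o →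
      ¬ Win b M U (pre x n) from fun n hn hM => H _ n hn hM rfl
  intro o
  induction o using WellFoundedLT.induction with
  | ind o ih =>
    intro n hn hM ho hw
    by_cases hb : n % 2 = b
    · have h1 := att_spec hw (hU n hn) (by rwa [pre_length])
      rw [← hown n hn hb hM hw] at h1
      exact ih _ (ho ▸ h1.2.2) (n + 1) (by omega) h1.1 rfl h1.2.1
    · have h0 := hopp n hn hb hM
      have h1 := hw.opp_step (hU n hn) (by rwa [pre_length]) h0
      exact ih _ (ho ▸ h1.2) (n + 1) (by omega) h0 rfl h1.1

/-! ### Clopen determinacy -/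

def Clopen (G : GT.{u}) (X : Set (ℕ → G.α)) : Prop :=
  ∀ x ∈ GBody G, ∃ n, ∀ y ∈ GBody G, pre y n = pre x n → (y ∈ X ↔ x ∈ X)

def OpenIn (G : GT.{u}) (X : Set (ℕ → G.α)) : Prop :=
  ∀ x ∈ GBody G, x ∈ X → ∃ n, ∀ y ∈ GBody G, pre y n = pre x n → y ∈ X

def Determined (G : GT.{u}) (X : Set (ℕ → G.α)) : Prop :=
  (∃ σ, Legal G σ ∧ ∀ x ∈ GBody G, Cons 0 σ x → x ∈ X) ∨
  (∃ σ, Legal G σ ∧ ∀ x ∈ GBody G, Cons 1 σ x → x ∉ X)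

theorem open_determined (G : GT.{u}) (X : Set (ℕ → G.α)) (hX : OpenIn G X) : Determined G X := by
  have := G.nonempty
  set U : Set (List G.α) := {p | p ∈ G.T ∧ ∀ y ∈ GBody G, pre y p.length = p → y ∈ X} with hUdef
  by_cases hw : Win 0 G.T U []
  · left
    refine ⟨fun p => G.fix p (att 0 G.T U p), G.fix_legal _, fun x hx hc => ?_⟩
    by_contra hxX
    have hU : ∀ n, 0 ≤ n → pre x n ∉ U := by
      intro n _ hn
      exact hxX (hn.2 x hx (by rw [pre_length]))
    refine not_win_of_att hU (fun n _ _ _ => hx (n + 1)) ?_ 0 le_rfl (hx 0) hw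
    intro n _ hb hM hwn
    rw [hc n hb]
    exact G.fix_eq (att_spec hwn (hU n (Nat.zero_le _)) (by rwa [pre_length])).1
  · right
    refine ⟨fun p => G.fix p (Classical.epsilon fun a => a :: p ∈ G.T ∧ ¬ Win 0 G.T U (a :: p)),
      G.fix_legal _, fun x hx hc => ?_⟩
    have key : ∀ n, ¬ Win 0 G.T U (pre x n) := by
      intro n
      induction n with
      | zero => exact hw
      | succ n ih =>
        by_cases hb : n % 2 = 0
        · intro h
          exact ih (Win.of_own (by rwa [pre_length]) (hx (n + 1)) h)
        · have h1 : ∃ a, a :: pre x n ∈ G.T ∧ ¬ Win 0 G.T U (a :: pre x n) := by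
            by_contra hcon
            push Not at hcon
            exact ih (Win.of_opp (by rwa [pre_length]) hcon)
          have h2 := Classical.epsilon_spec h1
          have h3 := hc n (by omega)
          beta_reduce at h3
          rw [G.fix_eq h2.1] at h3
          rw [← h3] at h2
          exact h2.2
    intro hxX
    obtain ⟨n, hn⟩ := hX x hx hxX
    exact key n (Win.of_tgt ⟨hx n, fun y hy hyn => hn y hy (by rwa [pre_length] at hyn)⟩)

/-! ### Coverings -/

structure Cov (k : ℕ) (H G : GT.{u}) where
  f : H.α → G.α
  map_mem : ∀ p ∈ H.T, p.map f ∈ G.T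
  surj : ∀ p ∈ G.T, p.length ≤ k → ∃ q ∈ H.T, q.map f = p
  inj : ∀ p ∈ H.T, ∀ q ∈ H.T, p.length ≤ k → p.map f = q.map f → p = q
  φ : ℕ → (List H.α → H.α) → (List G.α → G.α)
  legal : ∀ b σ, Legal H σ → Legal G (φ b σ)
  loc : ∀ b σ τ n, (∀ p ∈ H.T, p.length < n → σ p = τ p) →
    ∀ p ∈ G.T, p.length < n → φ b σ p = φ b τ p
  low : ∀ b σ, Legal H σ → ∀ p ∈ H.T, p.length < k → φ b σ (p.map f) = f (σ p)
  lift : ∀ b < 2, ∀ σ, Legal H σ → ∀ x ∈ GBody G, Cons b (φ b σ) x →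
    ∃ y ∈ GBody H, Cons b σ y ∧ f ∘ y = x

theorem Cov.body {k : ℕ} {H G : GT.{u}} (c : Cov k H G) {y : ℕ → H.α} (hy : y ∈ GBody H) :
    c.f ∘ y ∈ GBody G := by
  intro n
  rw [← pre_map]
  exact c.map_mem _ (hy n)

def Cov.mono {k l : ℕ} {H G : GT.{u}} (c : Cov k H G) (h : l ≤ k) : Cov l H G where
  f := c.f
  map_mem := c.map_mem
  surj p hp hl := c.surj p hp (hl.trans h)
  inj p hp q hq hl := c.inj p hp q hq (hl.trans h)
  φ := c.φ
  legal := c.legal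
  loc := c.loc
  low b σ hσ p hp hl := c.low b σ hσ p hp (hl.trans_le h)
  lift := c.lift

def Cov.comp {k : ℕ} {K H G : GT.{u}} (c : Cov k H G) (d : Cov k K H) : Cov k K G where
  f := c.f ∘ d.f
  map_mem p hp := by
    rw [← List.map_map]; exact c.map_mem _ (d.map_mem p hp)
  surj p hp hl := by
    obtain ⟨q, hq, rfl⟩ := c.surj p hp hl
    obtain ⟨r, hr, rfl⟩ := d.surj q hq (by simpa using hl)
    exact ⟨r, hr, by simp⟩
  inj p hp q hq hl h := by
    rw [← List.map_map, ← List.map_map] at h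
    exact d.inj p hp q hq hl (c.inj _ (d.map_mem p hp) _ (d.map_mem q hq) (by simpa using hl) h)
  φ b σ := c.φ b (d.φ b σ)
  legal b σ h := c.legal b _ (d.legal b σ h)
  loc b σ τ n h := c.loc b _ _ n (d.loc b σ τ n h)
  low b σ hσ p hp hl := by
    rw [← List.map_map, c.low b _ (d.legal b σ hσ) _ (d.map_mem p hp) (by simpa using hl),
      d.low b σ hσ p hp hl]; rfl
  lift b hb σ hσ x hx hc := by
    obtain ⟨y, hy, hyc, rfl⟩ := c.lift b hb _ (d.legal b σ hσ) x hx hc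
    obtain ⟨z, hz, hzc, rfl⟩ := d.lift b hb _ hσ y hy hyc
    exact ⟨z, hz, hzc, rfl⟩

theorem Cov.determined {k : ℕ} {H G : GT.{u}} (c : Cov k H G) {X : Set (ℕ → G.α)}
    (h : Determined H ((fun y => c.f ∘ y) ⁻¹' X)) : Determined G X := by
  rcases h with ⟨σ, hσ, h⟩ | ⟨σ, hσ, h⟩
  · refine Or.inl ⟨c.φ 0 σ, c.legal _ _ hσ, fun x hx hc => ?_⟩
    obtain ⟨y, hy, hyc, rfl⟩ := c.lift 0 (by norm_num) σ hσ x hx hc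
    exact h y hy hyc
  · refine Or.inr ⟨c.φ 1 σ, c.legal _ _ hσ, fun x hx hc => ?_⟩
    obtain ⟨y, hy, hyc, rfl⟩ := c.lift 1 (by norm_num) σ hσ x hx hc
    exact h y hy hyc

theorem Clopen.openIn {G : GT.{u}} {X : Set (ℕ → G.α)} (h : Clopen G X) : OpenIn G X := by
  intro x hx hxX
  obtain ⟨n, hn⟩ := h x hx
  exact ⟨n, fun y hy hyn => (hn y hy hyn).2 hxX⟩

end BD


namespace BD
universe u

/-! ### Inverse limits of coverings -/

section Limit
variable (k : ℕ) (G : ℕ → GT.{u}) (c : ∀ i, Cov (k + i) (G (i + 1)) (G i))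

/-- threads of letters -/
def Thr : Type u := {a : ∀ i, (G i).α // ∀ i, (c i).f (a (i + 1)) = a i}

def limT : Set (List (Thr k G c)) := {p | ∀ i, p.map (fun a => a.1 i) ∈ (G i).T}

variable {k G c}

theorem thr_map_succ (p : List (Thr k G c)) (i : ℕ) :
    (p.map (fun a => a.1 (i + 1))).map (c i).f = p.map (fun a => a.1 i) := by
  rw [List.map_map]
  apply List.map_congr_left
  intro a _
  exact a.2 i

theorem lim_inj {p q : List (Thr k G c)} (hp : p ∈ limT k G c) (hq : q ∈ limT k G c) (i : ℕ)
    (hl : p.length ≤ k + i) (h : p.map (fun a => a.1 i) = q.map (fun a => a.1 i)) : p = q := by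
  have up : ∀ j, p.map (fun a => a.1 (i + j)) = q.map (fun a => a.1 (i + j)) := by
    intro j
    induction j with
    | zero => exact h
    | succ j ih =>
      rw [← Nat.add_assoc]
      apply (c (i + j)).inj _ (hp _) _ (hq _) (by simp; omega)
      rw [thr_map_succ, thr_map_succ, ih]
  have down : ∀ j l, p.map (fun a => a.1 (l + j)) = q.map (fun a => a.1 (l + j)) →
      p.map (fun a => a.1 l) = q.map (fun a => a.1 l) := by
    intro j
    induction j with
    | zero => exact fun l h => h
    | succ j ih =>
      intro l h
      apply ih
      rw [← thr_map_succ p, ← thr_map_succ q]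
      exact congrArg _ h
  have all : ∀ l, p.map (fun a => a.1 l) = q.map (fun a => a.1 l) := by
    intro l
    apply down i l
    rw [Nat.add_comm]; exact up l
  have hlen : p.length = q.length := by simpa using congrArg List.length h
  apply List.ext_getElem hlen
  intro n h1 h2
  apply Subtype.ext
  funext l
  have := congrArg (fun L => L[n]?) (all l)
  simpa [h1, h2] using this

/-- extending a position of the limit by a letter at stage `i` -/
theorem lim_extend {p : List (Thr k G c)} (hp : p ∈ limT k G c) (i : ℕ) (hl : p.length < k + i)
    (a : (G i).α) (ha : a :: p.map (fun a => a.1 i) ∈ (G i).T) :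
    ∃ b : Thr k G c, b.1 i = a ∧ b :: p ∈ limT k G c := by
  -- upward sequence of letters
  have step : ∀ j, ∀ a : (G (i + j)).α, a :: p.map (fun a => a.1 (i + j)) ∈ (G (i + j)).T →
      ∃ b : (G (i + j + 1)).α, (c (i + j)).f b = a ∧
        b :: p.map (fun a => a.1 (i + j + 1)) ∈ (G (i + j + 1)).T := by
    intro j a ha
    obtain ⟨q, hq, hqa⟩ := (c (i + j)).surj _ ha (by simp; omega)
    cases q with
    | nil => simp at hqa
    | cons b q =>
      simp only [List.map_cons, List.cons.injEq] at hqa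
      refine ⟨b, hqa.1, ?_⟩
      have : q = p.map (fun a => a.1 (i + j + 1)) := by
        apply (c (i + j)).inj _ ((G _).tail_mem _ _ hq) _ (hp _)
        · have := congrArg List.length hqa.2
          simp at this; omega
        · rw [hqa.2, thr_map_succ]
      rw [← this]; exact hq
  choose st hst1 hst2 using step
  let upS : ∀ j, {a : (G (i + j)).α // a :: p.map (fun a => a.1 (i + j)) ∈ (G (i + j)).T} :=
    fun j => Nat.rec ⟨a, ha⟩ (fun j x => ⟨st j x.1 x.2, hst2 j x.1 x.2⟩) j
  let up : ∀ j, (G (i + j)).α := fun j => (upS j).1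
  have hup : ∀ j, up j :: p.map (fun a => a.1 (i + j)) ∈ (G (i + j)).T := fun j => (upS j).2
  have hup1 : ∀ j, (c (i + j)).f (up (j + 1)) = up j := fun j => hst1 j _ (hup j)
  -- downward projection
  let dn : ∀ l j, (G (l + j)).α → (G l).α := fun l j => Nat.rec (fun a => a)
    (fun j r a => r ((c (l + j)).f a)) j
  have dn_succ : ∀ l j a, dn l (j + 1) a = dn l j ((c (l + j)).f a) := fun l j a => rfl
  have dn_f : ∀ l j (a : (G (l + 1 + j)).α) (a' : (G (l + (j + 1))).α), HEq a a' →
      (c l).f (dn (l + 1) j a) = dn l (j + 1) a' := by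
    intro l j
    induction j with
    | zero => intro a a' h; cases h; rfl
    | succ j ih =>
      intro a a' h
      rw [dn_succ, dn_succ]
      apply ih
      have e : l + 1 + j = l + (j + 1) := by omega
      have gen : ∀ m m' (hm : m = m') (a : (G (m + 1)).α) (a' : (G (m' + 1)).α), HEq a a' →
          HEq ((c m).f a) ((c m').f a') := by
        intro m m' hm a a' h
        subst hm; cases h; rfl
      exact gen _ _ e a a' h
  have dn_mem : ∀ l j (a : (G (l + j)).α), a :: p.map (fun a => a.1 (l + j)) ∈ (G (l + j)).T →
      dn l j a :: p.map (fun a => a.1 l) ∈ (G l).T := by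
    intro l j
    induction j with
    | zero => exact fun a h => h
    | succ j ih =>
      intro a h
      rw [dn_succ]
      apply ih
      have := (c (l + j)).map_mem _ h
      simp only [List.map_cons] at this
      rwa [← thr_map_succ p]
  -- the cast of `up l` to stage `l + i`
  have cst : ∀ l, ∃ a : (G (l + i)).α, HEq a (up l) := by
    intro l
    have e : i + l = l + i := Nat.add_comm _ _
    exact ⟨e ▸ up l, by simp⟩
  choose w hw using cst
  have hwmem : ∀ l, w l :: p.map (fun a => a.1 (l + i)) ∈ (G (l + i)).T := by
    intro l
    have gen : ∀ m m' (hm : m = m') (a : (G m).α) (a' : (G m').α), HEq a a' →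
        a' :: p.map (fun a => a.1 m') ∈ (G m').T → a :: p.map (fun a => a.1 m) ∈ (G m).T := by
      intro m m' hm a a' h; subst hm; cases h; exact id
    exact gen _ _ (Nat.add_comm _ _) _ _ (hw l) (hup l)
  let b : ∀ l, (G l).α := fun l => dn l i (w l)
  have hb : ∀ l, (c l).f (b (l + 1)) = b l := by
    intro l
    have e : l + 1 + i = l + (i + 1) := by omega
    have h1 := dn_f l i (w (l + 1)) (e ▸ w (l + 1)) (by simp)
    show (c l).f (dn (l + 1) i (w (l + 1))) = dn l i (w l)
    rw [h1, dn_succ]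
    congr 1
    have gen : ∀ m m' (hm : m = m') (a : (G (m + 1)).α) (a' : (G (m' + 1)).α), HEq a a' →
        HEq ((c m).f a) ((c m').f a') := by
      intro m m' hm a a' h
      subst hm; cases h; rfl
    apply eq_of_heq
    refine (gen _ _ (Nat.add_comm _ _) _ (up (l + 1)) ?_).trans ((heq_of_eq (hup1 l)).trans (hw l).symm)
    exact HEq.trans (by simp) (hw (l + 1))
  refine ⟨⟨b, hb⟩, ?_, ?_⟩
  · -- the value at stage i
    have key : ∀ j, dn i j (up j) = a := by
      intro j
      induction j with
      | zero => rfl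
      | succ j ih => rw [dn_succ, hup1, ih]
    show dn i i (w i) = a
    rw [eq_of_heq (hw i), key]
  · intro l
    exact dn_mem l i _ (hwmem l)

variable (k G c)

def limG : GT.{u} where
  α := Thr k G c
  T := limT k G c
  nil_mem := fun i => (G i).nil_mem
  tail_mem := fun a p h i => (G i).tail_mem _ _ (h i)
  pruned := fun p hp => by
    obtain ⟨a, ha⟩ := (G (p.length + 1)).pruned _ (hp (p.length + 1))
    obtain ⟨b, _, hb⟩ := lim_extend hp (p.length + 1) (by omega) a ha
    exact ⟨b, hb⟩

variable {k G c}

theorem lim_surj (i : ℕ) (p : List (G i).α) (hp : p ∈ (G i).T) (hl : p.length ≤ k + i) :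
    ∃ q ∈ limT k G c, q.map (fun a => a.1 i) = p := by
  induction p with
  | nil => exact ⟨[], (limG k G c).nil_mem, rfl⟩
  | cons a p ih =>
    simp only [List.length_cons] at hl
    obtain ⟨q, hq, hqp⟩ := ih ((G i).tail_mem _ _ hp) (by omega)
    have hlen : q.length = p.length := by rw [← hqp]; simp
    obtain ⟨b, hb, hb'⟩ := lim_extend hq i (by omega) a (by rw [hqp]; exact hp)
    exact ⟨b :: q, hb', by simp [hb, hqp]⟩

open Classical in
noncomputable def lbase (σ : List (Thr k G c) → Thr k G c) (i : ℕ) (p : List (G i).α) : (G i).α :=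
  (G i).fix p (if h : ∃ q ∈ limT k G c, q.map (fun a => a.1 i) = p ∧ p.length < k + i then
    (σ h.choose).1 i else Classical.choice (G i).nonempty)

theorem lbase_legal (σ : List (Thr k G c) → Thr k G c) (i : ℕ) : Legal (G i) (lbase σ i) :=
  (G i).fix_legal _

theorem lbase_spec {σ : List (Thr k G c) → Thr k G c} (hσ : Legal (limG k G c) σ) (i : ℕ)
    {q : List (Thr k G c)} (hq : q ∈ limT k G c) (hl : q.length < k + i) :
    lbase σ i (q.map (fun a => a.1 i)) = (σ q).1 i := by
  have h : ∃ q' ∈ limT k G c, q'.map (fun a => a.1 i) = q.map (fun a => a.1 i) ∧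
      (q.map (fun a => a.1 i)).length < k + i := ⟨q, hq, rfl, by simpa using hl⟩
  have e : h.choose = q := by
    refine (lim_inj hq h.choose_spec.1 i hl.le ?_).symm
    exact h.choose_spec.2.1.symm
  rw [lbase, dif_pos h, e]
  exact GT.fix_eq _ (hσ q hq i)

theorem lbase_loc {σ τ : List (Thr k G c) → Thr k G c} {n : ℕ}
    (h : ∀ p ∈ limT k G c, p.length < n → σ p = τ p) (i : ℕ) (p : List (G i).α)
    (hp : p.length < n) : lbase σ i p = lbase τ i p := by
  rw [lbase, lbase]
  congr 1
  split_ifs with h1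
  · rw [h _ h1.choose_spec.1]
    have := congrArg List.length h1.choose_spec.2.1
    simp only [List.length_map] at this
    omega
  · rfl

noncomputable def lD (b : ℕ) (σ : List (Thr k G c) → Thr k G c) :
    ℕ → ∀ i, List (G i).α → (G i).α
  | 0 => fun i => lbase σ i
  | m + 1 => fun i => (c i).φ b (lD b σ m (i + 1))

theorem lD_legal (b : ℕ) (σ : List (Thr k G c) → Thr k G c) (m i : ℕ) :
    Legal (G i) (lD b σ m i) := by
  induction m generalizing i with
  | zero => exact lbase_legal σ i
  | succ m ih => exact (c i).legal _ _ (ih (i + 1))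

theorem lD_loc (b : ℕ) {σ τ : List (Thr k G c) → Thr k G c} {n : ℕ}
    (h : ∀ p ∈ limT k G c, p.length < n → σ p = τ p) (m i : ℕ) :
    ∀ p ∈ (G i).T, p.length < n → lD b σ m i p = lD b τ m i p := by
  induction m generalizing i with
  | zero => exact fun p _ hp => lbase_loc h i p hp
  | succ m ih => exact (c i).loc _ _ _ n (ih (i + 1))

theorem lD_agree (b : ℕ) {σ : List (Thr k G c) → Thr k G c} (hσ : Legal (limG k G c) σ)
    (m i : ℕ) (p : List (G i).α) (hp : p ∈ (G i).T) (hl : p.length < k + i + m) :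
    lD b σ m i p = lD b σ (m + 1) i p := by
  induction m generalizing i with
  | zero =>
    obtain ⟨q, hq, rfl⟩ := lim_surj (c := c) i p hp (by omega)
    have hl' : q.length < k + i := by simpa using hl
    show lbase σ i _ = (c i).φ b (lbase σ (i + 1)) _
    rw [lbase_spec hσ i hq hl', ← thr_map_succ, (c i).low b _ (lbase_legal σ _) _ (hq _)
      (by simpa using hl'), lbase_spec hσ (i + 1) hq (by omega)]
    exact ((σ q).2 i).symm
  | succ m ih =>
    show (c i).φ b (lD b σ m (i + 1)) p = (c i).φ b (lD b σ (m + 1) (i + 1)) p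
    exact (c i).loc b _ _ (k + (i + 1) + m) (ih (i + 1)) p hp (by omega)

theorem lD_agree' (b : ℕ) {σ : List (Thr k G c) → Thr k G c} (hσ : Legal (limG k G c) σ)
    (m d i : ℕ) (p : List (G i).α) (hp : p ∈ (G i).T) (hl : p.length < k + i + m) :
    lD b σ m i p = lD b σ (m + d) i p := by
  induction d with
  | zero => rfl
  | succ d ih => rw [ih]; exact lD_agree b hσ (m + d) i p hp (by omega)

noncomputable def lS (b : ℕ) (σ : List (Thr k G c) → Thr k G c) (i : ℕ) (p : List (G i).α) :
    (G i).α := lD b σ (p.length + 1) i p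

theorem lS_legal (b : ℕ) (σ : List (Thr k G c) → Thr k G c) (i : ℕ) :
    Legal (G i) (lS b σ i) := fun p hp => lD_legal b σ (p.length + 1) i p hp

theorem lS_base (b : ℕ) {σ : List (Thr k G c) → Thr k G c} (hσ : Legal (limG k G c) σ) (i : ℕ)
    {q : List (Thr k G c)} (hq : q ∈ limT k G c) (hl : q.length < k + i) :
    lS b σ i (q.map (fun a => a.1 i)) = (σ q).1 i := by
  rw [lS, ← lbase_spec hσ i hq hl]
  have := lD_agree' b hσ 0 (q.length + 1) i (q.map (fun a => a.1 i)) (hq i) (by simpa using hl)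
  rw [Nat.zero_add] at this
  simpa [lD] using this.symm

theorem lS_succ (b : ℕ) {σ : List (Thr k G c) → Thr k G c} (hσ : Legal (limG k G c) σ) (i : ℕ)
    (p : List (G i).α) (hp : p ∈ (G i).T) : (c i).φ b (lS b σ (i + 1)) p = lS b σ i p := by
  have h1 : (c i).φ b (lS b σ (i + 1)) p = (c i).φ b (lD b σ (p.length + 1) (i + 1)) p := by
    refine (c i).loc b _ _ (p.length + 1) ?_ p hp (by omega)
    intro q hq hl
    have := lD_agree' b hσ (q.length + 1) (p.length - q.length) (i + 1) q hq (by omega)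
    rw [show q.length + 1 + (p.length - q.length) = p.length + 1 by omega] at this
    exact this
  rw [h1]
  exact (lD_agree b hσ (p.length + 1) i p hp (by omega)).symm

theorem lim_lift (b : ℕ) (hb : b < 2) {σ : List (Thr k G c) → Thr k G c}
    (hσ : Legal (limG k G c) σ) (x : ℕ → (G 0).α) (hx : x ∈ GBody (G 0))
    (hc : Cons b (lS b σ 0) x) :
    ∃ y ∈ GBody (limG k G c), Cons b σ y ∧ (fun a : Thr k G c => a.1 0) ∘ y = x := by
  have step : ∀ i, ∀ z : {x : ℕ → (G i).α // x ∈ GBody (G i) ∧ Cons b (lS b σ i) x},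
      ∃ z' : {x : ℕ → (G (i + 1)).α // x ∈ GBody (G (i + 1)) ∧ Cons b (lS b σ (i + 1)) x},
        (c i).f ∘ z'.1 = z.1 := by
    rintro i ⟨z, hz, hzc⟩
    obtain ⟨y, hy, hyc, hyz⟩ := (c i).lift b hb (lS b σ (i + 1)) (lS_legal b σ _) z hz (by
      intro n hn
      rw [lS_succ b hσ i _ (hz n)]
      exact hzc n hn)
    exact ⟨⟨y, hy, hyc⟩, hyz⟩
  choose st hst using step
  let z : ∀ i, {x : ℕ → (G i).α // x ∈ GBody (G i) ∧ Cons b (lS b σ i) x} :=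
    fun i => Nat.rec ⟨x, hx, hc⟩ (fun i z => st i z) i
  have hz : ∀ i, (c i).f ∘ (z (i + 1)).1 = (z i).1 := fun i => hst i _
  let y : ℕ → Thr k G c := fun n => ⟨fun i => (z i).1 n, fun i => congrFun (hz i) n⟩
  have hpr : ∀ n i, (pre y n).map (fun a => a.1 i) = pre (z i).1 n := by
    intro n i
    rw [pre_map]; rfl
  have hy : ∀ n, pre y n ∈ limT k G c := by
    intro n i
    rw [hpr]
    exact (z i).2.1 n
  refine ⟨y, hy, ?_, rfl⟩
  intro n hn
  have h1 := hσ _ (hy n)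
  have h2 : y n :: pre y n = σ (pre y n) :: pre y n := by
    refine lim_inj (hy (n + 1)) h1 (n + 1) (by simp [pre_length]) ?_
    simp only [List.map_cons, List.cons.injEq, and_true]
    have := (z (n + 1)).2.2 n hn
    exact this.trans ((congrArg _ (hpr n (n + 1)).symm).trans
      (lS_base b hσ (n + 1) (hy n) (by rw [pre_length]; omega)))
  exact (List.cons.inj h2).1

variable (k G c)

noncomputable def limCov : Cov k (limG k G c) (G 0) where
  f := fun a => a.1 0
  map_mem := fun p hp => hp 0
  surj := fun p hp hl => lim_surj 0 p hp hl
  inj := fun p hp q hq hl h => lim_inj hp hq 0 hl h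
  φ := fun b σ => lS b σ 0
  legal := fun b σ _ => lS_legal b σ 0
  loc := fun b σ τ n h p hp hl => lD_loc b h _ 0 p hp hl
  low := fun b σ hσ p hp hl => lS_base b hσ 0 hp hl
  lift := fun b hb σ hσ x hx hc => lim_lift b hb hσ x hx hc

end Limit
end BD


namespace BD
universe u

/-! ### Unravelling closed sets -/

section Closed
variable (G : GT.{u}) (C : Set (List G.α)) (k : ℕ)

structure QI (S : Set (List G.α)) (r : List G.α) : Prop where
  root : r ∈ S
  sub : ∀ q ∈ S, q ∈ G.T ∧ r <:+ q
  tail : ∀ a q, a :: q ∈ S → r <:+ q → q ∈ S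
  even : ∀ q ∈ S, q.length % 2 = 0 → ∃ a, a :: q ∈ S
  odd : ∀ q ∈ S, q.length % 2 = 1 → ∀ a, a :: q ∈ G.T → a :: q ∈ S

structure QII (S S' : Set (List G.α)) (r : List G.α) : Prop where
  root : r ∈ S'
  sub : ∀ q ∈ S', q ∈ S ∧ q ∈ C ∧ r <:+ q
  tail : ∀ a q, a :: q ∈ S' → r <:+ q → q ∈ S'
  odd : ∀ q ∈ S', q.length % 2 = 1 → ∃ a, a :: q ∈ S'
  even : ∀ q ∈ S', q.length % 2 = 0 → ∀ a, a :: q ∈ S → a :: q ∈ S'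

abbrev Lt : Type u := G.α × Set (List G.α) × Option (List G.α)

variable {G}

open Classical in
noncomputable def ltr (S S' : Set (List G.α)) (o : Option (List G.α)) (n : ℕ) (a : G.α) : Lt G :=
  (a, if n = k then S else if n = k + 1 then S' else ∅, if n = k + 1 then o else none)

noncomputable def enc (S S' : Set (List G.α)) (o : Option (List G.α)) : List G.α → List (Lt G)
  | [] => []
  | a :: p => ltr k S S' o p.length a :: enc S S' o p

def Acc (S S' : Set (List G.α)) (p : List G.α) : Prop :=
  ∃ r, r <:+ p ∧ r.length = k + 2 ∧ QII G C S S' r ∧ p ∈ S'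

def Rej (S : Set (List G.α)) (p u : List G.α) : Prop :=
  u ∈ S ∧ u ∉ C ∧ k + 2 ≤ u.length ∧ (p <:+ u ∨ u <:+ p)

structure Valid (S S' : Set (List G.α)) (o : Option (List G.α)) (p : List G.α) : Prop where
  mem : p ∈ G.T
  one : k + 1 ≤ p.length → ∃ r, r <:+ p ∧ r.length = k + 1 ∧ QI G S r
  two : k + 2 ≤ p.length → (o = none ∧ Acc C k S S' p) ∨ (∃ u, o = some u ∧ S' = ∅ ∧ Rej C k S p u)

theorem enc_length (S S' : Set (List G.α)) (o : Option (List G.α)) (p : List G.α) :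
    (enc k S S' o p).length = p.length := by
  induction p with
  | nil => rfl
  | cons a p ih => simp [enc, ih]

theorem enc_map (S S' : Set (List G.α)) (o : Option (List G.α)) (p : List G.α) :
    (enc k S S' o p).map Prod.fst = p := by
  induction p with
  | nil => rfl
  | cons a p ih => simp [enc, ih, ltr]

theorem enc_inj {S S' S1 S1' : Set (List G.α)} {o o1 : Option (List G.α)} {p p1 : List G.α}
    (h : enc k S S' o p = enc k S1 S1' o1 p1) :
    p = p1 ∧ (k < p.length → S = S1) ∧ (k + 1 < p.length → S' = S1' ∧ o = o1) := by
  have e : p = p1 := by rw [← enc_map k S S' o p, h, enc_map]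
  subst e
  refine ⟨rfl, ?_⟩
  induction p with
  | nil => simp
  | cons a p ih =>
    simp only [enc, List.cons.injEq] at h
    obtain ⟨h1, h2⟩ := ih h.2
    have h3 := h.1
    simp only [ltr, Prod.mk.injEq, true_and] at h3
    simp only [List.length_cons]
    constructor
    · intro hk
      rcases Nat.lt_or_ge k p.length with hl | hl
      · exact h1 hl
      · have : p.length = k := by omega
        simpa [this] using h3.1
    · intro hk
      rcases Nat.lt_or_ge (k + 1) p.length with hl | hl
      · exact h2 hl
      · have : p.length = k + 1 := by omega
        simpa [this] using h3

theorem enc_small {S S' S1 S1' : Set (List G.α)} {o o1 : Option (List G.α)} {p : List G.α}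
    (h1 : k < p.length → S = S1) (h2 : k + 1 < p.length → S' = S1' ∧ o = o1) :
    enc k S S' o p = enc k S1 S1' o1 p := by
  induction p with
  | nil => rfl
  | cons a p ih =>
    simp only [List.length_cons] at h1 h2
    simp only [enc, List.cons.injEq]
    refine ⟨?_, ih (fun h => h1 (by omega)) (fun h => h2 (by omega))⟩
    simp only [ltr, Prod.mk.injEq, true_and]
    constructor
    · split_ifs with h h'
      · exact h1 (by omega)
      · exact (h2 (by omega)).1
      · rfl
    · split_ifs with h
      · exact (h2 (by omega)).2
      · rfl

variable {C k}

theorem Valid.tail {S S' : Set (List G.α)} {o : Option (List G.α)} {a : G.α} {p : List G.α}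
    (h : Valid C k S S' o (a :: p)) : Valid C k S S' o p where
  mem := G.tail_mem _ _ h.mem
  one hl := by
    obtain ⟨r, hr, hrl, hQ⟩ := h.one (by simp; omega)
    refine ⟨r, ?_, hrl, hQ⟩
    rcases List.suffix_cons_iff.1 hr with h | h
    · subst h; simp at hrl; omega
    · exact h
  two hl := by
    rcases h.two (by simp; omega) with ⟨ho, r, hr, hrl, hQ, hm⟩ | ⟨u, ho, hS, h1, h2, h3, h4⟩
    · left
      have hr' : r <:+ p := by
        rcases List.suffix_cons_iff.1 hr with h | h
        · subst h; simp at hrl; omega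
        · exact h
      exact ⟨ho, r, hr', hrl, hQ, hQ.tail _ _ hm hr'⟩
    · right
      refine ⟨u, ho, hS, h1, h2, h3, ?_⟩
      rcases h4 with h4 | h4
      · exact Or.inl ((List.suffix_cons _ _).trans h4)
      · rcases List.suffix_cons_iff.1 h4 with h | h
        · subst h; exact Or.inl (List.suffix_cons _ _)
        · exact Or.inr h

theorem suffix_eq {α : Type u} {p q r : List α} (hp : p <:+ r) (hq : q <:+ r)
    (h : p.length = q.length) : p = q :=
  (List.suffix_of_suffix_length_le hp hq h.le).eq_of_length h

theorem suffix_next {α : Type u} {p u : List α} (h : p <:+ u) (hl : p.length < u.length) :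
    ∃ a, a :: p <:+ u := by
  obtain ⟨t, rfl⟩ := h
  rcases List.eq_nil_or_concat t with rfl | ⟨t', a, rfl⟩
  · simp at hl
  · exact ⟨a, t', by simp⟩

theorem QI.suffix {S : Set (List G.α)} {r : List G.α} (h : QI G S r) {p q : List G.α}
    (hr : r <:+ p) (hpq : p <:+ q) (hq : q ∈ S) : p ∈ S := by
  induction q with
  | nil => rw [List.suffix_nil] at hpq; exact hpq ▸ hq
  | cons a q ih =>
    rcases List.suffix_cons_iff.1 hpq with h1 | h1
    · exact h1 ▸ hq
    · exact ih h1 (h.tail _ _ hq (hr.trans h1))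

theorem valid_pruned (hk : k % 2 = 0) {S S' : Set (List G.α)} {o : Option (List G.α)}
    {p : List G.α} (h : Valid C k S S' o p) :
    ∃ a S1 S1' o1, Valid C k S1 S1' o1 (a :: p) ∧ enc k S S' o p = enc k S1 S1' o1 p := by
  rcases Nat.lt_or_ge p.length k with hl | hl
  · obtain ⟨a, ha⟩ := G.pruned p h.mem
    refine ⟨a, S, S', o, ⟨ha, ?_, ?_⟩, rfl⟩ <;> (simp; omega)
  rcases Nat.lt_or_ge p.length (k + 1) with hl1 | hl1
  · obtain ⟨a, ha⟩ := G.pruned p h.mem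
    refine ⟨a, {q | q ∈ G.T ∧ a :: p <:+ q}, S', o, ⟨ha, fun _ => ?_, ?_⟩, ?_⟩
    · refine ⟨a :: p, List.suffix_refl _, by simp; omega, ⟨⟨ha, List.suffix_refl _⟩, fun q hq => hq,
        fun b q hq hr => ⟨G.tail_mem _ _ hq.1, hr⟩, fun q hq _ => ?_, fun q hq _ b hb =>
        ⟨hb, hq.2.trans (List.suffix_cons _ _)⟩⟩⟩
      obtain ⟨b, hb⟩ := G.pruned q hq.1
      exact ⟨b, hb, hq.2.trans (List.suffix_cons _ _)⟩
    · simp; omega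
    · exact enc_small k (by omega) (by omega)
  obtain ⟨r, hr, hrl, hQ⟩ := h.one hl1
  rcases Nat.lt_or_ge p.length (k + 2) with hl2 | hl2
  · have e : r = p := hr.eq_of_length (by omega)
    subst e
    by_cases hu : ∃ u ∈ S, u ∉ C ∧ k + 2 ≤ u.length
    · obtain ⟨u, huS, huC, hul⟩ := hu
      obtain ⟨a, ha⟩ := suffix_next (hQ.sub u huS).2 (by omega)
      refine ⟨a, S, ∅, some u, ⟨G.suffix_mem ha (hQ.sub u huS).1, fun _ =>
        ⟨r, List.suffix_cons _ _, hrl, hQ⟩, fun _ => Or.inr ⟨u, rfl, rfl, huS, huC, hul,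
        Or.inl ha⟩⟩, enc_small k (fun _ => rfl) (by omega)⟩
    · push Not at hu
      obtain ⟨a, ha⟩ := G.pruned r h.mem
      have haS := hQ.odd r hQ.root (by omega) a ha
      refine ⟨a, S, {q | q ∈ S ∧ a :: r <:+ q}, none, ⟨ha, fun _ =>
        ⟨r, List.suffix_cons _ _, hrl, hQ⟩, fun _ => Or.inl ⟨rfl, a :: r, List.suffix_refl _,
          by simp; omega, ⟨⟨haS, List.suffix_refl _⟩, fun q hq => ⟨hq.1, ?_, hq.2⟩,
          fun b q hq hr => ⟨hQ.tail _ _ hq.1 ((List.suffix_cons _ _).trans hr), hr⟩,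
          fun q hq ho => ?_, fun q hq _ b hb => ⟨hb, hq.2.trans (List.suffix_cons _ _)⟩⟩,
          ⟨haS, List.suffix_refl _⟩⟩⟩, enc_small k (fun _ => rfl) (by omega)⟩
      · by_contra hc
        have h1 := hu q hq.1 hc
        have h2 := hq.2.length_le
        simp at h2; omega
      · obtain ⟨b, hb⟩ := G.pruned q (hQ.sub q hq.1).1
        exact ⟨b, hQ.odd q hq.1 ho b hb, hq.2.trans (List.suffix_cons _ _)⟩
  rcases h.two hl2 with ⟨ho, r2, hr2, hr2l, hQ2, hm⟩ | ⟨u, ho, hS, h1, h2, h3, h4⟩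
  · obtain ⟨a, ha⟩ : ∃ a, a :: p ∈ S' := by
      rcases Nat.mod_two_eq_zero_or_one p.length with he | he
      · obtain ⟨a, ha⟩ := hQ.even p (hQ2.sub p hm).1 he
        exact ⟨a, hQ2.even p hm he a ha⟩
      · exact hQ2.odd p hm he
    exact ⟨a, S, S', o, ⟨(hQ.sub _ (hQ2.sub _ ha).1).1, fun _ => ⟨r, hr.trans (List.suffix_cons _ _),
      hrl, hQ⟩, fun _ => Or.inl ⟨ho, r2, hr2.trans (List.suffix_cons _ _), hr2l, hQ2, ha⟩⟩, rfl⟩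
  · obtain ⟨a, haT, ha⟩ : ∃ a, a :: p ∈ G.T ∧ (a :: p <:+ u ∨ u <:+ a :: p) := by
      by_cases hup : u <:+ p
      · obtain ⟨a, ha⟩ := G.pruned p h.mem
        exact ⟨a, ha, Or.inr (hup.trans (List.suffix_cons _ _))⟩
      · have h4 := h4.resolve_right hup
        obtain ⟨a, ha⟩ := suffix_next h4 (by
          by_contra hc
          exact hup (h4.eq_of_length_le (by omega) ▸ List.suffix_refl _))
        exact ⟨a, G.suffix_mem ha (hQ.sub u h1).1, Or.inl ha⟩
    exact ⟨a, S, S', o, ⟨haT, fun _ => ⟨r, hr.trans (List.suffix_cons _ _),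
      hrl, hQ⟩, fun _ => Or.inr ⟨u, ho, hS, h1, h2, h3, ha⟩⟩, rfl⟩

variable (C k)

def clH (hk : k % 2 = 0) : GT.{u} where
  α := Lt G
  T := {q | ∃ S S' o p, q = enc k S S' o p ∧ Valid C k S S' o p}
  nil_mem := ⟨∅, ∅, none, [], rfl, G.nil_mem, by simp, by simp⟩
  tail_mem := by
    rintro a q ⟨S, S', o, p, hp, hv⟩
    cases p with
    | nil => simp [enc] at hp
    | cons b p =>
      simp only [enc, List.cons.injEq] at hp
      exact ⟨S, S', o, p, hp.2, hv.tail⟩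
  pruned := by
    rintro q ⟨S, S', o, p, rfl, hv⟩
    obtain ⟨a, S1, S1', o1, hv1, he⟩ := valid_pruned hk hv
    exact ⟨ltr k S1 S1' o1 p.length a, S1, S1', o1, a :: p, by rw [he]; rfl, hv1⟩

variable {C k}

theorem clH_mem {hk : k % 2 = 0} {S S' : Set (List G.α)} {o : Option (List G.α)} {p : List G.α}
    (h : Valid C k S S' o p) : enc k S S' o p ∈ (clH C k hk).T := ⟨S, S', o, p, rfl, h⟩

theorem clH_step {hk : k % 2 = 0} {σ : List (Lt G) → Lt G} (hσ : Legal (clH C k hk) σ)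
    {S S' : Set (List G.α)} {o : Option (List G.α)} {p : List G.α}
    (h : Valid C k S S' o p) :
    ∃ a S1 S1' o1, σ (enc k S S' o p) = ltr k S1 S1' o1 p.length a ∧
      Valid C k S1 S1' o1 (a :: p) ∧ (k < p.length → S1 = S) ∧
      (k + 1 < p.length → S1' = S' ∧ o1 = o) := by
  obtain ⟨S1, S1', o1, p1, he, hv⟩ := hσ _ (clH_mem h)
  cases p1 with
  | nil => simp [enc] at he
  | cons a p1 =>
    have he := List.cons.inj he
    obtain ⟨e1, e2, e3⟩ := enc_inj k he.2
    subst e1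
    exact ⟨a, S1, S1', o1, he.1, hv, fun h => (e2 h).symm,
      fun h => ⟨(e3 h).1.symm, (e3 h).2.symm⟩⟩

/-- consequence of `clH_step` for later moves -/
theorem clH_step' {hk : k % 2 = 0} {σ : List (Lt G) → Lt G} (hσ : Legal (clH C k hk) σ)
    {S S' : Set (List G.α)} {o : Option (List G.α)} {p : List G.α}
    (h : Valid C k S S' o p) (hl : k + 1 < p.length) :
    σ (enc k S S' o p) = ltr k S S' o p.length (σ (enc k S S' o p)).1 ∧
      Valid C k S S' o ((σ (enc k S S' o p)).1 :: p) := by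
  obtain ⟨a, S1, S1', o1, h1, h2, h3, h4⟩ := clH_step hσ h
  obtain rfl := h3 (by omega)
  obtain ⟨rfl, rfl⟩ := h4 hl
  have : (σ (enc k S1 S1' o1 p)).1 = a := by rw [h1]; rfl
  rw [this]
  exact ⟨h1, h2⟩

end Closed
end BD


namespace BD
universe u

section Closed2
variable {G : GT.{u}} (C : Set (List G.α)) (k : ℕ)

instance GT.instNonempty (G : GT.{u}) : Nonempty G.α := G.nonempty

def cut {α : Type u} (p : List α) (m : ℕ) : List α := p.drop (p.length - m)

theorem cut_pre {α : Type u} (x : ℕ → α) {m n : ℕ} (h : m ≤ n) : cut (pre x n) m = pre x m :=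
  pre_drop x h

open Classical in
noncomputable def clip (hk : k % 2 = 0) (σ : List (Lt G) → Lt G) (n : ℕ) (q : List (Lt G)) : Lt G :=
  if q ∈ (clH C k hk).T ∧ q.length = n then σ q else Classical.choice inferInstance

theorem clip_eq (hk : k % 2 = 0) (σ : List (Lt G) → Lt G) {S S' : Set (List G.α)}
    {o : Option (List G.α)} {p : List G.α} (h : Valid C k S S' o p) {n : ℕ} (hn : p.length = n) :
    clip C k hk σ n (enc k S S' o p) = σ (enc k S S' o p) := by
  rw [clip, if_pos ⟨clH_mem h, by rw [enc_length, hn]⟩]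

theorem clip_loc (hk : k % 2 = 0) (σ τ : List (Lt G) → Lt G) (n m : ℕ) (hm : m < n)
    (h : ∀ p ∈ (clH C k hk).T, p.length < n → σ p = τ p) :
    clip C k hk σ m = clip C k hk τ m := by
  funext q
  simp only [clip]
  split_ifs with h1
  · exact h _ h1.1 (h1.2.trans_lt hm)
  · rfl

def IsAnc {α : Type u} (U : Set (List α)) (p w : List α) : Prop :=
  w <:+ p ∧ w ∈ U ∧ ∀ w' ∈ U, w' <:+ p → w.length ≤ w'.length

theorem IsAnc.unique {α : Type u} {U : Set (List α)} {p w w' : List α} (h : IsAnc U p w)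
    (h' : IsAnc U p w') : w = w' :=
  suffix_eq h.1 h'.1 (le_antisymm (h.2.2 _ h'.2.1 h'.1) (h'.2.2 _ h.2.1 h.1))

def UA (S : Set (List G.α)) : Set (List G.α) := {w | w ∈ S ∧ w ∉ C ∧ k + 2 ≤ w.length}

def SigA (S : Set (List G.α)) (r : List G.α) : Set (List G.α) :=
  {q | q ∈ S ∧ r <:+ q ∧ ∀ q', r <:+ q' → q' <:+ q → ¬ Win 0 S (UA C k S) q'}

open Classical in
noncomputable def fA (S : Set (List G.α)) (s : List (Lt G) → Lt G) (p : List G.α) : G.α :=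
  if h : ∃ w, IsAnc (UA C k S) p w then (s (enc k S ∅ (some h.choose) p)).1
  else if Win 0 S (UA C k S) p then att 0 S (UA C k S) p
  else (s (enc k S (SigA C k S (cut p (k + 2))) none p)).1

def UB (s : List (Lt G) → Lt G) (r : List G.α) : Set (List G.α) :=
  {w | ∃ S, QI G S r ∧ (s (enc k S ∅ none r)).2.2 = some w}

noncomputable def Sw (s : List (Lt G) → Lt G) (r w : List G.α) : Set (List G.α) :=
  Classical.epsilon fun S => QI G S r ∧ (s (enc k S ∅ none r)).2.2 = some w

def SigB (s : List (Lt G) → Lt G) (r : List G.α) : Set (List G.α) :=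
  {q | q ∈ G.T ∧ r <:+ q ∧ ∀ q', r <:+ q' → q' <:+ q → ¬ Win 1 G.T (UB k s r) q'}

open Classical in
noncomputable def fB (s2 s : List (Lt G) → Lt G) (r p : List G.α) : G.α :=
  if h : ∃ w, IsAnc (UB k s2 r) p w then (s (enc k (Sw k s2 r h.choose) ∅ (some h.choose) p)).1
  else if Win 1 G.T (UB k s2 r) p then att 1 G.T (UB k s2 r) p
  else (s (enc k (SigB k s2 r) (s2 (enc k (SigB k s2 r) ∅ none r)).2.1 none p)).1

open Classical in
noncomputable def clφ (hk : k % 2 = 0) (b : ℕ) (σ : List (Lt G) → Lt G) (p : List G.α) : G.α :=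
  G.fix p (if p.length ≤ k then (clip C k hk σ p.length (enc k ∅ ∅ none p)).1
    else if b = 0 then
      fA C k (clip C k hk σ k (enc k ∅ ∅ none (cut p k))).2.1 (clip C k hk σ p.length) p
    else fB k (clip C k hk σ (k + 1)) (clip C k hk σ p.length) (cut p (k + 1)) p)

variable {C k}

theorem valid_small {S S' : Set (List G.α)} {o : Option (List G.α)} {p : List G.α} (hp : p ∈ G.T)
    (hl : p.length ≤ k) : Valid C k S S' o p := ⟨hp, by omega, by omega⟩

theorem clφ_loc (hk : k % 2 = 0) (b : ℕ) (σ τ : List (Lt G) → Lt G) (n : ℕ)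
    (h : ∀ p ∈ (clH C k hk).T, p.length < n → σ p = τ p) (p : List G.α) (hl : p.length < n) :
    clφ C k hk b σ p = clφ C k hk b τ p := by
  have e := fun m hm => clip_loc C k hk σ τ n m hm h
  simp only [clφ]
  congr 1
  rw [e _ hl]
  split_ifs with h1 h2
  · rfl
  · rw [e k (by omega)]
  · rw [e (k + 1) (by omega)]

theorem clφ_low (hk : k % 2 = 0) (b : ℕ) {σ : List (Lt G) → Lt G} (hσ : Legal (clH C k hk) σ)
    {S S' : Set (List G.α)} {o : Option (List G.α)} {p : List G.α} (hp : p ∈ G.T)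
    (hl : p.length ≤ k) : clφ C k hk b σ p = (σ (enc k S S' o p)).1 := by
  rw [clφ, if_pos hl, clip_eq C k hk σ (valid_small hp hl) rfl,
    enc_small (S1 := S) (S1' := S') (o1 := o) k (by omega) (by omega)]
  obtain ⟨a, S1, S1', o1, h1, h2, -⟩ := clH_step hσ (valid_small (S := S) (S' := S') (o := o) hp hl)
  rw [h1]
  exact G.fix_eq h2.mem

theorem pre_enc {S S' : Set (List G.α)} {o : Option (List G.α)} (x : ℕ → G.α) (n : ℕ) :
    pre (fun n => ltr k S S' o n (x n)) n = enc k S S' o (pre x n) := by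
  induction n with
  | zero => rfl
  | succ n ih => simp [pre, enc, ih, pre_length]

/-- putting together a lifted play -/
theorem lift_of (hk : k % 2 = 0) (b : ℕ) {σ : List (Lt G) → Lt G}
    (hσ : Legal (clH C k hk) σ) {x : ℕ → G.α} 
    {S S' : Set (List G.α)} {o : Option (List G.α)} (hv : ∀ n, Valid C k S S' o (pre x n))
    (h1 : ∀ n, n % 2 = b → n ≤ k + 1 → σ (enc k S S' o (pre x n)) = ltr k S S' o n (x n))
    (h2 : ∀ n, n % 2 = b → k + 2 ≤ n → x n = (σ (enc k S S' o (pre x n))).1) :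
    ∃ y ∈ GBody (clH C k hk), Cons b σ y ∧ Prod.fst ∘ y = x := by
  refine ⟨fun n => ltr k S S' o n (x n), fun n => ?_, fun n hn => ?_, ?_⟩
  · have := clH_mem (hk := hk) (hv n)
    rwa [← pre_enc] at this
  · refine Eq.symm ((congrArg σ (pre_enc x n)).trans ?_)
    rcases Nat.lt_or_ge n (k + 2) with hl | hl
    · exact h1 n hn (by omega)
    · have := (clH_step' hσ (hv n) (by rw [pre_length]; omega)).1
      rw [this, ← h2 n hn hl, pre_length]
  · funext n; rfl

theorem low_step (hk : k % 2 = 0) (b : ℕ) {σ : List (Lt G) → Lt G}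
    (hσ : Legal (clH C k hk) σ) {x : ℕ → G.α} (hx : x ∈ GBody G)
    {S S' : Set (List G.α)} {o : Option (List G.α)} {n : ℕ} (hn : n < k)
    (hc : x n = clφ C k hk b σ (pre x n)) :
    σ (enc k S S' o (pre x n)) = ltr k S S' o n (x n) := by
  have hl : (pre x n).length ≤ k := by rw [pre_length]; omega
  rw [clφ_low hk b hσ (S := S) (S' := S') (o := o) (hx n) hl] at hc
  obtain ⟨a, S1, S1', o1, h1, -⟩ := clH_step hσ (valid_small (S := S) (S' := S') (o := o) (hx n) hl)
  rw [h1, pre_length] at hc ⊢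
  rw [hc]
  simp [ltr, show n ≠ k by omega, show n ≠ k + 1 by omega]

/-- along a rejected play the moves before reaching the witness are forced -/
theorem forced (hk : k % 2 = 0) {σ : List (Lt G) → Lt G}
    (hσ : Legal (clH C k hk) σ) {x : ℕ → G.α} {S : Set (List G.α)} {m n : ℕ}
    (hv : Valid C k S ∅ (some (pre x m)) (pre x n)) (hn : k + 2 ≤ n) (hnm : n < m) :
    x n = (σ (enc k S ∅ (some (pre x m)) (pre x n))).1 := by
  have h := (clH_step' hσ hv (by rw [pre_length]; omega)).2
  rcases h.two (by simp [pre_length]; omega) with ⟨h0, -⟩ | ⟨w, hw, -, -, -, -, h1⟩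
  · simp at h0
  · obtain rfl := Option.some.inj hw
    have h2 : pre x (n + 1) = _ := suffix_eq (pre_suffix x hnm) (r := pre x m) (q := (σ (enc k S ∅ (some (pre x m)) (pre x n))).1 :: pre x n) (by
      rcases h1 with h1 | h1
      · exact h1
      · exact ⟨[], (h1.eq_of_length_le (by simp [pre_length]; omega)).symm⟩) (by simp [pre_length])
    exact (List.cons.inj h2).1

theorem lift_I (hk : k % 2 = 0) {σ : List (Lt G) → Lt G}
    (hσ : Legal (clH C k hk) σ) {x : ℕ → G.α} (hx : x ∈ GBody G) (hc : Cons 0 (clφ C k hk 0 σ) x) :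
    ∃ y ∈ GBody (clH C k hk), Cons 0 σ y ∧ Prod.fst ∘ y = x := by
  obtain ⟨a, S, S1', o1, hs1, hs2, -⟩ := clH_step hσ
    (valid_small (S := ∅) (S' := ∅) (o := none) (hx k) (by rw [pre_length]))
  have hck := hc k hk
  rw [clφ_low hk 0 hσ (S := ∅) (S' := ∅) (o := none) (hx k) (by rw [pre_length]), hs1] at hck
  have hxa : x k = a := hck
  subst hxa
  rw [pre_length] at hs1
  have hS : (clip C k hk σ k (enc k ∅ ∅ none (pre x k))).2.1 = S := by
    rw [clip_eq C k hk σ (valid_small (hx k) (by rw [pre_length])) (pre_length x k), hs1]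
    simp [ltr]
  have hQ : QI G S (pre x (k + 1)) := by
    obtain ⟨r, hr, hrl, hQ⟩ := hs2.one (by simp [pre_length])
    have : r = pre x (k + 1) := by
      have := suffix_pre x (n := k + 1) hr
      rwa [hrl] at this
    exact this ▸ hQ
  -- unfolding of the strategy
  have hF : ∀ n, n % 2 = 0 → k + 2 ≤ n →
      x n = G.fix (pre x n) (fA C k S (clip C k hk σ n) (pre x n)) := by
    intro n hn hl
    have h := hc n hn
    rw [clφ, pre_length, if_neg (by omega), if_pos rfl, cut_pre x (by omega), hS] at h
    exact h
  have hstart : ∀ S' o n, n % 2 = 0 → n ≤ k + 1 →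
      σ (enc k S S' o (pre x n)) = ltr k S S' o n (x n) := by
    intro S' o n hn hl
    rcases Nat.lt_or_ge n k with h | h
    · exact low_step hk 0 hσ hx h (hc n hn)
    · have : n = k := by omega
      subst this
      rw [enc_small (S1 := ∅) (S1' := ∅) (o1 := none) n (by simp [pre_length])
        (by rw [pre_length]; omega), hs1]
      simp [ltr]
  have hone : ∀ n, k + 1 ≤ (pre x n).length →
      ∃ r, r <:+ pre x n ∧ r.length = k + 1 ∧ QI G S r := by
    intro n hn
    exact ⟨_, pre_suffix x (by rwa [pre_length] at hn), pre_length _ _, hQ⟩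
  by_cases hU : ∃ m, pre x m ∈ UA C k S
  · classical
    obtain ⟨m, hm, hmin⟩ : ∃ m, pre x m ∈ UA C k S ∧ ∀ n, pre x n ∈ UA C k S → m ≤ n :=
      ⟨Nat.find hU, Nat.find_spec hU, fun n hn => Nat.find_min' hU hn⟩
    have hv : ∀ n, Valid C k S ∅ (some (pre x m)) (pre x n) := by
      intro n
      refine ⟨hx n, hone n, fun hl => Or.inr ⟨_, rfl, rfl, hm.1, hm.2.1, hm.2.2, ?_⟩⟩
      rcases le_total n m with h | h
      · exact Or.inl (pre_suffix x h)
      · exact Or.inr (pre_suffix x h)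
    refine lift_of hk 0 hσ hv (hstart _ _) ?_
    intro n hn hl
    rcases Nat.lt_or_ge n m with hnm | hnm
    · exact forced hk hσ (hv n) hl hnm
    · have hanc : IsAnc (UA C k S) (pre x n) (pre x m) := by
        refine ⟨pre_suffix x hnm, hm, fun w hw hwn => ?_⟩
        rw [suffix_pre x hwn] at hw ⊢
        simpa [pre_length] using hmin _ hw
      have h : ∃ w, IsAnc (UA C k S) (pre x n) w := ⟨_, hanc⟩
      rw [hF n hn hl, fA, dif_pos h, h.choose_spec.unique hanc,
        clip_eq C k hk σ (hv n) (pre_length x n)]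
      exact G.fix_eq (clH_step' hσ (hv n) (by rw [pre_length]; omega)).2.mem
  · push Not at hU
    have hanc : ∀ n, ¬ ∃ w, IsAnc (UA C k S) (pre x n) w := by
      rintro n ⟨w, hw, hwU, -⟩
      rw [suffix_pre x hw] at hwU
      exact hU _ hwU
    have hodd : ∀ n, n % 2 ≠ 0 → pre x n ∈ S → pre x (n + 1) ∈ S := by
      intro n hn hnS
      exact hQ.odd _ hnS (by rw [pre_length]; omega) _ (hx (n + 1))
    have hnw := not_win_of_att (b := 0) (M := S) (U := UA C k S) (x := x) (N := k + 2)
      (fun n _ => hU n) (fun n _ hn => hodd n hn) (by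
        intro n hn hb hnS hw
        rw [hF n hb hn, fA, dif_neg (hanc n), if_pos hw]
        exact G.fix_eq (hQ.sub _ (att_spec hw (hU n) (by rwa [pre_length])).1).1)
    have hr2 : pre x (k + 2) ∈ S := hodd _ (by omega) hQ.root
    have hQ2 : QII G C S (SigA C k S (pre x (k + 2))) (pre x (k + 2)) := by
      refine ⟨⟨hr2, List.suffix_refl _, ?_⟩, ?_, ?_, ?_, ?_⟩
      · intro q' h1 h2
        have : q' = pre x (k + 2) := h2.eq_of_length_le h1.length_le
        rw [this]
        exact hnw _ le_rfl hr2
      · intro q hq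
        refine ⟨hq.1, ?_, hq.2.1⟩
        by_contra hqC
        refine hq.2.2 q hq.2.1 (List.suffix_refl _) (Win.of_tgt ⟨hq.1, hqC, ?_⟩)
        simpa [pre_length] using hq.2.1.length_le
      · intro a q hq hr
        exact ⟨hQ.tail _ _ hq.1 ((pre_suffix x (by omega)).trans hr), hr,
          fun q' h1 h2 => hq.2.2 q' h1 (h2.trans (List.suffix_cons _ _))⟩
      · intro q hq ho
        by_contra hcon
        push Not at hcon
        refine hq.2.2 q hq.2.1 (List.suffix_refl _) (Win.of_opp (by omega) ?_)
        intro a ha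
        by_contra hw
        refine hcon a ⟨ha, hq.2.1.trans (List.suffix_cons _ _), ?_⟩
        intro q' h1 h2
        rcases List.suffix_cons_iff.1 h2 with h | h
        · rw [h]; exact hw
        · exact hq.2.2 q' h1 h
      · intro q hq he a ha
        refine ⟨ha, hq.2.1.trans (List.suffix_cons _ _), ?_⟩
        intro q' h1 h2
        rcases List.suffix_cons_iff.1 h2 with h | h
        · rw [h]; intro hw
          exact hq.2.2 q hq.2.1 (List.suffix_refl _) (Win.of_own he ha hw)
        · exact hq.2.2 q' h1 h
    have hmk : ∀ n, pre x n ∈ SigA C k S (pre x (k + 2)) → k + 2 ≤ n →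
        Valid C k S (SigA C k S (pre x (k + 2))) none (pre x n) := by
      intro n hn hl
      exact ⟨hx n, hone n, fun _ => Or.inl ⟨rfl, _, pre_suffix x hl, pre_length _ _, hQ2, hn⟩⟩
    have hmv : ∀ n, pre x n ∈ SigA C k S (pre x (k + 2)) → k + 2 ≤ n → n % 2 = 0 →
        x n = (σ (enc k S (SigA C k S (pre x (k + 2))) none (pre x n))).1 := by
      intro n hn hl hb
      have hv := hmk n hn hl
      rw [hF n hb hl, fA, dif_neg (hanc n), if_neg (hnw n hl hn.1), cut_pre x hl,
        clip_eq C k hk σ hv (pre_length x n)]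
      exact G.fix_eq (clH_step' hσ hv (by rw [pre_length]; omega)).2.mem
    have hall : ∀ d, pre x (k + 2 + d) ∈ SigA C k S (pre x (k + 2)) := by
      intro d
      induction d with
      | zero => exact hQ2.root
      | succ d ih =>
        have hS' : pre x (k + 2 + d + 1) ∈ S := by
          by_cases hb : (k + 2 + d) % 2 = 0
          · have hv := hmk _ ih (by omega)
            have h1 := hmv _ ih (by omega) hb
            have h2 := (clH_step' hσ hv (by rw [pre_length]; omega)).2
            rw [← h1] at h2
            rcases h2.two (by simp [pre_length]; omega) with ⟨_, r, _, _, hQ', hm⟩ | ⟨w, hw, _⟩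
            · exact (hQ'.sub _ hm).1
            · simp at hw
          · exact hodd _ hb ih.1
        refine ⟨hS', pre_suffix x (by omega), ?_⟩
        intro q' h1 h2
        rcases List.suffix_cons_iff.1 h2 with h | h
        · rw [h]; exact hnw (k + 2 + d + 1) (by omega) hS'
        · exact ih.2.2 q' h1 h
    have hall' : ∀ n, k + 2 ≤ n → pre x n ∈ SigA C k S (pre x (k + 2)) := by
      intro n hn
      have := hall (n - (k + 2))
      rwa [show k + 2 + (n - (k + 2)) = n by omega] at this
    have hv : ∀ n, Valid C k S (SigA C k S (pre x (k + 2))) none (pre x n) := by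
      intro n
      rcases Nat.lt_or_ge n (k + 2) with h | h
      · exact ⟨hx n, hone n, by rw [pre_length]; omega⟩
      · exact hmk n (hall' n h) h
    exact lift_of hk 0 hσ hv (hstart _ _) (fun n hn hl => hmv n (hall' n hl) hl hn)

end Closed2
end BD


namespace BD
universe u

section Closed3
variable {G : GT.{u}} {C : Set (List G.α)} {k : ℕ}

theorem lift_II (hk : k % 2 = 0) {σ : List (Lt G) → Lt G}
    (hσ : Legal (clH C k hk) σ) {x : ℕ → G.α} (hx : x ∈ GBody G) (hc : Cons 1 (clφ C k hk 1 σ) x) :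
    ∃ y ∈ GBody (clH C k hk), Cons 1 σ y ∧ Prod.fst ∘ y = x := by
  obtain ⟨r, hr⟩ : ∃ r, r = pre x (k + 1) := ⟨_, rfl⟩
  have hrl : r.length = k + 1 := by rw [hr, pre_length]
  obtain ⟨s2, hs2⟩ : ∃ s2, s2 = clip C k hk σ (k + 1) := ⟨_, rfl⟩
  have hvr : ∀ S S' o, QI G S r → Valid C k S S' o r := fun S S' o hQ =>
    ⟨hr ▸ hx _, fun _ => ⟨r, List.suffix_refl _, hrl, hQ⟩, by omega⟩
  have hs2v : ∀ S S' o, QI G S r → s2 (enc k S S' o r) = σ (enc k S S' o r) := by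
    intro S S' o hQ
    rw [hs2, clip_eq C k hk σ (hvr S S' o hQ) hrl]
  have hF : ∀ n, n % 2 = 1 → k + 1 ≤ n →
      x n = G.fix (pre x n) (fB k s2 (clip C k hk σ n) r (pre x n)) := by
    intro n hn hl
    have h := hc n hn
    rw [clφ, pre_length, if_neg (by omega), if_neg (by omega), cut_pre x (by omega), ← hr, ← hs2]
      at h
    exact h
  have hstart : ∀ S S' o n, n % 2 = 1 → n < k →
      σ (enc k S S' o (pre x n)) = ltr k S S' o n (x n) := by
    intro S S' o n hn hl
    exact low_step hk 1 hσ hx hl (hc n hn)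
  have hone : ∀ S, QI G S r → ∀ n, k + 1 ≤ (pre x n).length →
      ∃ r, r <:+ pre x n ∧ r.length = k + 1 ∧ QI G S r := by
    intro S hQ n hn
    exact ⟨_, hr ▸ pre_suffix x (by rwa [pre_length] at hn), hrl, hQ⟩
  -- the answers of `σ` at stage `k+1`
  have hans : ∀ S, QI G S r → ∃ a S1' o1, σ (enc k S ∅ none r) = ltr k S S1' o1 (k + 1) a ∧
      Valid C k S S1' o1 (a :: r) := by
    intro S hQ
    obtain ⟨a, S1, S1', o1, h1, h2, h3, -⟩ := clH_step hσ (hvr S ∅ none hQ)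
    obtain rfl := h3 (by omega)
    rw [hrl] at h1
    exact ⟨a, S1', o1, h1, h2⟩
  have henc : ∀ S S' o, enc k S S' o (pre x (k + 1)) = enc k S ∅ none r := by
    intro S S' o
    rw [← hr]
    exact enc_small k (fun _ => rfl) (by omega)
  by_cases hU : ∃ m, pre x m ∈ UB k s2 r
  · classical
    obtain ⟨m, hm, hmin⟩ : ∃ m, pre x m ∈ UB k s2 r ∧ ∀ n, pre x n ∈ UB k s2 r → m ≤ n :=
      ⟨Nat.find hU, Nat.find_spec hU, fun n hn => Nat.find_min' hU hn⟩
    have hsw : QI G (Sw k s2 r (pre x m)) r ∧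
      (s2 (enc k (Sw k s2 r (pre x m)) ∅ none r)).2.2 = some (pre x m) := Classical.epsilon_spec hm
    obtain ⟨S, hSdef⟩ : ∃ S, S = Sw k s2 r (pre x m) := ⟨_, rfl⟩
    rw [← hSdef] at hsw
    obtain ⟨hQ, hso⟩ := hsw
    rw [hs2v _ _ _ hQ] at hso
    obtain ⟨a, S1', o1, h1, h2⟩ := hans S hQ
    have ho1 : o1 = some (pre x m) := by rw [h1] at hso; simpa [ltr] using hso
    subst ho1
    obtain ⟨rfl, hrej⟩ : S1' = ∅ ∧ Rej C k S (a :: r) (pre x m) := by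
      rcases h2.two (by simp; omega) with ⟨h0, -⟩ | ⟨w, hw, h3, h4⟩
      · simp at h0
      · obtain rfl := Option.some.inj hw
        exact ⟨h3, h4⟩
    have hml : k + 2 ≤ m := by simpa [pre_length] using hrej.2.2.1
    have hv : ∀ n, Valid C k S ∅ (some (pre x m)) (pre x n) := by
      intro n
      refine ⟨hx n, hone S hQ n, fun hl => Or.inr ⟨_, rfl, rfl, hrej.1, hrej.2.1, hrej.2.2.1, ?_⟩⟩
      rcases le_total n m with h | h
      · exact Or.inl (pre_suffix x h)
      · exact Or.inr (pre_suffix x h)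
    refine lift_of hk 1 hσ hv ?_ ?_
    · intro n hn hl
      rcases Nat.lt_or_ge n k with h | h
      · exact hstart _ _ _ n hn h
      · obtain rfl : n = k + 1 := by omega
        rw [henc, h1]
        have h3 : a :: r <:+ pre x m := by
          rcases hrej.2.2.2 with h | h
          · exact h
          · exact ⟨[], (h.eq_of_length_le (by simp [pre_length]; omega)).symm⟩
        have h4 := suffix_pre x h3
        simp only [List.length_cons, hrl, pre, List.cons.injEq] at h4
        rw [h4.1]
    · intro n hn hl
      rcases Nat.lt_or_ge n m with hnm | hnm
      · exact forced hk hσ (hv n) hl hnm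
      · have hanc : IsAnc (UB k s2 r) (pre x n) (pre x m) := by
          refine ⟨pre_suffix x hnm, hm, fun w hw hwn => ?_⟩
          rw [suffix_pre x hwn] at hw ⊢
          simpa [pre_length] using hmin _ hw
        have h : ∃ w, IsAnc (UB k s2 r) (pre x n) w := ⟨_, hanc⟩
        rw [hF n hn (by omega), fB, dif_pos h, h.choose_spec.unique hanc, ← hSdef,
          clip_eq C k hk σ (hv n) (pre_length x n)]
        exact G.fix_eq (clH_step' hσ (hv n) (by rw [pre_length]; omega)).2.mem
  · push Not at hU
    have hanc : ∀ n, ¬ ∃ w, IsAnc (UB k s2 r) (pre x n) w := by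
      rintro n ⟨w, hw, hwU, -⟩
      rw [suffix_pre x hw] at hwU
      exact hU _ hwU
    have hnw := not_win_of_att (b := 1) (M := G.T) (U := UB k s2 r) (x := x) (N := k + 1)
      (fun n _ => hU n) (fun n _ hn _ => hx (n + 1)) (by
        intro n hn hb hnS hw
        rw [hF n hb hn, fB, dif_neg (hanc n), if_pos hw]
        exact G.fix_eq (att_spec hw (hU n) (by rwa [pre_length])).1)
    have hQ : QI G (SigB k s2 r) r := by
      refine ⟨⟨hr ▸ hx _, List.suffix_refl _, ?_⟩, fun q hq => ⟨hq.1, hq.2.1⟩, ?_, ?_, ?_⟩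
      · intro q' h1 h2
        have : q' = r := h2.eq_of_length_le h1.length_le
        rw [this, hr]
        exact hr ▸ hnw _ le_rfl (hx _)
      · intro a q hq h
        exact ⟨G.tail_mem _ _ hq.1, h,
          fun q' h1 h2 => hq.2.2 q' h1 (h2.trans (List.suffix_cons _ _))⟩
      · intro q hq ho
        by_contra hcon
        push Not at hcon
        refine hq.2.2 q hq.2.1 (List.suffix_refl _) (Win.of_opp (by omega) ?_)
        intro a ha
        by_contra hw
        refine hcon a ⟨ha, hq.2.1.trans (List.suffix_cons _ _), ?_⟩
        intro q' h1 h2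
        rcases List.suffix_cons_iff.1 h2 with h | h
        · rw [h]; exact hw
        · exact hq.2.2 q' h1 h
      · intro q hq he a ha
        refine ⟨ha, hq.2.1.trans (List.suffix_cons _ _), ?_⟩
        intro q' h1 h2
        rcases List.suffix_cons_iff.1 h2 with h | h
        · rw [h]; intro hw
          exact hq.2.2 q hq.2.1 (List.suffix_refl _) (Win.of_own he ha hw)
        · exact hq.2.2 q' h1 h
    obtain ⟨S, hSdef⟩ : ∃ S, S = SigB k s2 r := ⟨_, rfl⟩
    rw [← hSdef] at hQ
    obtain ⟨a, S', o1, h1, h2⟩ := hans S hQ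
    have hacc : o1 = none ∧ Acc C k S S' (a :: r) := by
      rcases h2.two (by simp; omega) with h | ⟨w, hw, -, h4⟩
      · exact h
      · exfalso
        have hwU : w ∈ UB k s2 r := ⟨S, hQ, by rw [hs2v _ _ _ hQ, h1]; simp [ltr, hw]⟩
        have hwS : w ∈ SigB k s2 r := hSdef ▸ h4.1
        exact hwS.2.2 w hwS.2.1 (List.suffix_refl _) (Win.of_tgt hwU)
    obtain ⟨rfl, r2, hr2, hr2l, hQ2, hmem⟩ := hacc
    have hS' : (s2 (enc k S ∅ none r)).2.1 = S' := by
      rw [hs2v _ _ _ hQ, h1]; simp [ltr]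
    have hF' : ∀ n, n % 2 = 1 → k + 1 ≤ n →
        x n = G.fix (pre x n) (clip C k hk σ n (enc k S S' none (pre x n))).1 := by
      intro n hn hl
      rw [hF n hn hl, fB, dif_neg (hanc n), if_neg (hnw n hl (hx n)), ← hSdef, hS']
    have hxa : x (k + 1) = a := by
      have h := hF' (k + 1) (by omega) le_rfl
      rw [henc, ← hr, clip_eq C k hk σ (hvr S ∅ none hQ) hrl, h1] at h
      rw [h]
      exact G.fix_eq h2.mem
    have hr2x : r2 = pre x (k + 2) := by
      have e : a :: r = pre x (k + 2) := by rw [hr, ← hxa]; rfl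
      rw [e] at hr2
      have := suffix_pre x hr2
      rwa [hr2l] at this
    subst hr2x
    have hxS : ∀ n, k + 1 ≤ n → pre x n ∈ S := by
      intro n hn
      rw [hSdef]
      refine ⟨hx n, hr ▸ pre_suffix x hn, ?_⟩
      intro q' h3 h4
      rw [suffix_pre x h4]
      exact hnw _ (by have := h3.length_le; omega) (hx _)
    have hmk : ∀ n, pre x n ∈ S' → k + 2 ≤ n → Valid C k S S' none (pre x n) := by
      intro n hn hl
      exact ⟨hx n, hone S hQ n, fun _ => Or.inl ⟨rfl, _, pre_suffix x hl, pre_length _ _, hQ2, hn⟩⟩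
    have hmv : ∀ n, pre x n ∈ S' → k + 2 ≤ n → n % 2 = 1 →
        x n = (σ (enc k S S' none (pre x n))).1 := by
      intro n hn hl hb
      have hv := hmk n hn hl
      rw [hF' n hb (by omega), clip_eq C k hk σ hv (pre_length x n)]
      exact G.fix_eq (clH_step' hσ hv (by rw [pre_length]; omega)).2.mem
    have hall : ∀ d, pre x (k + 2 + d) ∈ S' := by
      intro d
      induction d with
      | zero => exact hQ2.root
      | succ d ih =>
        by_cases hb : (k + 2 + d) % 2 = 1
        · have hv := hmk _ ih (by omega)
          have h1 := hmv _ ih (by omega) hb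
          have h2 := (clH_step' hσ hv (by rw [pre_length]; omega)).2
          rw [← h1] at h2
          rcases h2.two (by simp [pre_length]; omega) with ⟨_, r, _, _, hQ', hm⟩ | ⟨w, hw, _⟩
          · exact hm
          · simp at hw
        · exact hQ2.even _ ih (by rw [pre_length]; omega) _ (hxS (k + 2 + d + 1) (by omega))
    have hall' : ∀ n, k + 2 ≤ n → pre x n ∈ S' := by
      intro n hn
      have := hall (n - (k + 2))
      rwa [show k + 2 + (n - (k + 2)) = n by omega] at this
    have hv : ∀ n, Valid C k S S' none (pre x n) := by
      intro n
      rcases Nat.lt_or_ge n (k + 2) with h | h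
      · exact ⟨hx n, hone S hQ n, by rw [pre_length]; omega⟩
      · exact hmk n (hall' n h) h
    refine lift_of hk 1 hσ hv ?_ (fun n hn hl => hmv n (hall' n hl) hl hn)
    intro n hn hl
    rcases Nat.lt_or_ge n k with h | h
    · exact hstart _ _ _ n hn h
    · obtain rfl : n = k + 1 := by omega
      rw [henc, h1, hxa]

variable (C k)

noncomputable def clCov (hk : k % 2 = 0) : Cov k (clH C k hk) G where
  f := Prod.fst
  map_mem := by
    rintro _ ⟨S, S', o, p, rfl, hv⟩
    exact (enc_map k S S' o p).symm ▸ hv.mem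
  surj p hp hl := ⟨enc k ∅ ∅ none p, clH_mem (valid_small hp hl), enc_map _ _ _ _ _⟩
  inj := by
    rintro _ ⟨S, S', o, p, rfl, hv⟩ _ ⟨S1, S1', o1, p1, rfl, hv1⟩ hl h
    have h' : p = p1 := (enc_map k S S' o p).symm.trans (h.trans (enc_map k S1 S1' o1 p1))
    subst h'
    have hl' : p.length ≤ k := (enc_length k S S' o p) ▸ hl
    exact enc_small k (by omega) (by omega)
  φ := clφ C k hk
  legal b σ hσ := G.fix_legal _
  loc b σ τ n h p _ hl := clφ_loc hk b σ τ n h p hl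
  low := by
    rintro b σ hσ _ ⟨S, S', o, p, rfl, hv⟩ hl
    have hl' : p.length < k := (enc_length k S S' o p) ▸ hl
    exact (congrArg (clφ C k hk b σ) (enc_map k S S' o p)).trans (clφ_low hk b hσ hv.mem hl'.le)
  lift b hb σ hσ x hx hc := by
    obtain rfl | rfl : b = 0 ∨ b = 1 := by omega
    · exact lift_I hk hσ hx hc
    · exact lift_II hk hσ hx hc

variable {C k}

theorem enc_flag {S S' : Set (List G.α)} {o : Option (List G.α)} {y : ℕ → Lt G} {p : List G.α}
    {n : ℕ} (h : pre y n = enc k S S' o p) (hn : k + 1 < n) : (y (k + 1)).2.2 = o := by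
  induction n generalizing p with
  | zero => omega
  | succ n ih =>
    have hl : p.length = n + 1 := by rw [← enc_length k S S' o p, ← h, pre_length]
    cases p with
    | nil => simp at hl
    | cons a p =>
      simp only [pre, enc, List.cons.injEq] at h
      simp only [List.length_cons, add_left_inj] at hl
      rcases Nat.lt_or_ge (k + 1) n with h1 | h1
      · exact ih h.2 h1
      · obtain rfl : n = k + 1 := by omega
        rw [h.1, hl]; simp [ltr]

theorem clH_clopen (hk : k % 2 = 0) (hC : ∀ a p, a :: p ∈ C → p ∈ C) (X : Set (ℕ → G.α))
    (hX : ∀ y ∈ GBody G, y ∈ X ↔ ∀ n, pre y n ∈ C) :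
    Clopen (clH C k hk) {y | (clCov C k hk).f ∘ y ∈ X} := by
  have hsuf : ∀ p q : List G.α, p <:+ q → q ∈ C → p ∈ C := by
    intro p q h hq
    induction q with
    | nil => rw [List.suffix_nil] at h; exact h ▸ hq
    | cons a q ih =>
      rcases List.suffix_cons_iff.1 h with h | h
      · exact h ▸ hq
      · exact ih h (hC _ _ hq)
  have key : ∀ y ∈ GBody (clH C k hk),
      ((clCov C k hk).f ∘ y ∈ X ↔ (show Lt G from y (k + 1)).2.2 = none) := by
    intro y hy
    have hb := (clCov C k hk).body hy
    rw [hX _ hb]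
    have hdec : ∀ n, k + 2 ≤ n → ∃ S S', Valid C k S S' (show Lt G from y (k + 1)).2.2
        (pre ((clCov C k hk).f ∘ y) n) := by
      intro n hn
      obtain ⟨S, S', o, p, he, hv⟩ := hy n
      have h1 : (show Lt G from y (k + 1)).2.2 = o := enc_flag he (by omega)
      refine ⟨S, S', ?_⟩
      rw [h1, ← pre_map, he]
      have : List.map (clCov C k hk).f (enc k S S' o p) = p := enc_map k S S' o p
      rw [this]
      exact hv
    generalize (show Lt G from y (k + 1)).2.2 = o at hdec
    constructor
    · intro h
      cases o with
      | none => rfl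
      | some w =>
        exfalso
        obtain ⟨S, S', hv⟩ := hdec (max (k + 2) w.length) (le_max_left _ _)
        rcases hv.two (by rw [pre_length]; exact le_max_left _ _) with ⟨h0, -⟩ | ⟨w', hw, -, h1, h2, h3, h4⟩
        · simp at h0
        · obtain rfl := Option.some.inj hw
          refine h2 (hsuf _ _ ?_ (h (max (k + 2) w.length)))
          rcases h4 with h4 | h4
          · exact ⟨[], (h4.eq_of_length_le (by rw [pre_length]; exact le_max_right _ _)).symm⟩
          · exact h4
    · rintro rfl n
      obtain ⟨S, S', hv⟩ := hdec (max (k + 2) n) (le_max_left _ _)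
      rcases hv.two (by rw [pre_length]; exact le_max_left _ _) with ⟨-, r, -, -, hQ, hm⟩ | ⟨w', hw, -⟩
      · exact hsuf _ _ (pre_suffix _ (le_max_right _ _)) (hQ.sub _ hm).2.1
      · simp at hw
  intro x hx
  refine ⟨k + 2, fun y hy h => ?_⟩
  have h1 := pre_val h (show k + 1 < k + 2 by omega)
  exact (key y hy).trans ((by rw [h1]) : _ ↔ _) |>.trans (key x hx).symm

theorem closed_cover (G : GT.{u}) (C : Set (List G.α)) (hC : ∀ a p, a :: p ∈ C → p ∈ C)
    (X : Set (ℕ → G.α)) (hX : ∀ y ∈ GBody G, y ∈ X ↔ ∀ n, pre y n ∈ C) (k : ℕ) :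
    ∃ (H : GT.{u}) (c : Cov k H G), Clopen H {y | c.f ∘ y ∈ X} := by
  have hk : (2 * k) % 2 = 0 := by omega
  exact ⟨clH C (2 * k) hk, (clCov C (2 * k) hk).mono (by omega), clH_clopen hk hC X hX⟩

end Closed3

end BD


namespace BD
universe u

/-! ### Borel sets can be unravelled -/

theorem open_cover (G : GT.{u}) (X : Set (ℕ → G.α)) (hX : OpenIn G X) (k : ℕ) :
    ∃ (H : GT.{u}) (c : Cov k H G), Clopen H {y | c.f ∘ y ∈ X} := by
  obtain ⟨H, c, hc⟩ := closed_cover G {p | ∃ y ∈ GBody G, y ∉ X ∧ ∃ n, pre y n = p} (by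
    rintro a p ⟨y, hy, hyX, n, hn⟩
    cases n with
    | zero => simp [pre] at hn
    | succ n =>
      simp only [pre, List.cons.injEq] at hn
      exact ⟨y, hy, hyX, n, hn.2⟩) Xᶜ (by
    intro y hy
    constructor
    · exact fun h n => ⟨y, hy, h, n, rfl⟩
    · intro h hyX
      obtain ⟨n, hn⟩ := hX y hy hyX
      obtain ⟨z, hz, hzX, m, hm⟩ := h n
      have : m = n := by rw [← pre_length z m, hm, pre_length]
      subst this
      exact hzX (hn z hz hm)) k
  refine ⟨H, c, fun x hx => ?_⟩
  obtain ⟨n, hn⟩ := hc x hx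
  exact ⟨n, fun y hy h => not_iff_not.1 (hn y hy h)⟩

def Unr {α : Type u} (X : Set (ℕ → α)) : Prop :=
  ∀ (G : GT.{u}) (h : G.α → α) (k : ℕ),
    ∃ (H : GT.{u}) (c : Cov k H G), Clopen H {y | h ∘ c.f ∘ y ∈ X}

theorem Unr.compl {α : Type u} {X : Set (ℕ → α)} (hX : Unr X) : Unr Xᶜ := by
  intro G h k
  obtain ⟨H, c, hc⟩ := hX G h k
  refine ⟨H, c, fun x hx => ?_⟩
  obtain ⟨n, hn⟩ := hc x hx
  exact ⟨n, fun y hy h => not_iff_not.2 (hn y hy h)⟩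

theorem unr_open {α : Type u} {X : Set (ℕ → α)}
    (hX : ∀ x ∈ X, ∃ n, ∀ y, pre y n = pre x n → y ∈ X) : Unr X := by
  intro G h k
  obtain ⟨H, c, hc⟩ := open_cover G {y | h ∘ y ∈ X} (by
    intro x _ hxX
    obtain ⟨n, hn⟩ := hX _ hxX
    refine ⟨n, fun y _ hyn => hn _ ?_⟩
    rw [← pre_map, ← pre_map, hyn]) k
  exact ⟨H, c, hc⟩

theorem Unr.iUnion {α : Type u} {X : ℕ → Set (ℕ → α)} (hX : ∀ i, Unr (X i)) : Unr (⋃ i, X i) := by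
  intro G h k
  have step : ∀ i (s : (G : GT.{u}) × (G.α → α)), ∃ (H : GT.{u}) (c : Cov (k + i) H s.1),
      Clopen H {y | s.2 ∘ c.f ∘ y ∈ X i} := fun i s => hX i s.1 s.2 (k + i)
  choose nH nc hnc using step
  let st : ℕ → (G : GT.{u}) × (G.α → α) := fun i => Nat.rec ⟨G, h⟩
    (fun i s => ⟨nH i s, s.2 ∘ (nc i s).f⟩) i
  let GG : ℕ → GT.{u} := fun i => (st i).1
  let hh : ∀ i, (GG i).α → α := fun i => (st i).2
  let cc : ∀ i, Cov (k + i) (GG (i + 1)) (GG i) := fun i => nc i (st i)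
  have hhs : ∀ i, hh (i + 1) = hh i ∘ (cc i).f := fun i => rfl
  have hcl : ∀ i, Clopen (GG (i + 1)) {y | hh (i + 1) ∘ y ∈ X i} := fun i => hnc i (st i)
  have hthr : ∀ (a : Thr k GG cc) i, hh i (a.1 i) = hh 0 (a.1 0) := by
    intro a i
    induction i with
    | zero => rfl
    | succ i ih => rw [hhs, Function.comp, a.2 i, ih]
  have hL : OpenIn (limG k GG cc) {y | h ∘ (limCov k GG cc).f ∘ y ∈ ⋃ i, X i} := by
    intro x hx hxX
    obtain ⟨i, hi⟩ := Set.mem_iUnion.1 hxX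
    have e : ∀ y : ℕ → Thr k GG cc, h ∘ (limCov k GG cc).f ∘ y =
        hh (i + 1) ∘ ((fun a : Thr k GG cc => a.1 (i + 1)) ∘ y) := by
      intro y
      funext n
      exact (hthr (y n) (i + 1)).symm
    have pm : ∀ (y : ℕ → Thr k GG cc) (n : ℕ), pre ((fun a : Thr k GG cc => a.1 (i + 1)) ∘ y) n =
        (pre y n).map (fun a => a.1 (i + 1)) := fun y n => (pre_map _ _ _).symm
    have hbd : ∀ y ∈ GBody (limG k GG cc),
        (fun a : Thr k GG cc => a.1 (i + 1)) ∘ y ∈ GBody (GG (i + 1)) := by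
      intro y hy n
      exact (congrArg (· ∈ (GG (i + 1)).T) (pm y n)).mpr (hy n (i + 1))
    obtain ⟨n, hn⟩ := hcl i _ (hbd x hx)
    refine ⟨n, fun y hy hyn => Set.mem_iUnion.2 ⟨i, ?_⟩⟩
    refine (congrArg (· ∈ X i) (e y)).mpr ((hn _ (hbd y hy) ?_).2 ?_)
    · exact (pm y n).trans ((congrArg _ hyn).trans (pm x n).symm)
    · exact (congrArg (· ∈ X i) (e x)).mp hi
  obtain ⟨H, c, hc⟩ := open_cover _ _ hL k
  exact ⟨H, (limCov k GG cc).comp c, hc⟩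

def fullG (α : Type u) [Nonempty α] : GT.{u} where
  α := α
  T := Set.univ
  nil_mem := trivial
  tail_mem _ _ _ := trivial
  pruned _ _ := ⟨Classical.choice inferInstance, trivial⟩

theorem Unr.determined {α : Type u} [Nonempty α] {X : Set (ℕ → α)} (hX : Unr X) :
    (∃ σ : List α → α, ∀ x, Cons 0 σ x → x ∈ X) ∨ (∃ σ : List α → α, ∀ x, Cons 1 σ x → x ∉ X) := by
  obtain ⟨H, c, hc⟩ := hX (fullG α) id 0
  have h : Determined (fullG α) X := c.determined (open_determined H _ hc.openIn)
  rcases h with ⟨σ, -, h⟩ | ⟨σ, -, h⟩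
  · exact Or.inl ⟨σ, fun x hx => h x (fun _ => trivial) hx⟩
  · exact Or.inr ⟨σ, fun x hx => h x (fun _ => trivial) hx⟩

/-- continuous preimages of measurable sets can be unravelled -/
theorem unr_of_measurable {α : Type u} {β : Type*} (𝒪 : Set (Set (ℕ → β)))
    (dec : (ℕ → α) → (ℕ → β))
    (h : ∀ A ∈ 𝒪, ∀ x, dec x ∈ A → ∃ n, ∀ y, pre y n = pre x n → dec y ∈ A)
    (X : Set (ℕ → β)) (hX : @MeasurableSet _ (MeasurableSpace.generateFrom 𝒪) X) :
    Unr (dec ⁻¹' X) := by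
  induction X, hX using MeasurableSpace.generateFrom_induction with
  | hC t ht _ => exact unr_open fun x hx => h t ht x hx
  | empty => exact unr_open fun x hx => hx.elim
  | compl t _ ih => exact ih.compl
  | iUnion f _ ih => rw [Set.preimage_iUnion]; exact Unr.iUnion ih

end BD


namespace BD
universe u

/-! ### Plays -/
section Plays
variable {α : Type u}

theorem pp_eq (x : ℕ → α) (n : ℕ) : playPrefix x n = (pre x n).reverse := by
  induction n with
  | zero => simp [playPrefix, pre]
  | succ n ih =>
    rw [pre, List.reverse_cons, ← ih, playPrefix, List.ofFn_succ_last]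
    rfl

theorem pp_length (x : ℕ → α) (n : ℕ) : (playPrefix x n).length = n := by simp [playPrefix]

theorem pp_succ (x : ℕ → α) (n : ℕ) : playPrefix x (n + 1) = playPrefix x n ++ [x n] := by
  rw [pp_eq, pp_eq, pre, List.reverse_cons]

theorem pp_prefix_le (x : ℕ → α) {m n : ℕ} (h : m ≤ n) : playPrefix x m <+: playPrefix x n := by
  rw [pp_eq, pp_eq, List.reverse_prefix]
  exact pre_suffix x h

theorem prefix_pp (x : ℕ → α) {p : List α} {n : ℕ} (h : p <+: playPrefix x n) :
    p = playPrefix x p.length := by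
  rw [pp_eq, ← List.reverse_reverse p, List.reverse_prefix] at h
  have := suffix_pre x h
  rw [pp_eq, ← List.length_reverse, ← this, List.reverse_reverse]

theorem pp_pre {x y : ℕ → α} {n : ℕ} : playPrefix x n = playPrefix y n ↔ pre x n = pre y n := by
  rw [pp_eq, pp_eq, List.reverse_inj]

theorem pp_congr {x y : ℕ → α} {n : ℕ} (h : playPrefix x n = playPrefix y n) {m : ℕ} (hm : m ≤ n) :
    playPrefix x m = playPrefix y m := pp_pre.2 (pre_congr (pp_pre.1 h) hm)

theorem pp_val {x y : ℕ → α} {n : ℕ} (h : playPrefix x n = playPrefix y n) {m : ℕ} (hm : m < n) :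
    x m = y m := pre_val (pp_pre.1 h) hm

theorem pp_ext {x y : ℕ → α} (h : ∀ n, playPrefix x n = playPrefix y n) : x = y := by
  funext n
  exact pp_val (h (n + 1)) (Nat.lt_succ_self n)

theorem pp_of_val {x y : ℕ → α} {n : ℕ} (h : ∀ m < n, x m = y m) :
    playPrefix x n = playPrefix y n := by
  induction n with
  | zero => rfl
  | succ n ih => rw [pp_succ, pp_succ, ih (fun m hm => h m (by omega)), h n (by omega)]

def recPos (F : List α → α) : ℕ → List α
  | 0 => []
  | n + 1 => F (recPos F n) :: recPos F n

def recSeq (F : List α → α) (n : ℕ) : α := F (recPos F n)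

theorem pre_recSeq (F : List α → α) (n : ℕ) : pre (recSeq F) n = recPos F n := by
  induction n with
  | zero => rfl
  | succ n ih => rw [pre, ih]; rfl

theorem recSeq_eq (F : List α → α) (n : ℕ) : recSeq F n = F (pre (recSeq F) n) := by
  rw [pre_recSeq]; rfl

theorem recSeq_unique {F : List α → α} {x : ℕ → α} {n : ℕ} (h : ∀ m < n, x m = F (pre x m)) :
    pre x n = pre (recSeq F) n := by
  induction n with
  | zero => rfl
  | succ n ih =>
    rw [pre, pre, recSeq_eq, ← ih (fun m hm => h m (by omega)), h n (by omega)]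

/-- The play which starts with `η` and then follows `s`. -/
def run [Inhabited α] (s : List α → α) (η : List α) : ℕ → α :=
  recSeq fun q => if q.length < η.length then η.getD q.length default else s q.reverse

theorem pp_getD [Inhabited α] (η : List α) : playPrefix (fun i => η.getD i default) η.length = η := by
  apply List.ext_getElem
  · rw [pp_length]
  · intro n h1 h2
    simp [playPrefix, h2]

theorem runs_start [Inhabited α] (s : List α → α) (η : List α) : playPrefix (run s η) η.length = η := by
  conv_rhs => rw [← pp_getD η]
  apply pp_of_val
  intro m hm
  rw [run, recSeq_eq, pre_length, if_pos hm]

theorem runs_step [Inhabited α] (s : List α → α) (η : List α) {n : ℕ} (hn : η.length ≤ n) :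
    run s η n = s (playPrefix (run s η) n) := by
  rw [pp_eq]
  conv_lhs => rw [run, recSeq_eq, pre_length, if_neg (by omega)]
  rfl

theorem start_val {x y : ℕ → α} {η : List α} (hx : playPrefix x η.length = η)
    (hy : playPrefix y η.length = η) : playPrefix x η.length = playPrefix y η.length :=
  hx.trans hy.symm

theorem runs_unique [Inhabited α] {s : List α → α} {η : List α} {x : ℕ → α}
    (h0 : playPrefix x η.length = η) (h : ∀ n, η.length ≤ n → x n = s (playPrefix x n)) :
    x = run s η := by
  apply pp_ext
  intro n
  induction n with
  | zero => rfl
  | succ n ih =>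
    rcases Nat.lt_or_ge n η.length with hl | hl
    · exact pp_congr (start_val h0 (runs_start s η)) hl
    · rw [pp_succ, pp_succ, h n hl, runs_step s η hl, ih]

theorem runs_shift [Inhabited α] (s : List α → α) (η : List α) {n : ℕ} (hn : η.length ≤ n) :
    run s (playPrefix (run s η) n) = run s η := by
  symm
  apply runs_unique
  · rw [pp_length]
  · intro m hm
    rw [pp_length] at hm
    exact runs_step s η (hn.trans hm)

/-- `x` passes through `η` and stays in `K` afterwards -/
def KPlay (K : Set (List α)) (η : List α) (x : ℕ → α) : Prop :=
  playPrefix x η.length = η ∧ ∀ n, η.length ≤ n → playPrefix x n ∈ K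

/-- from `η` on, `x` follows `s` at nodes satisfying `P` -/
def Foll (P : List α → Prop) (s : List α → α) (η : List α) (x : ℕ → α) : Prop :=
  ∀ n, η.length ≤ n → P (playPrefix x n) → x n = s (playPrefix x n)

def KLegal (K : Set (List α)) (s : List α → α) : Prop := ∀ δ ∈ K, δ ++ [s δ] ∈ K

theorem runs_foll [Inhabited α] (P : List α → Prop) (s : List α → α) (η : List α) :
    Foll P s η (run s η) := fun _ hn _ => runs_step s η hn

theorem runs_kplay [Inhabited α] {K : Set (List α)} {s : List α → α} (hs : KLegal K s) {η : List α}
    (hη : η ∈ K) : KPlay K η (run s η) := by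
  refine ⟨runs_start s η, fun n hn => ?_⟩
  induction n, hn using Nat.le_induction with
  | base => rw [runs_start]; exact hη
  | succ n hn ih => rw [pp_succ, runs_step s η hn]; exact hs _ ih

theorem KPlay.body {K T : Set (List α)} (hT : IsTree T) (hK : K ⊆ T) {η : List α} {x : ℕ → α}
    (h : KPlay K η x) : x ∈ Body T := by
  intro n
  exact hT (pp_prefix_le x (le_max_left n η.length)) (hK (h.2 _ (le_max_right _ _)))

open Classical in
noncomputable def kfix [Inhabited α] (K : Set (List α)) (δ : List α) (a : α) : α :=
  if δ ++ [a] ∈ K then a else if h : ∃ a, δ ++ [a] ∈ K then h.choose else a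

theorem kfix_eq [Inhabited α] {K : Set (List α)} {δ : List α} {a : α} (h : δ ++ [a] ∈ K) :
    kfix K δ a = a := by simp [kfix, h]

theorem kfix_legal [Inhabited α] {K : Set (List α)} (hK : ∀ δ ∈ K, ∃ a, δ ++ [a] ∈ K)
    (s : List α → α) : KLegal K (fun δ => kfix K δ (s δ)) := by
  intro δ hδ
  simp only [kfix]
  split_ifs with h h'
  · exact h
  · exact h'.choose_spec
  · exact absurd (hK δ hδ) h'

end Plays

/-! ### Determinacy of games on trees with arbitrary turn order -/
section Det
variable {α : Type u} [Inhabited α]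

open Classical in
noncomputable def decS (K : Set (List α)) (own : List α → Prop) (η : List α) (x : ℕ → α)
    (δ : List α) : α :=
  kfix K δ (if own δ then x (2 * (δ.length - η.length)) else x (2 * (δ.length - η.length) + 1))

noncomputable def dec (K : Set (List α)) (own : List α → Prop) (η : List α) (x : ℕ → α) : ℕ → α :=
  run (decS K own η x) η

theorem dec_congr {K : Set (List α)} {own : List α → Prop} {η : List α} {x y : ℕ → α} {n : ℕ}
    (h : pre x (2 * n) = pre y (2 * n)) :
    playPrefix (dec K own η x) (η.length + n) = playPrefix (dec K own η y) (η.length + n) := by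
  induction n with
  | zero => exact start_val (runs_start _ _) (runs_start _ _)
  | succ n ih =>
    have ih' := ih (pre_congr h (by omega))
    rw [← Nat.add_assoc, pp_succ, pp_succ, ih']
    congr 2
    rw [dec, dec, runs_step _ _ (by omega), runs_step _ _ (by omega)]
    rw [dec, dec] at ih'
    rw [ih', decS, decS, pp_length, pre_val h (show 2 * (η.length + n - η.length) < _ by omega),
      pre_val h (show 2 * (η.length + n - η.length) + 1 < _ by omega)]

theorem unr_dec {T K : Set (List α)} (hT : IsTree T) (hKT : K ⊆ T)
    (hK : ∀ δ ∈ K, ∃ a, δ ++ [a] ∈ K) (own : List α → Prop) {η : List α} (hη : η ∈ K)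
    (X : Set (ℕ → α))
    (hX : @MeasurableSet _ (MeasurableSpace.generateFrom {A | IsOpenIn T A}) X) :
    Unr (dec K own η ⁻¹' X) := by
  refine unr_of_measurable _ _ ?_ X hX
  rintro A ⟨S, hS, rfl⟩ x hx
  simp only [Set.mem_iUnion] at hx ⊢
  obtain ⟨γ, hγ, hb, hγx⟩ := hx
  refine ⟨2 * γ.length, fun y hy => ⟨γ, hγ, ?_, ?_⟩⟩
  · exact (runs_kplay (kfix_legal hK _) hη).body hT hKT
  · rw [← pp_congr (dec_congr hy.symm) (by omega)]
    exact hγx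

theorem foll_kfix {K : Set (List α)} {own : List α → Prop} {η : List α} {z : ℕ → α}
    (hz : KPlay K η z) {x : ℕ → α}
    (h1 : ∀ n, own (playPrefix z (η.length + n)) →
      z (η.length + n) = kfix K (playPrefix z (η.length + n)) (x (2 * n)))
    (h2 : ∀ n, ¬ own (playPrefix z (η.length + n)) →
      z (η.length + n) = kfix K (playPrefix z (η.length + n)) (x (2 * n + 1))) :
    dec K own η x = z := by
  symm
  apply runs_unique hz.1
  intro n hn
  obtain ⟨m, rfl⟩ := Nat.exists_eq_add_of_le hn
  rw [decS, pp_length, Nat.add_sub_cancel_left]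
  split_ifs with h
  · exact h1 m h
  · exact h2 m h

open Classical in
theorem det {T K : Set (List α)} (hT : IsTree T) (hKT : K ⊆ T)
    (hK : ∀ δ ∈ K, ∃ a, δ ++ [a] ∈ K) (own : List α → Prop) {η : List α} (hη : η ∈ K)
    (X : Set (ℕ → α))
    (hX : @MeasurableSet _ (MeasurableSpace.generateFrom {A | IsOpenIn T A}) X) :
    (∃ s, KLegal K s ∧ ∀ z, KPlay K η z → Foll own s η z → z ∈ X) ∨
    (∃ s, KLegal K s ∧ ∀ z, KPlay K η z → Foll (fun δ => ¬ own δ) s η z → z ∉ X) := by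
  rcases (unr_dec hT hKT hK own hη X hX).determined with ⟨σ, hσ⟩ | ⟨σ, hσ⟩
  · left
    let F : (ℕ → α) → List α → α := fun z q =>
      if q.length % 2 = 0 then σ q else z (η.length + q.length / 2)
    refine ⟨fun δ => kfix K δ (σ (pre (recSeq (F fun i => δ.getD i default))
      (2 * (δ.length - η.length)))), kfix_legal hK _, ?_⟩
    intro z hz hf
    have hc : Cons 0 σ (recSeq (F z)) := by
      intro n hn
      rw [recSeq_eq]
      simp only [F, pre_length, hn, if_true]
    have hd : dec K own η (recSeq (F z)) = z := by
      apply foll_kfix hz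
      · intro n hn
        rw [hf _ (by omega) hn]
        simp only [pp_length, Nat.add_sub_cancel_left]
        rw [hc (2 * n) (by omega)]
        congr 2
        refine (recSeq_unique ?_).symm
        intro m hm
        rw [recSeq_eq]
        simp only [F, pre_length]
        split_ifs with he
        · rfl
        · have h1 := pp_getD (playPrefix z (η.length + n))
          rw [pp_length] at h1
          exact (pp_val h1 (by omega)).symm
      · intro n hn
        rw [recSeq_eq]
        have : ¬ (2 * n + 1) % 2 = 0 := by omega
        simp only [F, pre_length, this, if_false]
        rw [show (2 * n + 1) / 2 = n by omega]
        refine (kfix_eq ?_).symm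
        rw [← pp_succ]
        exact hz.2 _ (by omega)
    have := hσ _ hc
    rwa [Set.mem_preimage, hd] at this
  · right
    let F : (ℕ → α) → List α → α := fun z q =>
      if q.length % 2 = 1 then σ q else
        if own (playPrefix z (η.length + q.length / 2)) then z (η.length + q.length / 2) else default
    refine ⟨fun δ => kfix K δ (σ (pre (recSeq (F fun i => δ.getD i default))
      (2 * (δ.length - η.length) + 1))), kfix_legal hK _, ?_⟩
    intro z hz hf
    have hc : Cons 1 σ (recSeq (F z)) := by
      intro n hn
      rw [recSeq_eq]
      simp only [F, pre_length, hn, if_true]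
    have hd : dec K own η (recSeq (F z)) = z := by
      apply foll_kfix hz
      · intro n hn
        rw [recSeq_eq]
        have : ¬ (2 * n) % 2 = 1 := by omega
        simp only [F, pre_length, this, if_false]
        rw [show (2 * n) / 2 = n by omega, if_pos hn]
        refine (kfix_eq ?_).symm
        rw [← pp_succ]
        exact hz.2 _ (by omega)
      · intro n hn
        rw [hf _ (by omega) hn]
        simp only [pp_length, Nat.add_sub_cancel_left]
        rw [hc (2 * n + 1) (by omega)]
        congr 2
        refine (recSeq_unique ?_).symm
        intro m hm
        rw [recSeq_eq]
        simp only [F, pre_length]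
        have h1 := pp_getD (playPrefix z (η.length + n))
        rw [pp_length] at h1
        split_ifs with he ho ho' ho'
        · rfl
        · rcases Nat.lt_or_ge (m / 2) n with hlt | hge
          · exact (pp_val h1 (by omega)).symm
          · have e : m / 2 = n := by omega
            rw [e] at ho
            exact absurd ho hn
        · rw [pp_congr h1 (by omega)] at ho'
          exact absurd ho ho'
        · rw [pp_congr h1 (by omega)] at ho'
          exact absurd ho' ho
        · rfl
    have := hσ _ hc
    rwa [Set.mem_preimage, hd] at this

end Det
end BD


namespace BD
universe u

/-! ### Uniform strategies -/
section Uniform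
variable {α : Type u}

/-- `δ` is reachable from `r` by steps of `st`. -/
inductive Reach (st : List α → α → Prop) (r : List α) : List α → Prop
  | refl : Reach st r r
  | snoc : ∀ δ a, Reach st r δ → st δ a → Reach st r (δ ++ [a])

theorem Reach.play {st : List α → α → Prop} {r δ : List α} (h : Reach st r δ) (z : ℕ → α) :
    ∀ n, δ = playPrefix z n → r = playPrefix z r.length ∧ r.length ≤ n ∧
      ∀ m, r.length ≤ m → m < n → st (playPrefix z m) (z m) := by
  induction h with
  | refl =>
    intro n hn
    have : r.length = n := by rw [hn, pp_length]
    refine ⟨by rw [this]; exact hn, this.le, fun m h1 h2 => by omega⟩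
  | snoc δ a h hst ih =>
    intro n hn
    cases n with
    | zero =>
      have := congrArg List.length hn
      simp [pp_length] at this
    | succ n =>
      rw [pp_succ] at hn
      obtain ⟨h1, h2⟩ := List.append_inj' hn rfl
      obtain ⟨i1, i2, i3⟩ := ih n h1
      refine ⟨i1, by omega, fun m h3 h4 => ?_⟩
      rcases Nat.lt_or_ge m n with h5 | h5
      · exact i3 m h3 h5
      · obtain rfl : m = n := by omega
        rw [← h1]
        simp only [List.cons.injEq, and_true] at h2
        rw [← h2]; exact hst

theorem exists_ref (st : List α → List α → α → Prop) (W : Set (List α)) :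
    ∃ ref : List α → List α,
      (∀ δ, (∃ r ∈ W, Reach (st r) r δ) → ref δ ∈ W ∧ Reach (st (ref δ)) (ref δ) δ) ∧
      ∀ (z : ℕ → α) (n₀ : ℕ), (∃ r ∈ W, Reach (st r) r (playPrefix z n₀)) →
        (∀ n, n₀ ≤ n → (∃ r ∈ W, Reach (st r) r (playPrefix z n)) →
          st (ref (playPrefix z n)) (playPrefix z n) (z n)) →
        ∃ r ∈ W, r.length ≤ n₀ ∧ r = playPrefix z r.length ∧
          ∀ m, r.length ≤ m → st r (playPrefix z m) (z m) := by
  classical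
  have key : ∀ δ, ∃ r, (∃ r ∈ W, Reach (st r) r δ) → (r ∈ W ∧ Reach (st r) r δ ∧
      ∀ r' ∈ W, Reach (st r') r' δ → r.length ≤ r'.length) := by
    intro δ
    by_cases h : ∃ r ∈ W, Reach (st r) r δ
    · have h2 : ∃ k, ∃ r ∈ W, Reach (st r) r δ ∧ r.length = k := by
        obtain ⟨r, h1, h2⟩ := h
        exact ⟨_, r, h1, h2, rfl⟩
      obtain ⟨r, h3, h4, h5⟩ := Nat.find_spec h2
      refine ⟨r, fun _ => ⟨h3, h4, fun r' h6 h7 => ?_⟩⟩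
      rw [h5]
      exact Nat.find_min' h2 ⟨r', h6, h7, rfl⟩
    · exact ⟨[], fun h' => absurd h' h⟩
  choose ref href using key
  refine ⟨ref, fun δ h => ⟨(href δ h).1, (href δ h).2.1⟩, ?_⟩
  intro z n₀ h0 hst
  have hcov : ∀ n, n₀ ≤ n → (∃ r ∈ W, Reach (st r) r (playPrefix z n)) := by
    intro n hn
    induction n, hn using Nat.le_induction with
    | base => exact h0
    | succ n hn ih =>
      refine ⟨_, (href _ ih).1, ?_⟩
      rw [pp_succ]
      exact Reach.snoc _ _ (href _ ih).2.1 (hst n hn ih)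
  have hstep : ∀ n, n₀ ≤ n → Reach (st (ref (playPrefix z n))) (ref (playPrefix z n))
      (playPrefix z (n+1)) := by
    intro n hn
    rw [pp_succ]
    exact Reach.snoc _ _ (href _ (hcov n hn)).2.1 (hst n hn (hcov n hn))
  have hmono : ∀ n, n₀ ≤ n → (ref (playPrefix z (n+1))).length ≤ (ref (playPrefix z n)).length := by
    intro n hn
    exact (href _ (hcov (n+1) (by omega))).2.2 _ (href _ (hcov n hn)).1 (hstep n hn)
  -- minimal length
  have hmin : ∃ k, ∃ n, n₀ ≤ n ∧ (ref (playPrefix z n)).length = k := ⟨_, n₀, le_rfl, rfl⟩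
  obtain ⟨N, hN, hk⟩ := Nat.find_spec hmin
  have hconst : ∀ n, N ≤ n → ref (playPrefix z n) = ref (playPrefix z N) := by
    intro n hn
    have e : ∀ n, n₀ ≤ n → ref (playPrefix z n) = playPrefix z (ref (playPrefix z n)).length :=
      fun n hn => ((href _ (hcov n hn)).2.1.play z n rfl).1
    have l1 : (ref (playPrefix z n)).length ≤ (ref (playPrefix z N)).length := by
      induction n, hn using Nat.le_induction with
      | base => exact le_rfl
      | succ n hn ih => exact (hmono n (by omega)).trans ih
    have l2 : (ref (playPrefix z N)).length ≤ (ref (playPrefix z n)).length := by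
      rw [hk]
      exact Nat.find_min' hmin ⟨n, by omega, rfl⟩
    rw [e n (by omega), e N hN, le_antisymm l1 l2]
  have hle : (ref (playPrefix z N)).length ≤ n₀ := by
    rw [hk]
    exact (Nat.find_min' hmin ⟨n₀, le_rfl, rfl⟩).trans
      ((href _ (hcov n₀ le_rfl)).2.1.play z n₀ rfl).2.1
  refine ⟨ref (playPrefix z N), (href _ (hcov N hN)).1, hle, ((href _ (hcov N hN)).2.1.play z N rfl).1, ?_⟩
  intro m hm
  have h1 := hstep (max N m) (by omega)
  rw [hconst _ (le_max_left _ _)] at h1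
  exact (h1.play z _ rfl).2.2 m hm (by omega)

def Wins (K : Set (List α)) (P : List α → Prop) (X : Set (ℕ → α)) (η : List α) (s : List α → α) :
    Prop := ∀ z, KPlay K η z → Foll P s η z → z ∈ X

theorem uniform [Inhabited α] {K : Set (List α)} (hK : ∀ δ ∈ K, ∃ a, δ ++ [a] ∈ K)
    (P : List α → Prop) (X : Set (ℕ → α)) :
    ∃ s, KLegal K s ∧ ∀ η ∈ K, (∃ s', KLegal K s' ∧ Wins K P X η s') → Wins K P X η s := by
  classical
  have hσ : ∀ η, ∃ s', (∃ s', KLegal K s' ∧ Wins K P X η s') → KLegal K s' ∧ Wins K P X η s' := by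
    intro η
    by_cases h : ∃ s', KLegal K s' ∧ Wins K P X η s'
    · obtain ⟨s', h'⟩ := h; exact ⟨s', fun _ => h'⟩
    · exact ⟨fun _ => default, fun h' => absurd h' h⟩
  choose σ hσ using hσ
  set W : Set (List α) := {η | η ∈ K ∧ ∃ s', KLegal K s' ∧ Wins K P X η s'} with hW
  set st : List α → List α → α → Prop := fun r δ a => δ ++ [a] ∈ K ∧ (P δ → a = σ r δ) with hst
  obtain ⟨ref, h1, h2⟩ := exists_ref st W
  refine ⟨fun δ => if ∃ r ∈ W, Reach (st r) r δ then σ (ref δ) δ else kfix K δ default, ?_, ?_⟩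
  · intro δ hδ
    dsimp only
    split_ifs with h
    · exact (hσ _ (h1 _ h).1.2).1 δ hδ
    · exact kfix_legal hK (fun _ => default) δ hδ
  · intro η hη hw z hz hf
    obtain ⟨r, hr, -, h3, h4⟩ := h2 z η.length ⟨η, ⟨hη, hw⟩, by rw [hz.1]; exact Reach.refl⟩ (by
      intro n hn hc
      refine ⟨by rw [← pp_succ]; exact hz.2 _ (by omega), fun hP => ?_⟩
      rw [hf n hn hP]; exact if_pos hc)
    refine (hσ r hr.2).2 z ⟨h3.symm, fun n hn => ?_⟩ (fun n hn hP => (h4 n hn).2 hP)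
    rcases Nat.eq_or_lt_of_le hn with h5 | h5
    · rw [← h5, ← h3]; exact hr.1
    · obtain ⟨k, rfl⟩ : ∃ k, n = k + 1 := ⟨n - 1, by omega⟩
      rw [pp_succ]; exact (h4 k (by omega)).1

theorem Wins.child {K : Set (List α)} {P : List α → Prop} {X : Set (ℕ → α)} {δ : List α}
    {s : List α → α} (h : Wins K P X δ s) (hδ : δ ∈ K) {a : α} (ha : P δ → a = s δ) :
    Wins K P X (δ ++ [a]) s := by
  intro z hz hf
  have e : playPrefix z (δ.length + 1) = δ ++ [a] := by
    have := hz.1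
    simpa using this
  rw [pp_succ] at e
  obtain ⟨e1, e2⟩ := List.append_inj' e rfl
  simp only [List.cons.injEq, and_true] at e2
  refine h z ⟨e1, fun n hn => ?_⟩ (fun n hn hP => ?_)
  · rcases Nat.eq_or_lt_of_le hn with h5 | h5
    · rw [← h5, e1]; exact hδ
    · exact hz.2 n (by simpa using h5)
  · rcases Nat.eq_or_lt_of_le hn with h5 | h5
    · subst h5
      rw [e1] at hP ⊢
      rw [e2]; exact ha hP
    · exact hf n (by simpa using h5) hP

end Uniform

section ZeroSum
variable {α : Type u} [Inhabited α]

theorem mono_stab (f : ℕ → ℕ) (n₀ N : ℕ) (hb : ∀ n, n₀ ≤ n → f n ≤ N)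
    (hm : ∀ n, n₀ ≤ n → f n ≤ f (n+1)) : ∃ m, n₀ ≤ m ∧ f n₀ ≤ f m ∧ ∀ n, m ≤ n → f n = f m := by
  have hmon : ∀ a b, n₀ ≤ a → a ≤ b → f a ≤ f b := by
    intro a b ha hab
    induction b, hab using Nat.le_induction with
    | base => exact le_rfl
    | succ n hn ih => exact ih.trans (hm n (by omega))
  have hex : ∃ k, ∃ n, n₀ ≤ n ∧ N - f n = k := ⟨_, n₀, le_rfl, rfl⟩
  classical
  obtain ⟨m, h1, h2⟩ := Nat.find_spec hex
  refine ⟨m, h1, hmon _ _ le_rfl h1, fun n hn => le_antisymm ?_ (hmon _ _ h1 hn)⟩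
  have h3 := Nat.find_min' hex ⟨n, h1.trans hn, rfl⟩
  rw [← h2] at h3
  have := hb n (by omega)
  have := hb m (by omega)
  omega

theorem anti_stab (f : ℕ → ℕ) (n₀ : ℕ)
    (hm : ∀ n, n₀ ≤ n → f (n+1) ≤ f n) : ∃ m, n₀ ≤ m ∧ f m ≤ f n₀ ∧ ∀ n, m ≤ n → f n = f m := by
  have hmon : ∀ a b, n₀ ≤ a → a ≤ b → f b ≤ f a := by
    intro a b ha hab
    induction b, hab using Nat.le_induction with
    | base => exact le_rfl
    | succ n hn ih => exact (hm n (by omega)).trans ih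
  have hex : ∃ k, ∃ n, n₀ ≤ n ∧ f n = k := ⟨_, n₀, le_rfl, rfl⟩
  classical
  obtain ⟨m, h1, h2⟩ := Nat.find_spec hex
  refine ⟨m, h1, hmon _ _ le_rfl h1, fun n hn => le_antisymm (hmon _ _ h1 hn) ?_⟩
  have h3 := Nat.find_min' hex ⟨n, h1.trans hn, rfl⟩
  omega

theorem zero_sum {T K : Set (List α)} (hT : IsTree T) (hKT : K ⊆ T)
    (hK : ∀ δ ∈ K, ∃ a, δ ++ [a] ∈ K) (own : List α → Prop)
    (u : (ℕ → α) → ℕ) (N : ℕ) (hN : ∀ η ∈ K, ∀ z, KPlay K η z → u z ≤ N)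
    (X : ℕ → Set (ℕ → α))
    (hX : ∀ n, @MeasurableSet _ (MeasurableSpace.generateFrom {A | IsOpenIn T A}) (X n))
    (hXu : ∀ n, ∀ η ∈ K, ∀ z, KPlay K η z → (z ∈ X n ↔ n ≤ u z)) :
    ∃ s, KLegal K s ∧ ∀ η ∈ K, ∀ z, KPlay K η z →
      (Foll own s η z → u (run s η) ≤ u z) ∧
      (Foll (fun δ => ¬ own δ) s η z → u z ≤ u (run s η)) := by
  classical
  choose σ hσl hσ using fun n => uniform hK own (X n)
  choose τ hτl hτ using fun n => uniform hK (fun δ => ¬ own δ) (X n)ᶜ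
  let W : ℕ → List α → Prop := fun n η => Wins K own (X n) η (σ n)
  let L : ℕ → List α → Prop := fun n η => Wins K (fun δ => ¬ own δ) (X n)ᶜ η (τ n)
  have hWL : ∀ n, ∀ η ∈ K, W n η ∨ L n η := by
    intro n η hη
    rcases det hT hKT hK own hη (X n) (hX n) with h | h
    · exact Or.inl (hσ n η hη h)
    · exact Or.inr (hτ n η hη h)
  have hnot : ∀ n, ∀ η ∈ K, W n η → L n η → False := by
    intro n η hη h1 h2
    let s : List α → α := fun δ => if own δ then σ n δ else τ n δ
    have hs : KLegal K s := by
      intro δ hδ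
      by_cases h : own δ
      · simp only [s, if_pos h]; exact hσl n δ hδ
      · simp only [s, if_neg h]; exact hτl n δ hδ
    have hp := runs_kplay hs hη
    refine h2 _ hp ?_ (h1 _ hp ?_)
    · intro m hm hP
      rw [runs_step s η hm]
      simp only [s, if_neg hP]
    · intro m hm hP
      rw [runs_step s η hm]
      simp only [s, if_pos hP]
  have hW0 : ∀ η ∈ K, W 0 η := fun η hη z hz _ => (hXu 0 η hη z hz).2 (Nat.zero_le _)
  have hWN : ∀ η ∈ K, ∀ n, W n η → n ≤ N := by
    intro η hη n h
    have hp := runs_kplay (hσl n) hη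
    exact ((hXu n η hη _ hp).1 (h _ hp (runs_foll _ _ _))).trans (hN η hη _ hp)
  have hanti : ∀ η ∈ K, ∀ m n, m ≤ n → W n η → W m η := by
    intro η hη m n hmn h
    exact hσ m η hη ⟨σ n, hσl n, fun z hz hf =>
      (hXu m η hη z hz).2 (hmn.trans ((hXu n η hη z hz).1 (h z hz hf)))⟩
  let val : List α → ℕ := fun η => Nat.findGreatest (fun n => W n η) N
  have hval : ∀ η ∈ K, W (val η) η := fun η hη =>
    Nat.findGreatest_spec (P := fun n => W n η) (Nat.zero_le N) (hW0 η hη)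
  have hle : ∀ η ∈ K, ∀ n, W n η → n ≤ val η := fun η hη n h =>
    Nat.le_findGreatest (hWN η hη n h) h
  have hvalN : ∀ η, val η ≤ N := fun η => Nat.findGreatest_le N
  have hL : ∀ η ∈ K, L (val η + 1) η := by
    intro η hη
    refine (hWL _ η hη).resolve_left fun h => ?_
    have := hle η hη _ h
    omega
  have hLle : ∀ η ∈ K, ∀ n, L (n+1) η → val η ≤ n := by
    intro η hη n h
    by_contra hc
    exact hnot (n+1) η hη (hanti η hη _ _ (by omega) (hval η hη)) h
  let s : List α → α := fun δ => if own δ then σ (val δ) δ else τ (val δ + 1) δ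
  have hs : KLegal K s := by
    intro δ hδ
    by_cases h : own δ
    · simp only [s, if_pos h]; exact hσl _ δ hδ
    · simp only [s, if_neg h]; exact hτl _ δ hδ
  have ge : ∀ η ∈ K, ∀ z, KPlay K η z → Foll own s η z → val η ≤ u z := by
    intro η hη z hz hf
    obtain ⟨m, h1, h2, h3⟩ := mono_stab (fun n => val (playPrefix z n)) η.length N
      (fun n _ => hvalN _) (by
        intro n hn
        have hk := hz.2 n hn
        refine hle _ (hz.2 (n+1) (by omega)) _ ?_
        rw [pp_succ]
        refine (hval _ hk).child hk fun hP => ?_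
        rw [hf n hn hP]; simp only [s, if_pos hP])
    simp only [hz.1] at h2
    refine h2.trans ?_
    have hk := hz.2 m h1
    have hz' : KPlay K (playPrefix z m) z :=
      ⟨by rw [pp_length], fun n hn => hz.2 n (by rw [pp_length] at hn; omega)⟩
    refine (hXu _ _ hk z hz').1 (hval _ hk z hz' ?_)
    intro n hn hP
    rw [pp_length] at hn
    rw [hf n (by omega) hP]
    simp only [s, if_pos hP]
    rw [h3 n hn]
  have le : ∀ η ∈ K, ∀ z, KPlay K η z → Foll (fun δ => ¬ own δ) s η z → u z ≤ val η := by
    intro η hη z hz hf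
    obtain ⟨m, h1, h2, h3⟩ := anti_stab (fun n => val (playPrefix z n)) η.length (by
        intro n hn
        have hk := hz.2 n hn
        refine hLle _ (hz.2 (n+1) (by omega)) _ ?_
        rw [pp_succ]
        refine (hL _ hk).child hk fun hP => ?_
        rw [hf n hn hP]; simp only [s, if_neg hP])
    simp only [hz.1] at h2
    refine le_trans ?_ h2
    have hk := hz.2 m h1
    have hz' : KPlay K (playPrefix z m) z :=
      ⟨by rw [pp_length], fun n hn => hz.2 n (by rw [pp_length] at hn; omega)⟩
    have h4 : z ∉ X (val (playPrefix z m) + 1) := by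
      refine hL _ hk z hz' ?_
      intro n hn hP
      rw [pp_length] at hn
      rw [hf n (by omega) hP]
      simp only [s, if_neg hP]
      rw [h3 n hn]
    rw [hXu _ _ hk z hz'] at h4
    omega
  refine ⟨s, hs, fun η hη z hz => ?_⟩
  have hp := runs_kplay hs hη
  have e : u (run s η) = val η :=
    le_antisymm (le η hη _ hp (runs_foll _ _ _)) (ge η hη _ hp (runs_foll _ _ _))
  rw [e]
  exact ⟨ge η hη z hz, le η hη z hz⟩

end ZeroSum
end BD


namespace BD
universe u

/-! ### A reachability game with finitely many leaf labels -/
section Labels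
variable {N : Type u}

inductive Rch (E : N → N → Prop) (M L : Set N) : ℕ → N → Prop
  | base : ∀ m c, m ∈ M → E m c → c ∈ L → Rch E M L 0 m
  | step : ∀ n m c, m ∈ M → E m c → Rch E M L n c → Rch E M L (n + 1) m

theorem Rch.mem {E : N → N → Prop} {M L : Set N} {n : ℕ} {m : N} (h : Rch E M L n m) : m ∈ M := by
  cases h <;> assumption

theorem Rch.mono {E : N → N → Prop} {M M' L : Set N} (hM : M ⊆ M') {n : ℕ} {m : N}
    (h : Rch E M L n m) : Rch E M' L n m := by
  induction h with
  | base m c h1 h2 h3 => exact Rch.base m c (hM h1) h2 h3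
  | step n m c h1 h2 _ ih => exact Rch.step n m c (hM h1) h2 ih

theorem Rch.child {E : N → N → Prop} {M L : Set N} {n : ℕ} {m : N}
    (h : Rch E M L n m) : ∃ c, E m c ∧ (c ∈ M ∨ c ∈ L) := by
  cases h with
  | base m c h1 h2 h3 => exact ⟨c, h2, Or.inr h3⟩
  | step n m c h1 h2 h3 => exact ⟨c, h2, Or.inl h3.mem⟩

/-- the sets that are trapped towards the leaves `Lb` -/
structure Trap (E : N → N → Prop) (own : N → Prop) (M Lf Lb X : Set N) : Prop where
  sub : X ⊆ M
  ownc : ∀ m ∈ X, own m → ∀ c, E m c → (c ∈ M ∨ c ∈ Lf) → c ∈ X ∨ c ∈ Lb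
  oppc : ∀ m ∈ X, ¬ own m → ∃ c, E m c ∧ (c ∈ X ∨ c ∈ Lb)
  rch : ∀ m ∈ X, ∃ n, Rch E X Lb n m

theorem labels (E : N → N → Prop) (own : N → Prop) (k : ℕ) :
    ∀ (lo : ℕ) (M Lf : Set N) (lab : N → ℕ), Disjoint M Lf →
      (∀ c ∈ Lf, lo ≤ lab c ∧ lab c < lo + k) →
      (∀ m ∈ M, ∃ n, Rch E M Lf n m) →
      ∃ (val rk : N → ℕ), (∀ c ∈ Lf, val c = lab c) ∧ (∀ m ∈ M, lo ≤ val m) ∧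
        ∀ m ∈ M, (∃ c, E m c ∧ (c ∈ M ∨ c ∈ Lf) ∧ val c = val m ∧ (c ∈ M → rk c < rk m)) ∧
          ∀ c, E m c → (c ∈ M ∨ c ∈ Lf) → (own m → val c ≤ val m) ∧ (¬ own m → val m ≤ val c) := by
  classical
  induction k with
  | zero =>
    intro lo M Lf lab hd hlab hr
    have hLf : ∀ c, c ∉ Lf := fun c hc => by have := hlab c hc; omega
    have hM : ∀ m, m ∉ M := by
      intro m hm
      obtain ⟨n, hn⟩ := hr m hm
      induction hn with
      | base m c h1 h2 h3 => exact hLf c h3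
      | step n m c h1 h2 h3 ih => exact ih h3.mem
    exact ⟨fun _ => 0, fun _ => 0, fun c hc => absurd hc (hLf c), fun m hm => absurd hm (hM m),
      fun m hm => absurd hm (hM m)⟩
  | succ k ih =>
    intro lo M Lf lab hd hlab hr
    let Lb : Set N := {c | c ∈ Lf ∧ lab c = lo}
    let B : Set N := ⋃₀ {X | Trap E own M Lf Lb X}
    have hBX : ∀ X, Trap E own M Lf Lb X → X ⊆ B := fun X hX => Set.subset_sUnion_of_mem hX
    have hB : Trap E own M Lf Lb B := by
      refine ⟨?_, ?_, ?_, ?_⟩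
      · exact Set.sUnion_subset fun X hX => hX.sub
      · rintro m ⟨X, hX, hm⟩ ho c hc hc'
        exact (hX.ownc m hm ho c hc hc').imp (fun h => hBX X hX h) id
      · rintro m ⟨X, hX, hm⟩ ho
        obtain ⟨c, h1, h2⟩ := hX.oppc m hm ho
        exact ⟨c, h1, h2.imp (fun h => hBX X hX h) id⟩
      · rintro m ⟨X, hX, hm⟩
        obtain ⟨n, hn⟩ := hX.rch m hm
        exact ⟨n, hn.mono (hBX X hX)⟩
    let M' : Set N := M \ B
    let Lf' : Set N := Lf \ Lb
    have hr' : ∀ m ∈ M', ∃ n, Rch E M' Lf' n m := by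
      by_contra hcon
      let Y : Set N := {m | m ∈ M' ∧ ¬ ∃ n, Rch E M' Lf' n m}
      have hYc : ∀ m ∈ Y, ∀ c, E m c → (c ∈ M ∨ c ∈ Lf) → c ∈ B ∪ Y ∨ c ∈ Lb := by
        intro m hm c hc hc'
        by_contra hn
        push Not at hn
        obtain ⟨h1, h2⟩ := hn
        simp only [Set.mem_union, not_or] at h1
        apply hm.2
        rcases hc' with h | h
        · have : ∃ n, Rch E M' Lf' n c := by
            by_contra h3
            exact h1.2 ⟨⟨h, h1.1⟩, h3⟩
          obtain ⟨n, hn⟩ := this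
          exact ⟨n + 1, Rch.step n m c hm.1 hc hn⟩
        · exact ⟨0, Rch.base m c hm.1 hc ⟨h, h2⟩⟩
      have hBY : Trap E own M Lf Lb (B ∪ Y) := by
        refine ⟨?_, ?_, ?_, ?_⟩
        · exact Set.union_subset hB.sub fun m hm => hm.1.1
        · rintro m (hm | hm) ho c hc hc'
          · exact (hB.ownc m hm ho c hc hc').imp (fun h => Or.inl h) id
          · exact hYc m hm c hc hc'
        · rintro m (hm | hm) ho
          · obtain ⟨c, h1, h2⟩ := hB.oppc m hm ho
            exact ⟨c, h1, h2.imp (fun h => Or.inl h) id⟩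
          · obtain ⟨n, hn⟩ := hr m hm.1.1
            obtain ⟨c, h1, h2⟩ := hn.child
            exact ⟨c, h1, hYc m hm c h1 h2⟩
        · have hBr : ∀ m ∈ B, ∃ n, Rch E (B ∪ Y) Lb n m := by
            intro m hm
            obtain ⟨n, hn⟩ := hB.rch m hm
            exact ⟨n, hn.mono Set.subset_union_left⟩
          rintro m (hm | hm)
          · exact hBr m hm
          · obtain ⟨n, hn⟩ := hr m hm.1.1
            induction hn with
            | base m c h1 h2 h3 =>
              rcases hYc m hm c h2 (Or.inr h3) with (h | h) | h
              · obtain ⟨n, hn⟩ := hBr c h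
                exact ⟨n + 1, Rch.step n m c (Or.inr hm) h2 hn⟩
              · exact absurd h3 (Set.disjoint_left.1 hd h.1.1)
              · exact ⟨0, Rch.base m c (Or.inr hm) h2 h⟩
            | step n m c h1 h2 h3 ih' =>
              rcases hYc m hm c h2 (Or.inl h3.mem) with (h | h) | h
              · obtain ⟨n, hn⟩ := hBr c h
                exact ⟨n + 1, Rch.step n m c (Or.inr hm) h2 hn⟩
              · obtain ⟨n, hn⟩ := ih' h
                exact ⟨n + 1, Rch.step n m c (Or.inr hm) h2 hn⟩
              · exact ⟨0, Rch.base m c (Or.inr hm) h2 h⟩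
      apply hcon
      intro m hm
      by_contra h
      exact hm.2 (hBX _ hBY (Or.inr ⟨hm, h⟩))
    obtain ⟨val, rk, v1, v2, v3⟩ := ih (lo + 1) M' Lf' lab
      (hd.mono Set.diff_subset Set.diff_subset)
      (by
        rintro c ⟨hc, hc'⟩
        have := hlab c hc
        have h2 : lab c ≠ lo := fun h => hc' ⟨hc, h⟩
        omega) hr'
    let rkB : N → ℕ := fun m => if h : ∃ n, Rch E B Lb n m then Nat.find h else 0
    let low : N → Prop := fun c => c ∈ B ∨ c ∈ Lb
    have hnoopp : ∀ m ∈ M', ¬ own m → ∀ c, E m c → ¬ low c := by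
      intro m hm ho c hc hl
      have hT : Trap E own M Lf Lb (insert m B) := by
        refine ⟨?_, ?_, ?_, ?_⟩
        · exact Set.insert_subset hm.1 hB.sub
        · rintro x (rfl | hx) ho' c hc hc'
          · exact absurd ho' ho
          · exact (hB.ownc x hx ho' c hc hc').imp (fun h => Or.inr h) id
        · rintro x (rfl | hx) ho'
          · exact ⟨c, hc, hl.imp (fun h => Or.inr h) id⟩
          · obtain ⟨c, h1, h2⟩ := hB.oppc x hx ho'
            exact ⟨c, h1, h2.imp (fun h => Or.inr h) id⟩
        · rintro x (rfl | hx)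
          · rcases hl with h | h
            · obtain ⟨n, hn⟩ := hB.rch c h
              exact ⟨n + 1, Rch.step n x c (Or.inl rfl) hc (hn.mono (Set.subset_insert _ _))⟩
            · exact ⟨0, Rch.base x c (Or.inl rfl) hc h⟩
          · obtain ⟨n, hn⟩ := hB.rch x hx
            exact ⟨n, hn.mono (Set.subset_insert _ _)⟩
      exact hm.2 (hBX _ hT (Or.inl rfl))
    have hnl : ∀ c, (c ∈ M ∨ c ∈ Lf) → ¬ low c → (c ∈ M' ∨ c ∈ Lf') := by
      intro c hc hl
      simp only [low, not_or] at hl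
      exact hc.imp (fun h => ⟨h, hl.1⟩) (fun h => ⟨h, hl.2⟩)
    have hlM' : ∀ c, c ∈ M' ∨ c ∈ Lf' → ¬ low c := by
      rintro c (h | h) (h' | h')
      · exact h.2 h'
      · exact Set.disjoint_left.1 hd h.1 h'.1
      · exact Set.disjoint_left.1 hd (hB.sub h') h.1
      · exact h.2 h'
    have hvge : ∀ c, c ∈ M' ∨ c ∈ Lf' → lo ≤ val c := by
      rintro c (h | h)
      · have := v2 c h; omega
      · rw [v1 c h]; exact (hlab c h.1).1
    let V : N → ℕ := fun c => if low c then lo else val c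
    have hVge : ∀ c, c ∈ M ∨ c ∈ Lf → lo ≤ V c := by
      intro c hc
      by_cases h : low c
      · simp [V, h]
      · simp only [V, if_neg h]; exact hvge c (hnl c hc h)
    refine ⟨V, fun c => if c ∈ B then rkB c else rk c, ?_, fun m hm => hVge m (Or.inl hm), ?_⟩
    · intro c hc
      by_cases h : low c
      · rcases h with h | h
        · exact absurd hc (Set.disjoint_left.1 hd (hB.sub h))
        · simp only [V, if_pos (show low c from Or.inr h)]; exact h.2.symm
      · simp only [V, if_neg h]
        rcases hnl c (Or.inr hc) h with h' | h'
        · exact absurd hc (Set.disjoint_left.1 hd h'.1)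
        · exact v1 c h'
    · intro m hm
      by_cases hmB : m ∈ B
      · have hVm : V m = lo := by simp only [V, if_pos (show low m from Or.inl hmB)]
        constructor
        · have hex := hB.rch m hmB
          have hsp := Nat.find_spec hex
          have hrk : rkB m = Nat.find hex := dif_pos hex
          generalize hn : Nat.find hex = n at hsp
          cases hsp with
          | base m c h1 h2 h3 =>
            refine ⟨c, h2, Or.inr h3.1, ?_, fun h => absurd h3.1 (Set.disjoint_left.1 hd h)⟩
            rw [hVm]; simp only [V, if_pos (show low c from Or.inr h3)]
          | step n m c h1 h2 h3 =>
            refine ⟨c, h2, Or.inl (hB.sub h3.mem), ?_, fun _ => ?_⟩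
            · rw [hVm]; simp only [V, if_pos (show low c from Or.inl h3.mem)]
            · simp only [if_pos h3.mem, if_pos hmB]
              have hex' : ∃ n, Rch E B Lb n c := ⟨n, h3⟩
              have : rkB c = Nat.find hex' := dif_pos hex'
              have := Nat.find_min' hex' h3
              omega
        · intro c hc hc'
          refine ⟨fun ho => ?_, fun _ => by rw [hVm]; exact hVge c hc'⟩
          rw [hVm]
          have : low c := hB.ownc m hmB ho c hc hc'
          simp only [V, if_pos this]; exact le_rfl
      · have hm' : m ∈ M' := ⟨hm, hmB⟩
        have hVm : V m = val m := if_neg (hlM' m (Or.inl hm'))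
        obtain ⟨⟨c, c1, c2, c3, c4⟩, w⟩ := v3 m hm'
        constructor
        · have hl := hlM' c c2
          refine ⟨c, c1, c2.imp (fun h => h.1) (fun h => h.1), ?_, fun h => ?_⟩
          · rw [hVm]; simp only [V, if_neg hl]; exact c3
          · have hcB : c ∉ B := fun h => hl (Or.inl h)
            simp only [if_neg hcB, if_neg hmB]
            exact c4 ⟨h, hcB⟩
        · intro c hc hc'
          rw [hVm]
          by_cases hl : low c
          · have hVc : V c = lo := if_pos hl
            rw [hVc]
            refine ⟨fun _ => hvge m (Or.inl hm'), fun ho => absurd hl (hnoopp m hm' ho c hc)⟩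
          · have hVc : V c = val c := if_neg hl
            rw [hVc]
            exact w c hc (hnl c hc' hl)

end Labels
end BD


namespace BD
universe u

/-! ### Solving one region with two opposed coalitions -/
section Region
variable {α : Type u} [Inhabited α]

structure Reg (T R : Set (List α)) (G : Set (ℕ → α)) : Prop where
  tree : IsTree T
  RT : R ⊆ T
  stay : ∀ q ∈ G, ∀ m n, m ≤ n → playPrefix q m ∈ R → playPrefix q n ∈ R
  thru : ∀ γ ∈ R, ∃ q ∈ G, playPrefix q γ.length = γ

def OK (G : Set (ℕ → α)) (own : List α → Prop) (u : (ℕ → α) → ℕ) (s : List α → α) (δ : List α) :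
    Prop :=
  run s δ ∈ G ∧ ∀ q ∈ G, playPrefix q δ.length = δ →
    (Foll own s δ q → u (run s δ) ≤ u q) ∧ (Foll (fun η => ¬ own η) s δ q → u q ≤ u (run s δ))

def Sol (R : Set (List α)) (G : Set (ℕ → α)) (own : List α → Prop) (u : (ℕ → α) → ℕ)
    (σ : List α) : Prop :=
  ∃ s, ∀ δ ∈ R, σ <+: δ → OK G own u s δ

open Classical in
noncomputable def ex (S : Set (List α)) (σ δ : List α) : List α :=
  if h : ∃ m, σ.length ≤ m ∧ δ.take m ∉ S then δ.take (Nat.find h) else δ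

theorem pp_take (z : ℕ → α) {m n : ℕ} (h : m ≤ n) : (playPrefix z n).take m = playPrefix z m := by
  have := prefix_pp z (List.take_prefix m (playPrefix z n))
  rw [this, List.length_take, pp_length, min_eq_left h]

/-- `m` is the exit point of `z` from `S`, after `σ` -/
def ExitAt (S : Set (List α)) (σ : List α) (z : ℕ → α) (m : ℕ) : Prop :=
  σ.length ≤ m ∧ playPrefix z m ∉ S ∧ ∀ k, σ.length ≤ k → k < m → playPrefix z k ∈ S

theorem exists_exit {S : Set (List α)} {σ : List α} {z : ℕ → α} {n : ℕ} (hn : σ.length ≤ n)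
    (h : playPrefix z n ∉ S) : ∃ m, m ≤ n ∧ ExitAt S σ z m := by
  classical
  have hex : ∃ m, σ.length ≤ m ∧ playPrefix z m ∉ S := ⟨n, hn, h⟩
  refine ⟨Nat.find hex, Nat.find_min' hex ⟨hn, h⟩, (Nat.find_spec hex).1, (Nat.find_spec hex).2, ?_⟩
  intro k hk hk'
  by_contra hc
  exact Nat.find_min hex hk' ⟨hk, hc⟩

theorem ex_eq {S : Set (List α)} {σ : List α} {z : ℕ → α} {m n : ℕ} (h : ExitAt S σ z m)
    (hn : m ≤ n) : ex S σ (playPrefix z n) = playPrefix z m := by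
  classical
  have hex : ∃ k, σ.length ≤ k ∧ (playPrefix z n).take k ∉ S :=
    ⟨m, h.1, by rw [pp_take z hn]; exact h.2.1⟩
  have e : Nat.find hex = m := by
    rw [Nat.find_eq_iff]
    refine ⟨⟨h.1, by rw [pp_take z hn]; exact h.2.1⟩, ?_⟩
    rintro k hk ⟨h1, h2⟩
    rw [pp_take z (by omega)] at h2
    exact h2 (h.2.2 k h1 hk)
  rw [ex, dif_pos hex, e, pp_take z hn]

theorem ExitAt.congr {S : Set (List α)} {σ : List α} {z w : ℕ → α} {m : ℕ} (h : ExitAt S σ z m)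
    (e : playPrefix w m = playPrefix z m) : ExitAt S σ w m :=
  ⟨h.1, by rw [e]; exact h.2.1, fun k h1 h2 => by rw [pp_congr e h2.le]; exact h.2.2 k h1 h2⟩

open Classical in
noncomputable def comp (S : Set (List α)) (σ : List α) (s₀ : List α → α)
    (sx : List α → List α → α) (δ : List α) : α :=
  if δ ∈ S then s₀ δ else sx (ex S σ δ) δ

structure Setup (T R : Set (List α)) (G : Set (ℕ → α)) (own : List α → Prop) (u : (ℕ → α) → ℕ)
    (S : Set (List α)) (σ : List α) (sx : List α → List α → α) : Prop extends Reg T R G where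
  SR : S ⊆ R
  Sc : ∀ τ ∈ S, ∀ η ∈ R, η <+: τ → η ∈ S
  σS : σ ∈ S
  hsx : ∀ τ ∈ R, τ ∉ S → ∀ δ ∈ R, τ <+: δ → OK G own u (sx τ) δ

variable {T R : Set (List α)} {G : Set (ℕ → α)} {own : List α → Prop} {u : (ℕ → α) → ℕ}
    {S : Set (List α)} {σ : List α} {sx : List α → List α → α}

theorem Setup.inR (H : Setup T R G own u S σ sx) {z : ℕ → α} (hz : z ∈ G)
    (hσ : playPrefix z σ.length = σ) {n : ℕ} (hn : σ.length ≤ n) : playPrefix z n ∈ R :=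
  H.stay z hz _ n hn (by rw [hσ]; exact H.SR H.σS)

theorem Setup.notS (H : Setup T R G own u S σ sx) {z : ℕ → α}
    (hR : ∀ n, σ.length ≤ n → playPrefix z n ∈ R) {m n : ℕ} (h : ExitAt S σ z m) (hn : m ≤ n) :
    playPrefix z n ∉ S :=
  fun hc => h.2.1 (H.Sc _ hc _ (hR m h.1) (pp_prefix_le z hn))

theorem Setup.comp_eq (H : Setup T R G own u S σ sx) (s₀ : List α → α) {z : ℕ → α}
    (hR : ∀ n, σ.length ≤ n → playPrefix z n ∈ R) {m n : ℕ} (h : ExitAt S σ z m) (hn : m ≤ n) :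
    comp S σ s₀ sx (playPrefix z n) = sx (playPrefix z m) (playPrefix z n) := by
  rw [comp, if_neg (H.notS hR h hn), ex_eq h hn]

theorem Setup.comp_run (H : Setup T R G own u S σ sx) (s₀ : List α → α) {q : ℕ → α}
    (hσ : playPrefix q σ.length = σ)
    (hR : ∀ n, σ.length ≤ n → playPrefix q n ∈ R) {m n : ℕ} (h : ExitAt S σ q m) (hn : m ≤ n) :
    run (comp S σ s₀ sx) (playPrefix q n) = run (sx (playPrefix q m)) (playPrefix q n) ∧
    OK G own u (comp S σ s₀ sx) (playPrefix q n) := by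
  have hok : OK G own u (sx (playPrefix q m)) (playPrefix q n) :=
    H.hsx _ (hR m h.1) h.2.1 _ (hR n (h.1.trans hn)) (pp_prefix_le q hn)
  have key : ∀ w ∈ G, playPrefix w n = playPrefix q n → ∀ k, m ≤ k →
      comp S σ s₀ sx (playPrefix w k) = sx (playPrefix q m) (playPrefix w k) := by
    intro w hw e k hk
    have e1 : playPrefix w m = playPrefix q m := pp_congr e hn
    have e2 : playPrefix w σ.length = σ := (pp_congr e (h.1.trans hn)).trans hσ
    rw [← e1]
    exact H.comp_eq s₀ (fun n hn => H.inR hw e2 hn) (h.congr e1) hk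
  have hrun : run (comp S σ s₀ sx) (playPrefix q n) = run (sx (playPrefix q m)) (playPrefix q n) := by
    symm
    have hst := runs_start (sx (playPrefix q m)) (playPrefix q n)
    apply runs_unique hst
    intro k hk
    rw [runs_step _ _ hk]
    rw [pp_length] at hk hst
    exact (key _ hok.1 hst k (hn.trans hk)).symm
  refine ⟨hrun, ?_, ?_⟩
  · rw [hrun]; exact hok.1
  · intro w hw e
    rw [hrun]
    have := hok.2 w hw e
    rw [pp_length] at e
    refine ⟨fun hf => this.1 fun k hk hP => ?_, fun hf => this.2 fun k hk hP => ?_⟩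
    · rw [hf k hk hP]; rw [pp_length] at hk; exact key w hw e k (by omega)
    · rw [hf k hk hP]; rw [pp_length] at hk; exact key w hw e k (by omega)

theorem Setup.sol_of (H : Setup T R G own u S σ sx) (s₀ : List α → α)
    (h : ∀ δ ∈ S, σ <+: δ → OK G own u (comp S σ s₀ sx) δ) : Sol R G own u σ := by
  refine ⟨comp S σ s₀ sx, fun δ hδ hσδ => ?_⟩
  by_cases hS : δ ∈ S
  · exact h δ hS hσδ
  · obtain ⟨q, hq, e⟩ := H.thru δ hδ
    have e2 : playPrefix q σ.length = σ := (prefix_pp q (by rw [e]; exact hσδ)).symm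
    rw [← e] at hS
    obtain ⟨m, hm, hex⟩ := exists_exit hσδ.length_le hS
    have := (H.comp_run s₀ e2 (fun n hn => H.inR hq e2 hn) hex hm).2
    rwa [e] at this

theorem Setup.mid (H : Setup T R G own u S σ sx) {z : ℕ → α} {δ : List α} (hδ : δ ∈ S)
    (hσδ : σ <+: δ) (hz : playPrefix z δ.length = δ) :
    playPrefix z σ.length = σ ∧ ((∀ k, δ.length ≤ k → playPrefix z k ∈ R) →
      ∀ k, σ.length ≤ k → playPrefix z k ∈ R) ∧
      ∀ k, σ.length ≤ k → k ≤ δ.length → playPrefix z k ∈ S := by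
  have e2 : playPrefix z σ.length = σ := (prefix_pp z (by rw [hz]; exact hσδ)).symm
  have h3 : ∀ k, σ.length ≤ k → k ≤ δ.length → playPrefix z k ∈ S := by
    intro k h1 h2
    have hkδ : playPrefix z k <+: δ := by
      have := pp_prefix_le z h2
      rwa [hz] at this
    refine H.Sc δ hδ _ ?_ hkδ
    obtain ⟨q, hq, e⟩ := H.thru δ (H.SR hδ)
    have e3 : playPrefix z k = playPrefix q k := pp_congr (hz.trans e.symm) h2
    rw [e3]
    refine H.inR hq ?_ h1
    exact (pp_congr (e.trans hz.symm) hσδ.length_le).trans e2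
  refine ⟨e2, fun h k hk => ?_, h3⟩
  rcases le_total k δ.length with h4 | h4
  · exact H.SR (h3 k hk h4)
  · exact h k h4

end Region
end BD


namespace BD
universe u
section RegionB
variable {α : Type u} [Inhabited α]
variable {T R : Set (List α)} {G : Set (ℕ → α)} {own : List α → Prop} {u : (ℕ → α) → ℕ}
    {S : Set (List α)} {σ : List α} {sx : List α → List α → α}

theorem runs_child (s : List α → α) (m : List α) : run s (m ++ [s m]) = run s m := by
  have := runs_shift s m (n := m.length + 1) (by omega)
  rwa [pp_succ, runs_step s m le_rfl, runs_start] at this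

theorem Setup.leaf (H : Setup T R G own u S σ sx) (s₀ : List α → α) {m : List α} (hm : m ∈ S)
    (hσm : σ <+: m) {a : α} (hR : m ++ [a] ∈ R) (hS : m ++ [a] ∉ S) :
    run (comp S σ s₀ sx) (m ++ [a]) = run (sx (m ++ [a])) (m ++ [a]) ∧
    OK G own u (comp S σ s₀ sx) (m ++ [a]) := by
  obtain ⟨q, hq, e⟩ := H.thru _ hR
  have e1 : playPrefix q m.length = m := by
    have := pp_take q (show m.length ≤ (m ++ [a]).length by simp)
    rw [e] at this
    rw [← this]; simp
  obtain ⟨f1, -, f3⟩ := H.mid hm hσm e1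
  have hl : (m ++ [a]).length = m.length + 1 := by simp
  have hx : ExitAt S σ q (m ++ [a]).length := by
    refine ⟨by rw [hl]; have := hσm.length_le; omega, by rw [e]; exact hS, fun k h1 h2 => ?_⟩
    exact f3 k h1 (by omega)
  have := H.comp_run s₀ f1 (fun n hn => H.inR hq f1 hn) hx le_rfl
  rwa [e] at this

theorem Setup.caseB (H : Setup T R G own u S σ sx) (N : ℕ) (hN : ∀ z ∈ G, u z ≤ N)
    (hB : ∀ z, KPlay S σ z → z ∉ G) : Sol R G own u σ := by
  classical
  let M : Set (List α) := {δ | δ ∈ S ∧ σ <+: δ}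
  let Lf : Set (List α) := {c | c ∈ R ∧ c ∉ S ∧ ∃ m ∈ M, ∃ a, c = m ++ [a]}
  let E : List α → List α → Prop := fun m c => ∃ a, c = m ++ [a]
  let lab : List α → ℕ := fun c => u (run (sx c) c)
  -- every good play through `m` exits
  have hexit : ∀ m ∈ M, ∀ q ∈ G, playPrefix q m.length = m →
      ∃ e, ExitAt S σ q e ∧ m.length < e ∧ (∀ k, m.length ≤ k → k < e → playPrefix q k ∈ M) ∧
        playPrefix q e ∈ Lf := by
    intro m hm q hq e
    obtain ⟨f1, -, f3⟩ := H.mid hm.1 hm.2 e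
    have : ∃ n, σ.length ≤ n ∧ playPrefix q n ∉ S := by
      by_contra hc
      push Not at hc
      exact hB q ⟨f1, hc⟩ hq
    obtain ⟨n, h1, h2⟩ := this
    obtain ⟨x, hx1, hx2⟩ := exists_exit h1 h2
    have hlt : m.length < x := by
      by_contra hc
      exact hx2.2.1 (f3 x hx2.1 (by omega))
    have hM : ∀ k, m.length ≤ k → k < x → playPrefix q k ∈ M := by
      intro k h3 h4
      have h5 : σ.length ≤ k := hm.2.length_le.trans h3
      refine ⟨hx2.2.2 k h5 h4, ?_⟩
      have := pp_prefix_le q h5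
      rwa [f1] at this
    refine ⟨x, hx2, hlt, hM, H.inR hq f1 hx2.1, hx2.2.1, ?_⟩
    obtain ⟨y, rfl⟩ : ∃ y, x = y + 1 := ⟨x - 1, by omega⟩
    exact ⟨playPrefix q y, hM y (by omega) (by omega), q y, pp_succ q y⟩
  have hd : Disjoint M Lf := Set.disjoint_left.2 fun m h1 h2 => h2.2.1 h1.1
  have hleaf : ∀ s₀ : List α → α, ∀ c ∈ Lf, u (run (comp S σ s₀ sx) c) = lab c ∧
      OK G own u (comp S σ s₀ sx) c := by
    rintro s₀ c ⟨h1, h2, m, hm, a, rfl⟩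
    have := H.leaf s₀ hm.1 hm.2 h1 h2
    exact ⟨congrArg u this.1, this.2⟩
  have hlab : ∀ c ∈ Lf, 0 ≤ lab c ∧ lab c < 0 + (N + 1) := by
    intro c hc
    refine ⟨Nat.zero_le _, ?_⟩
    have h := hleaf (fun _ => default) c hc
    have := hN _ h.2.1
    omega
  have hr : ∀ m ∈ M, ∃ n, Rch E M Lf n m := by
    intro m hm
    obtain ⟨q, hq, e⟩ := H.thru m (H.SR hm.1)
    obtain ⟨x, -, hlt, hM, hL⟩ := hexit m hm q hq e
    have : ∀ j k, m.length ≤ k → k + j + 1 = x → Rch E M Lf j (playPrefix q k) := by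
      intro j
      induction j with
      | zero =>
        intro k h1 h2
        refine Rch.base _ (playPrefix q x) (hM k h1 (by omega)) ⟨q k, ?_⟩ hL
        rw [← pp_succ]; congr 1; omega
      | succ j ih =>
        intro k h1 h2
        exact Rch.step j _ _ (hM k h1 (by omega)) ⟨q k, pp_succ q k⟩ (ih (k+1) (by omega) (by omega))
    have h := this (x - 1 - m.length) m.length le_rfl (by omega)
    rw [e] at h
    exact ⟨_, h⟩
  obtain ⟨val, rk, v1, -, v3⟩ := labels E own (N+1) 0 M Lf lab hd hlab hr
  have hch : ∀ m, ∃ a, m ∈ M → ((m ++ [a] ∈ M ∨ m ++ [a] ∈ Lf) ∧ val (m ++ [a]) = val m ∧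
      (m ++ [a] ∈ M → rk (m ++ [a]) < rk m)) := by
    intro m
    by_cases hm : m ∈ M
    · obtain ⟨⟨c, ⟨a, rfl⟩, h2⟩, -⟩ := v3 m hm
      exact ⟨a, fun _ => h2⟩
    · exact ⟨default, fun h => absurd h hm⟩
  choose s₀ hs₀ using hch
  set s := comp S σ s₀ sx with hs
  have hsM : ∀ m ∈ M, s m = s₀ m := fun m hm => by rw [hs, comp, if_pos hm.1]
  have hrun : ∀ n, ∀ m ∈ M, rk m ≤ n → run s m ∈ G ∧ u (run s m) = val m := by
    intro n
    induction n with
    | zero =>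
      intro m hm h
      obtain ⟨h1, h2, h3⟩ := hs₀ m hm
      rcases h1 with h1 | h1
      · have := h3 h1; omega
      · have h4 := hleaf s₀ _ h1
        rw [← runs_child, hsM m hm]
        exact ⟨h4.2.1, by rw [← h2, v1 _ h1]; exact h4.1⟩
    | succ n ih =>
      intro m hm h
      obtain ⟨h1, h2, h3⟩ := hs₀ m hm
      rcases h1 with h1 | h1
      · have := ih _ h1 (by have := h3 h1; omega)
        rw [← runs_child, hsM m hm, ← h2]
        exact this
      · have h4 := hleaf s₀ _ h1
        rw [← runs_child, hsM m hm]
        exact ⟨h4.2.1, by rw [← h2, v1 _ h1]; exact h4.1⟩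
  have hdev : ∀ (P : List α → Prop) (cmp : ℕ → ℕ → Prop), (∀ a, cmp a a) →
      (∀ a b c, cmp a b → cmp b c → cmp a c) →
      (∀ m ∈ M, ∀ c, E m c → (c ∈ M ∨ c ∈ Lf) → ¬ P m → cmp (val m) (val c)) →
      (∀ c ∈ Lf, ∀ q ∈ G, playPrefix q c.length = c → Foll P s c q → cmp (val c) (u q)) →
      ∀ m ∈ M, ∀ q ∈ G, playPrefix q m.length = m → Foll P s m q → cmp (val m) (u q) := by
    intro P cmp hrefl htr h1 h2 m hm q hq e hf
    obtain ⟨x, hx, hlt, hM, hL⟩ := hexit m hm q hq e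
    have hin : ∀ k, m.length ≤ k → k ≤ x → playPrefix q k ∈ M ∨ playPrefix q k ∈ Lf := by
      intro k h3 h4
      rcases Nat.lt_or_ge k x with h5 | h5
      · exact Or.inl (hM k h3 h5)
      · obtain rfl : k = x := by omega
        exact Or.inr hL
    have h3 : ∀ k, m.length ≤ k → k ≤ x → cmp (val m) (val (playPrefix q k)) := by
      intro k hk
      induction k, hk using Nat.le_induction with
      | base => intro _; rw [e]; exact hrefl _
      | succ k hk ih =>
        intro hkx
        refine htr _ _ _ (ih (by omega)) ?_
        have hkM := hM k hk (by omega)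
        by_cases hP : P (playPrefix q k)
        · have e1 : playPrefix q (k+1) = playPrefix q k ++ [s₀ (playPrefix q k)] := by
            rw [pp_succ, hf k hk hP, hsM _ hkM]
          rw [e1, (hs₀ _ hkM).2.1]; exact hrefl _
        · exact h1 _ hkM _ ⟨q k, pp_succ q k⟩ (hin _ (by omega) hkx) hP
    refine htr _ _ _ (h3 x hlt.le le_rfl) (h2 _ hL q hq (by rw [pp_length]) ?_)
    intro k hk hP
    rw [pp_length] at hk
    exact hf k (by omega) hP
  refine H.sol_of s₀ fun m hm hσm => ?_
  obtain ⟨r1, r2⟩ := hrun _ m ⟨hm, hσm⟩ le_rfl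
  refine ⟨r1, fun q hq e => ?_⟩
  rw [← hs, r2]
  constructor
  · refine hdev own (fun a b => a ≤ b) (fun a => le_rfl) (fun a b c => le_trans) ?_ ?_ m ⟨hm, hσm⟩ q hq e
    · intro m hm c hc hc' hP
      exact ((v3 m hm).2 c hc hc').2 hP
    · intro c hc q hq e hf
      have h := hleaf s₀ c hc
      rw [v1 c hc, ← h.1]
      exact (h.2.2 q hq e).1 hf
  · refine hdev (fun η => ¬ own η) (fun a b => b ≤ a) (fun a => le_rfl) (fun a b c h1 h2 => le_trans h2 h1)
      ?_ ?_ m ⟨hm, hσm⟩ q hq e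
    · intro m hm c hc hc' hP
      exact ((v3 m hm).2 c hc hc').1 (not_not.1 hP)
    · intro c hc q hq e hf
      have h := hleaf s₀ c hc
      rw [v1 c hc, ← h.1]
      exact (h.2.2 q hq e).2 hf

end RegionB
end BD


namespace BD
universe u
section RegionA
variable {α : Type u} [Inhabited α]
variable {T R : Set (List α)} {G : Set (ℕ → α)} {own : List α → Prop} {u : (ℕ → α) → ℕ}
    {S : Set (List α)} {σ : List α} {sx : List α → List α → α}

theorem Setup.caseA (H : Setup T R G own u S σ sx) (N : ℕ) (hN : ∀ z ∈ G, u z ≤ N)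
    (X : ℕ → Set (ℕ → α))
    (hX : ∀ n, @MeasurableSet _ (MeasurableSpace.generateFrom {A | IsOpenIn T A}) (X n))
    (hXu : ∀ n, ∀ z ∈ G, (z ∈ X n ↔ n ≤ u z))
    (hA : ∀ z, KPlay S σ z → z ∈ G) : Sol R G own u σ := by
  classical
  let M : Set (List α) := {δ | δ ∈ S ∧ σ <+: δ}
  let Lf : Set (List α) := {c | c ∈ R ∧ c ∉ S ∧ ∃ m ∈ M, ∃ a, c = m ++ [a]}
  let w : List α → ℕ → α := fun τ => run (sx τ) τ
  let K : Set (List α) := {δ | δ ∈ M ∨ ∃ τ ∈ Lf, ∃ n, τ.length ≤ n ∧ δ = playPrefix (w τ) n}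
  have hthru : ∀ η ∈ R, σ <+: η → ∀ z : ℕ → α, playPrefix z η.length = η →
      playPrefix z σ.length = σ ∧ ∀ k, σ.length ≤ k → k ≤ η.length → playPrefix z k ∈ R := by
    intro η hη hση z hz
    have e2 : playPrefix z σ.length = σ := (prefix_pp z (by rw [hz]; exact hση)).symm
    refine ⟨e2, fun k h1 h2 => ?_⟩
    obtain ⟨q, hq, e⟩ := H.thru η hη
    rw [pp_congr (hz.trans e.symm) h2]
    refine H.inR hq ?_ h1
    exact (pp_congr (e.trans hz.symm) hση.length_le).trans e2
  -- facts about exits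
  have F1 : ∀ τ ∈ Lf, w τ ∈ G ∧ playPrefix (w τ) σ.length = σ ∧
      (∀ n, σ.length ≤ n → playPrefix (w τ) n ∈ R) ∧ ExitAt S σ (w τ) τ.length ∧
      playPrefix (w τ) τ.length = τ := by
    rintro τ ⟨h1, h2, m, hm, a, rfl⟩
    have hl := H.leaf (fun _ => default) hm.1 hm.2 h1 h2
    have hG : w (m ++ [a]) ∈ G := by
      have := hl.2.1
      rwa [hl.1] at this
    have e := runs_start (sx (m ++ [a])) (m ++ [a])
    have hσ : σ <+: m ++ [a] := hm.2.trans (List.prefix_append m [a])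
    have e2 := (hthru _ h1 hσ _ e).1
    have e1 : playPrefix (w (m ++ [a])) m.length = m := by
      have := pp_take (w (m ++ [a])) (show m.length ≤ (m ++ [a]).length by simp)
      rw [e] at this
      rw [← this]; simp
    refine ⟨hG, e2, fun n hn => H.inR hG e2 hn, ⟨hσ.length_le, by rw [e]; exact h2, ?_⟩, e⟩
    intro k h3 h4
    refine (H.mid hm.1 hm.2 e1).2.2 k h3 ?_
    simp at h4; omega
  have hKR : ∀ η ∈ K, η ∈ R ∧ σ <+: η := by
    rintro η (h | ⟨τ, hτ, n, hn, rfl⟩)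
    · exact ⟨H.SR h.1, h.2⟩
    · obtain ⟨-, f2, f3, f4, -⟩ := F1 τ hτ
      refine ⟨f3 n (f4.1.trans hn), ?_⟩
      have := pp_prefix_le (w τ) (f4.1.trans hn)
      rwa [f2] at this
  have hLK : ∀ τ ∈ Lf, τ ∈ K := fun τ hτ =>
    Or.inr ⟨τ, hτ, τ.length, le_rfl, (F1 τ hτ).2.2.2.2.symm⟩
  have hK : ∀ δ ∈ K, ∃ a, δ ++ [a] ∈ K := by
    rintro δ (h | ⟨τ, hτ, n, hn, rfl⟩)
    · obtain ⟨q, hq, e⟩ := H.thru δ (H.SR h.1)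
      have e2 := (H.mid h.1 h.2 e).1
      have hR := H.inR hq e2 (n := δ.length + 1) (by have := h.2.length_le; omega)
      rw [pp_succ, e] at hR
      refine ⟨q δ.length, ?_⟩
      by_cases hS : δ ++ [q δ.length] ∈ S
      · exact Or.inl ⟨hS, h.2.trans (List.prefix_append _ _)⟩
      · exact hLK _ ⟨hR, hS, δ, h, _, rfl⟩
    · exact ⟨w τ n, Or.inr ⟨τ, hτ, n + 1, by omega, (pp_succ _ _).symm⟩⟩
  have F4 : ∀ (z : ℕ → α) (m n : ℕ), ExitAt S σ z m → m ≤ n →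
      (∀ k, σ.length ≤ k → k ≤ n → playPrefix z k ∈ R) → playPrefix z n ∈ K →
      playPrefix z m ∈ Lf ∧ playPrefix z n = playPrefix (w (playPrefix z m)) n := by
    intro z m n hx hmn hR hk
    rcases hk with hk | ⟨τ, hτ, n', hn', e⟩
    · exact absurd (H.Sc _ hk.1 _ (hR m hx.1 hmn) (pp_prefix_le z hmn)) hx.2.1
    · have : n = n' := by
        have := congrArg List.length e
        simpa [pp_length] using this
      subst this
      obtain ⟨-, -, -, f4, f5⟩ := F1 τ hτ
      have e1 := ex_eq hx hmn
      rw [e, ex_eq f4 hn', f5] at e1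
      rw [← e1]
      exact ⟨hτ, e⟩
  have F3 : ∀ η ∈ K, ∀ z, KPlay K η z → playPrefix z σ.length = σ ∧
      ∀ k, σ.length ≤ k → playPrefix z k ∈ R := by
    intro η hη z hz
    have h := hthru η (hKR η hη).1 (hKR η hη).2 z hz.1
    refine ⟨h.1, fun k hk => ?_⟩
    rcases le_total k η.length with h1 | h1
    · exact h.2 k hk h1
    · exact (hKR _ (hz.2 k h1)).1
  have hKG : ∀ η ∈ K, ∀ z, KPlay K η z → z ∈ G := by
    intro η hη z hz
    obtain ⟨h1, h2⟩ := F3 η hη z hz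
    by_cases hS : ∀ n, σ.length ≤ n → playPrefix z n ∈ S
    · exact hA z ⟨h1, hS⟩
    · push Not at hS
      obtain ⟨n, hn, hn'⟩ := hS
      obtain ⟨m, hm, hx⟩ := exists_exit hn hn'
      have h3 : ∀ k, m ≤ k → η.length ≤ k → playPrefix z m ∈ Lf ∧
          playPrefix z k = playPrefix (w (playPrefix z m)) k :=
        fun k h4 h5 => F4 z m k hx h4 (fun k hk _ => h2 k hk) (hz.2 k h5)
      have : z = w (playPrefix z m) := by
        apply pp_ext
        intro k
        exact pp_congr (h3 (max k (max m η.length)) (by simp) (by simp)).2 (le_max_left _ _)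
      rw [this]
      exact (F1 _ (h3 (max m η.length) (by simp) (by simp)).1).1
  obtain ⟨s₀, hs₀, hz₀⟩ := zero_sum H.tree (fun η hη => H.RT (hKR η hη).1) hK own u N
    (fun η hη z hz => hN z (hKG η hη z hz)) X hX
    (fun n η hη z hz => hXu n z (hKG η hη z hz))
  set s := comp S σ s₀ sx with hs
  have hss : ∀ ζ ∈ K, s ζ = s₀ ζ := by
    intro ζ hζ
    by_cases hS : ζ ∈ S
    · rw [hs, comp, if_pos hS]
    · rcases hζ with h | ⟨τ, hτ, n, hn, e⟩
      · exact absurd h.1 hS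
      · obtain ⟨g1, g2, g3, g4, g5⟩ := F1 τ hτ
        have hζ : ζ ∈ K := Or.inr ⟨τ, hτ, n, hn, e⟩
        have hy := runs_kplay hs₀ hζ
        have hl : ζ.length = n := by rw [e, pp_length]
        have e1 : playPrefix (run s₀ ζ) n = playPrefix (w τ) n := by
          have := hy.1
          rw [hl] at this; rw [this, e]
        have hx : ExitAt S σ (run s₀ ζ) τ.length := g4.congr (pp_congr e1 hn)
        have h2 := F3 ζ hζ _ hy
        have h3 := (F4 _ _ (n+1) hx (by omega) (fun k hk _ => h2.2 k hk) (hy.2 _ (by omega))).2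
        have e3 : playPrefix (run s₀ ζ) τ.length = τ := (pp_congr e1 hn).trans g5
        rw [e3] at h3
        have h4 := pp_val h3 (Nat.lt_succ_self n)
        rw [runs_step s₀ ζ hl.le, e1, ← e] at h4
        rw [h4]
        rw [hs, e, H.comp_eq s₀ g3 g4 hn, g5]
        exact (runs_step (sx τ) τ hn).symm
  have hrun : ∀ η ∈ K, run s η = run s₀ η := by
    intro η hη
    symm
    have hy := runs_kplay hs₀ hη
    apply runs_unique hy.1
    intro n hn
    rw [runs_step s₀ η hn, hss _ (hy.2 n hn)]
  have hdev : ∀ (P : List α → Prop) (cmp : ℕ → ℕ → Prop),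
      (∀ a b c, cmp a b → cmp b c → cmp a c) →
      (∀ η ∈ K, ∀ z, KPlay K η z → Foll P s₀ η z → cmp (u (run s₀ η)) (u z)) →
      (∀ τ ∈ Lf, ∀ q ∈ G, playPrefix q τ.length = τ → Foll P s τ q → cmp (u (run s τ)) (u q)) →
      ∀ δ ∈ M, ∀ q ∈ G, playPrefix q δ.length = δ → Foll P s δ q → cmp (u (run s δ)) (u q) := by
    intro P cmp htr h1 h2 δ hδ q hq e hf
    rw [hrun δ (Or.inl hδ)]
    have hfoll : ∀ z, KPlay K δ z → Foll P s δ z → cmp (u (run s₀ δ)) (u z) := by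
      intro z hz hfz
      refine h1 δ (Or.inl hδ) z hz fun n hn hP => ?_
      rw [hfz n hn hP, hss _ (hz.2 n hn)]
    obtain ⟨f1, -, f3⟩ := H.mid hδ.1 hδ.2 e
    have hpre : ∀ k, σ.length ≤ k → σ <+: playPrefix q k := by
      intro k hk
      have := pp_prefix_le q hk
      rwa [f1] at this
    by_cases hS : ∀ n, σ.length ≤ n → playPrefix q n ∈ S
    · refine hfoll q ⟨e, fun n hn => Or.inl ?_⟩ hf
      have : σ.length ≤ n := hδ.2.length_le.trans hn
      exact ⟨hS n this, hpre n this⟩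
    · push Not at hS
      obtain ⟨n, hn, hn'⟩ := hS
      obtain ⟨x, hxn, hx⟩ := exists_exit hn hn'
      have hlt : δ.length < x := by
        by_contra hc
        exact hx.2.1 (f3 x hx.1 (by omega))
      have hM : ∀ k, δ.length ≤ k → k < x → playPrefix q k ∈ M := by
        intro k h3 h4
        have h5 : σ.length ≤ k := hδ.2.length_le.trans h3
        exact ⟨hx.2.2 k h5 h4, hpre k h5⟩
      have hL : playPrefix q x ∈ Lf := by
        refine ⟨H.inR hq f1 hx.1, hx.2.1, ?_⟩
        obtain ⟨y, rfl⟩ : ∃ y, x = y + 1 := ⟨x - 1, by omega⟩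
        exact ⟨playPrefix q y, hM y (by omega) (by omega), q y, pp_succ q y⟩
      have hτw : run s (playPrefix q x) = w (playPrefix q x) :=
        (H.comp_run s₀ f1 (fun n hn => H.inR hq f1 hn) hx le_rfl).1
      refine htr _ (u (run s (playPrefix q x))) _ ?_ (h2 _ hL q hq (by rw [pp_length]) ?_)
      · have hst : playPrefix (run s (playPrefix q x)) x = playPrefix q x := by
          have := runs_start s (playPrefix q x)
          rwa [pp_length] at this
        apply hfoll
        · refine ⟨(pp_congr hst hlt.le).trans e, fun k hk => ?_⟩
          rcases Nat.lt_or_ge k x with h5 | h5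
          · rw [pp_congr hst h5.le]; exact Or.inl (hM k hk h5)
          · refine Or.inr ⟨_, hL, k, by rw [pp_length]; exact h5, ?_⟩
            rw [hτw]
        · intro k hk hP
          rcases Nat.lt_or_ge k x with h5 | h5
          · have e5 := pp_congr hst h5.le
            rw [pp_val hst h5, e5]
            rw [e5] at hP
            exact hf k hk hP
          · exact runs_step _ _ (by rw [pp_length]; exact h5)
      · intro k hk hP
        rw [pp_length] at hk
        exact hf k (by omega) hP
  have hLok : ∀ τ ∈ Lf, OK G own u s τ := by
    rintro τ ⟨h1, h2, m, hm, a, rfl⟩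
    exact (H.leaf s₀ hm.1 hm.2 h1 h2).2
  refine H.sol_of s₀ fun m hm hσm => ?_
  have hmK : m ∈ K := Or.inl ⟨hm, hσm⟩
  refine ⟨?_, fun q hq e => ⟨?_, ?_⟩⟩
  · rw [← hs, hrun m hmK]
    exact hKG m hmK _ (runs_kplay hs₀ hmK)
  · exact hdev own (fun a b => a ≤ b) (fun a b c => le_trans)
      (fun η hη z hz => (hz₀ η hη z hz).1)
      (fun τ hτ q hq e => ((hLok τ hτ).2 q hq e).1) m ⟨hm, hσm⟩ q hq e
  · exact hdev (fun η => ¬ own η) (fun a b => b ≤ a) (fun a b c h1 h2 => le_trans h2 h1)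
      (fun η hη z hz => (hz₀ η hη z hz).2)
      (fun τ hτ q hq e => ((hLok τ hτ).2 q hq e).2) m ⟨hm, hσm⟩ q hq e

/-- Every node of the region has a solution. -/
theorem Reg.sol (H : Reg T R G) (own : List α → Prop) (u : (ℕ → α) → ℕ)
    (N : ℕ) (hN : ∀ z ∈ G, u z ≤ N)
    (X : ℕ → Set (ℕ → α))
    (hX : ∀ n, @MeasurableSet _ (MeasurableSpace.generateFrom {A | IsOpenIn T A}) (X n))
    (hXu : ∀ n, ∀ z ∈ G, (z ∈ X n ↔ n ≤ u z))
    (hres : ∀ S ⊆ R, S.Nonempty → ∃ σ ∈ S, (∀ z, KPlay S σ z → z ∈ G) ∨ (∀ z, KPlay S σ z → z ∉ G))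
    {σ : List α} (hσ : σ ∈ R) : Sol R G own u σ := by
  classical
  by_contra hc
  let S : Set (List α) := {σ | σ ∈ R ∧ ¬ Sol R G own u σ}
  obtain ⟨σ', hσ', h⟩ := hres S (fun σ h => h.1) ⟨σ, hσ, hc⟩
  have hsx : ∀ τ, ∃ s, (τ ∈ R → τ ∉ S → ∀ δ ∈ R, τ <+: δ → OK G own u s δ) := by
    intro τ
    by_cases h : Sol R G own u τ
    · obtain ⟨s, hs⟩ := h
      exact ⟨s, fun _ _ => hs⟩
    · exact ⟨fun _ => default, fun h1 h2 => absurd ⟨h1, h⟩ h2⟩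
  choose sx hsx using hsx
  have HS : Setup T R G own u S σ' sx :=
    { H with
      SR := fun σ h => h.1
      Sc := fun τ hτ η hη hp => ⟨hη, fun ⟨s, hs⟩ =>
        hτ.2 ⟨s, fun δ hδ hτδ => hs δ hδ (hp.trans hτδ)⟩⟩
      σS := hσ'
      hsx := hsx }
  rcases h with h | h
  · exact hσ'.2 (HS.caseA N hN X hX hXu h)
  · exact hσ'.2 (HS.caseB N hN h)

end RegionA
end BD


namespace BD
universe u
section Resolve
variable {α : Type u} [Inhabited α]

theorem resolve {T : Set (List α)} (hT : IsTree T) {D : Set (ℕ → α)} (hD : QuasiDiff T D) :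
    ∀ S ⊆ T, S.Nonempty → ∃ σ ∈ S, (∀ z, KPlay S σ z → z ∈ D) ∨ (∀ z, KPlay S σ z → z ∉ D) := by
  have body : ∀ S ⊆ T, ∀ σ z, KPlay S σ z → z ∈ Body T := fun S hS σ z hz => hz.body hT hS
  have hcyl : ∀ S ⊆ T, ∀ σ z, KPlay S σ z → ∀ γ, γ <+: σ → z ∈ cylinder T γ := by
    intro S hS σ z hz γ h
    exact ⟨body S hS σ z hz, (prefix_pp z (n := σ.length) (by rw [hz.1]; exact h)).symm⟩
  have hno : ∀ S : Set (List α), ∀ σ z, KPlay S σ z → ∀ γ, z ∈ cylinder T γ →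
      ∃ δ ∈ S, γ <+: δ := by
    intro S σ z hz γ hγ
    refine ⟨_, hz.2 (max γ.length σ.length) (le_max_right _ _), ?_⟩
    have := pp_prefix_le z (le_max_left γ.length σ.length)
    rwa [hγ.2] at this
  induction hD with
  | isOpen A hA =>
    intro S hS hne
    obtain ⟨S₀, hS₀, rfl⟩ := hA
    by_cases h : ∃ σ ∈ S, ∃ γ ∈ S₀, γ <+: σ
    · obtain ⟨σ, hσ, γ, hγ, hp⟩ := h
      refine ⟨σ, hσ, Or.inl fun z hz => ?_⟩
      simp only [Set.mem_iUnion]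
      exact ⟨γ, hγ, hcyl S hS σ z hz γ hp⟩
    · obtain ⟨σ, hσ⟩ := hne
      refine ⟨σ, hσ, Or.inr fun z hz hc => ?_⟩
      simp only [Set.mem_iUnion] at hc
      obtain ⟨γ, hγ, hc⟩ := hc
      obtain ⟨δ, hδ, hp⟩ := hno S σ z hz γ hc
      exact h ⟨δ, hδ, γ, hγ, hp⟩
  | iUnion S₀ D hS₀ hpw hD hDc ih =>
    intro S hS hne
    by_cases h : ∃ σ ∈ S, ∃ γ ∈ S₀, γ <+: σ
    · obtain ⟨σ, hσ, γ, hγ, hp⟩ := h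
      obtain ⟨σ', ⟨hσ', hσσ'⟩, h'⟩ := ih γ hγ {δ | δ ∈ S ∧ σ <+: δ} (fun δ hδ => hS hδ.1)
        ⟨σ, hσ, List.prefix_rfl⟩
      have hk : ∀ z, KPlay S σ' z → KPlay {δ | δ ∈ S ∧ σ <+: δ} σ' z := by
        intro z hz
        refine ⟨hz.1, fun n hn => ⟨hz.2 n hn, hσσ'.trans ?_⟩⟩
        have := pp_prefix_le z hn
        rwa [hz.1] at this
      have he : ∀ z, KPlay S σ' z → (z ∈ ⋃ γ ∈ S₀, D γ ↔ z ∈ D γ) := by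
        intro z hz
        simp only [Set.mem_iUnion]
        constructor
        · rintro ⟨γ', hγ', hz'⟩
          have h1 := hcyl S hS σ' z hz γ (hp.trans hσσ')
          have h2 := hDc γ' hγ' hz'
          have : γ' = γ := by
            by_contra hne'
            rcases le_total γ'.length γ.length with hl | hl
            · apply hpw hγ' hγ hne'
              have := pp_prefix_le z hl
              rwa [h1.2, h2.2] at this
            · apply hpw hγ hγ' (fun h => hne' h.symm)
              have := pp_prefix_le z hl
              rwa [h1.2, h2.2] at this
          rwa [this] at hz'
        · intro h; exact ⟨γ, hγ, h⟩
      refine ⟨σ', hσ', h'.imp (fun h z hz => ?_) (fun h z hz => ?_)⟩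
      · rw [he z hz]; exact h z (hk z hz)
      · rw [he z hz]; exact h z (hk z hz)
    · obtain ⟨σ, hσ⟩ := hne
      refine ⟨σ, hσ, Or.inr fun z hz hc => ?_⟩
      simp only [Set.mem_iUnion] at hc
      obtain ⟨γ, hγ, hc⟩ := hc
      obtain ⟨δ, hδ, hp⟩ := hno S σ z hz γ (hDc γ hγ hc)
      exact h ⟨δ, hδ, γ, hγ, hp⟩
  | compl A hA ih =>
    intro S hS hne
    obtain ⟨σ, hσ, h⟩ := ih S hS hne
    refine ⟨σ, hσ, h.symm.imp (fun h z hz => ?_) (fun h z hz => ?_)⟩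
    · exact ⟨body S hS σ z hz, h z hz⟩
    · exact fun hc => hc.2 (h z hz)

end Resolve

section Local
variable {α A O : Type*} [Inhabited α]

/-- local solution property at a node -/
def LOK (g : Game α A O) (G : Set (ℕ → α)) (s : List α → α) (δ : List α) : Prop :=
  run s δ ∈ G ∧ ∀ q ∈ G, playPrefix q δ.length = δ → ∀ a,
    (Foll (fun η => g.d η ≠ a) s δ q → ¬ g.pref a (g.v (run s δ)) (g.v q)) ∧
    (g.pref a (g.v (run s δ)) (g.v q) → ∃ b, g.pref b (g.v q) (g.v (run s δ)))

theorem local_agree (g : Game α A O) [Nonempty A]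
    (hwf : ∀ a : A, WellFounded (fun x y => g.pref a y x)) (B : Set O)
    (hag : ∀ a b : A, ∀ x ∈ B, ∀ y ∈ B, (g.pref b x y ↔ g.pref a x y))
    {R : Set (List α)} (H : Reg g.T R {p | p ∈ Body g.T ∧ g.v p ∈ B}) :
    ∃ s, ∀ δ ∈ R, LOK g {p | p ∈ Body g.T ∧ g.v p ∈ B} s δ := by
  classical
  obtain ⟨a₀⟩ := ‹Nonempty A›
  set G : Set (ℕ → α) := {p | p ∈ Body g.T ∧ g.v p ∈ B} with hG
  have hp : ∀ r, ∃ p : ℕ → α, r ∈ R → (p ∈ G ∧ playPrefix p r.length = r ∧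
      ∀ q ∈ G, playPrefix q r.length = r → ¬ g.pref a₀ (g.v p) (g.v q)) := by
    intro r
    by_cases hr : r ∈ R
    · obtain ⟨q, hq, e⟩ := H.thru r hr
      obtain ⟨x, ⟨p, ⟨hp1, hp2⟩, rfl⟩, hx⟩ := (hwf a₀).has_min
        (g.v '' {q | q ∈ G ∧ playPrefix q r.length = r}) ⟨_, q, ⟨hq, e⟩, rfl⟩
      exact ⟨p, fun _ => ⟨hp1, hp2, fun q hq e => hx _ ⟨q, ⟨hq, e⟩, rfl⟩⟩⟩
    · exact ⟨fun _ => default, fun h => absurd h hr⟩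
  choose p hp using hp
  obtain ⟨ref, h1, h2⟩ := exists_ref (fun r δ a => a = p r δ.length) R
  let s : List α → α := fun δ => p (ref δ) δ.length
  have key : ∀ η ∈ R, run s η ∈ G ∧ ∀ q ∈ G, playPrefix q η.length = η →
      ¬ g.pref a₀ (g.v (run s η)) (g.v q) := by
    intro η hη
    obtain ⟨r, hr, hl, e, hst⟩ := h2 (run s η) η.length
      ⟨η, hη, by rw [runs_start]; exact Reach.refl⟩ (fun n hn _ => runs_step s η hn)
    have e2 : run s η = p r := by
      funext n
      rcases Nat.lt_or_ge n r.length with h | h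
      · exact pp_val (e.symm.trans (hp r hr).2.1.symm) h
      · have := hst n h
        rwa [pp_length] at this
    rw [e2]
    refine ⟨(hp r hr).1, fun q hq hqη => (hp r hr).2.2 q hq ?_⟩
    rw [pp_congr (hqη.trans (runs_start s η).symm) hl, ← e]
  refine ⟨s, fun η hη => ⟨(key η hη).1, fun q hq e a => ?_⟩⟩
  have h3 := (key η hη).2 q hq e
  rw [hag a _ _ (key η hη).1.2 _ hq.2] at h3
  exact ⟨fun _ => h3, fun h => absurd h h3⟩

end Local
end BD


namespace BD
universe u

theorem finite_of_two_wf {O : Type*} (lt : O → O → Prop) [IsStrictTotalOrder O lt] (B : Set O)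
    (h1 : WellFounded (fun x y => lt y x)) (lt' : O → O → Prop)
    (h2 : WellFounded (fun x y => lt' y x)) (h : ∀ x ∈ B, ∀ y ∈ B, lt' x y ↔ lt y x) : B.Finite := by
  classical
  let r : B → B → Prop := fun x y => lt x y
  have : IsStrictTotalOrder B r :=
    { trichotomous := fun x y hxy hyx => Subtype.ext (by
        rcases trichotomous_of lt x.1 y.1 with h | h | h
        · exact absurd h hxy
        · exact h
        · exact absurd h hyx)
      irrefl := fun x => irrefl_of lt x.1
      trans := fun x y z => trans_of lt }
  let : LinearOrder B := linearOrderOfSTO r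
  have : WellFoundedGT B := ⟨InvImage.wf Subtype.val h1⟩
  have : WellFoundedLT B := by
    refine ⟨?_⟩
    refine Subrelation.wf (r := InvImage (fun x y => lt' y x) Subtype.val) ?_ (InvImage.wf Subtype.val h2)
    intro x y hxy
    exact (h _ y.2 _ x.2).2 hxy
  exact Set.finite_coe_iff.1 (Finite.of_wellFoundedLT_wellFoundedGT B)

section LocalOpp
variable {α A O : Type*} [Inhabited α]

theorem local_opp (g : Game α A O)
    (hlin : ∀ a : A, IsStrictTotalOrder O (g.pref a))
    (hwf : ∀ a : A, WellFounded (fun x y => g.pref a y x))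
    (hBorel : ∀ x : O, IsBorelIn g.T {p ∈ Body g.T | g.v p = x}) (B : Set O)
    (a₀ b₀ : A) (hab : ∀ x ∈ B, ∀ y ∈ B, (g.pref b₀ x y ↔ g.pref a₀ y x))
    (hagree : ∀ b : A,
      (∀ x ∈ B, ∀ y ∈ B, (g.pref b x y ↔ g.pref a₀ x y)) ∨
      (∀ x ∈ B, ∀ y ∈ B, (g.pref b x y ↔ g.pref a₀ y x)))
    {R : Set (List α)} (H : Reg g.T R {p | p ∈ Body g.T ∧ g.v p ∈ B})
    (hres : ∀ S ⊆ R, S.Nonempty → ∃ σ ∈ S,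
      (∀ z, KPlay S σ z → z ∈ {p | p ∈ Body g.T ∧ g.v p ∈ B}) ∨
      (∀ z, KPlay S σ z → z ∉ {p | p ∈ Body g.T ∧ g.v p ∈ B}))
    {σ : List α} (hσ : σ ∈ R) :
    ∃ s, ∀ δ ∈ R, σ <+: δ → LOK g {p | p ∈ Body g.T ∧ g.v p ∈ B} s δ := by
  classical
  have := hlin a₀
  have hfin : B.Finite := finite_of_two_wf (g.pref a₀) B (hwf a₀) (g.pref b₀) (hwf b₀) hab
  let rank : O → ℕ := fun x => {y | y ∈ B ∧ g.pref a₀ y x}.ncard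
  have hsub : ∀ x, {y | y ∈ B ∧ g.pref a₀ y x} ⊆ B := fun x y hy => hy.1
  have hrank : ∀ x ∈ B, ∀ y, g.pref a₀ x y → rank x < rank y := by
    intro x hx y hxy
    refine Set.ncard_lt_ncard ⟨fun z hz => ⟨hz.1, trans_of (g.pref a₀) hz.2 hxy⟩, fun hc => ?_⟩
      (hfin.subset (hsub y))
    exact irrefl_of (g.pref a₀) x (hc ⟨hx, hxy⟩).2
  set G : Set (ℕ → α) := {p | p ∈ Body g.T ∧ g.v p ∈ B} with hG
  let own : List α → Prop := fun η => ∀ x ∈ B, ∀ y ∈ B, (g.pref (g.d η) x y ↔ g.pref a₀ x y)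
  let X : ℕ → Set (ℕ → α) := fun n => ⋃ x ∈ {x | x ∈ B ∧ n ≤ rank x}, {p ∈ Body g.T | g.v p = x}
  obtain ⟨s, hs⟩ := H.sol own (fun z => rank (g.v z)) B.ncard
    (fun z _ => Set.ncard_le_ncard (hsub _) hfin) X
    (by
      intro n
      refine MeasurableSet.biUnion ?_ (fun x _ => (hBorel x).2)
      exact (hfin.subset fun x hx => hx.1).countable)
    (by
      intro n z hz
      simp only [X, Set.mem_iUnion]
      constructor
      · rintro ⟨x, hx, -, rfl⟩; exact hx.2
      · intro h; exact ⟨g.v z, ⟨hz.2, h⟩, hz.1, rfl⟩) hres hσ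
  refine ⟨s, fun δ hδ hσδ => ?_⟩
  obtain ⟨k1, k2⟩ := hs δ hδ hσδ
  refine ⟨k1, fun q hq e a => ⟨fun hf hpref => ?_, fun hpref => ?_⟩⟩
  · rcases hagree a with ha | ha
    · have h1 : Foll (fun η => ¬ own η) s δ q := by
        intro n hn hP
        refine hf n hn fun hd => hP ?_
        simp only [own, hd]; exact ha
      have h2 := (k2 q hq e).2 h1
      rw [ha _ k1.2 _ hq.2] at hpref
      have := hrank _ k1.2 _ hpref
      simp only at h2
      omega
    · by_cases ha' : ∀ x ∈ B, ∀ y ∈ B, (g.pref a x y ↔ g.pref a₀ x y)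
      · have h1 : Foll (fun η => ¬ own η) s δ q := by
          intro n hn hP
          refine hf n hn fun hd => hP ?_
          simp only [own, hd]; exact ha'
        have h2 := (k2 q hq e).2 h1
        rw [ha' _ k1.2 _ hq.2] at hpref
        have := hrank _ k1.2 _ hpref
        simp only at h2
        omega
      · have h1 : Foll own s δ q := by
          intro n hn hP
          refine hf n hn fun hd => ha' ?_
          simp only [own, hd] at hP; exact hP
        have h2 := (k2 q hq e).1 h1
        rw [ha _ k1.2 _ hq.2] at hpref
        have := hrank _ hq.2 _ hpref
        simp only at h2
        omega
  · rcases trichotomous_of (g.pref a₀) (g.v q) (g.v (run s δ)) with h | h | h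
    · exact ⟨a₀, h⟩
    · rw [h] at hpref
      have := hlin a
      exact absurd hpref (irrefl_of (g.pref a) _)
    · exact ⟨b₀, (hab _ hq.2 _ k1.2).2 h⟩

end LocalOpp
end BD


namespace BD
universe u

section Translate
variable {α A O : Type*} [Inhabited α]

theorem le_pp_length (γ : List α) (p : ℕ → α) : playPrefix (listExtend γ p) γ.length = γ := by
  conv_rhs => rw [← pp_getD γ]
  apply pp_of_val
  intro m hm
  simp [listExtend, hm]

theorem le_pp_add (γ : List α) (p : ℕ → α) (n : ℕ) :
    playPrefix (listExtend γ p) (γ.length + n) = γ ++ playPrefix p n := by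
  induction n with
  | zero => simpa [playPrefix] using le_pp_length γ p
  | succ n ih =>
    rw [← Nat.add_assoc, pp_succ, ih, pp_succ, List.append_assoc]
    simp [listExtend]

theorem induced_pp {T : Set (List α)} {s : List α → List α} (hs : IsProfile T s) (h0 : [] ∈ T)
    (n : ℕ) : playPrefix (inducedPlay s) n = iterNode s [] n ∧ iterNode s [] n ∈ T := by
  induction n with
  | zero => exact ⟨rfl, h0⟩
  | succ n ih =>
    obtain ⟨h1, ⟨c, hc⟩, h3⟩ := hs _ ih.2
    have hl : (iterNode s [] n).length = n := by rw [← ih.1, pp_length]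
    refine ⟨?_, h1⟩
    rw [← hc, List.length_append] at h3
    obtain ⟨x, rfl⟩ := List.length_eq_one_iff.1 (show c.length = 1 by omega)
    rw [pp_succ, ih.1]
    have e : iterNode s [] (n + 1) = iterNode s [] n ++ [x] := hc.symm
    have e2 : inducedPlay s n = x := by
      show (iterNode s [] (n + 1)).getD n default = x
      rw [e, List.getD_append_right _ _ _ _ hl.le, hl]
      simp
    rw [e, e2]

theorem ext_body {T : Set (List α)} (hT : IsTree T) {γ : List α} {p : ℕ → α}
    (hp : p ∈ Body {δ | γ ++ δ ∈ T}) : listExtend γ p ∈ Body T := by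
  intro n
  have := hp n
  have h : γ ++ playPrefix p n ∈ T := this
  rw [← le_pp_add] at h
  exact hT (pp_prefix_le _ (by omega)) h

theorem sub_profile_eq (s : List α → α) (γ δ : List α) :
    subProfile γ (fun η => η ++ [s η]) δ = δ ++ [s (γ ++ δ)] := by
  simp [subProfile]

theorem glue (g : Game α A O) (hT : IsTree g.T)
    (hlin : ∀ a : A, IsStrictTotalOrder O (g.pref a)) (s : List α → α)
    (hs : ∀ δ ∈ g.T, ∃ G : Set (ℕ → α), G ⊆ Body g.T ∧ LOK g G s δ ∧
      ∀ q ∈ Body g.T, playPrefix q δ.length = δ → q ∉ G →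
        ∀ a, g.pref a (g.v q) (g.v (run s δ))) :
    ∃ s, IsProfile g.T s ∧ IsGPSPE g s := by
  have hbody : ∀ δ ∈ g.T, run s δ ∈ Body g.T := by
    intro δ hδ
    obtain ⟨G, h1, h2, -⟩ := hs δ hδ
    exact h1 h2.1
  have hleg : KLegal g.T s := by
    intro δ hδ
    have := hbody δ hδ (δ.length + 1)
    rwa [pp_succ, runs_step s δ le_rfl, runs_start] at this
  have hprof : IsProfile g.T (fun η => η ++ [s η]) :=
    fun γ hγ => ⟨hleg γ hγ, List.prefix_append _ _, by simp⟩
  have hsubprof : ∀ γ ∈ g.T, IsProfile (g.sub γ).T (subProfile γ (fun η => η ++ [s η])) := by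
    intro γ hγ δ hδ
    rw [sub_profile_eq]
    refine ⟨?_, List.prefix_append _ _, by simp⟩
    show γ ++ (δ ++ [s (γ ++ δ)]) ∈ g.T
    rw [← List.append_assoc]
    exact hleg _ hδ
  have hnil : ∀ γ ∈ g.T, ([] : List α) ∈ (g.sub γ).T := by
    intro γ hγ
    show γ ++ [] ∈ g.T
    rwa [List.append_nil]
  have hplay : ∀ γ ∈ g.T, ∀ s' : List α → List α, IsProfile (g.sub γ).T s' → ∀ P : List α → Prop,
      (∀ δ, γ ++ δ ∈ g.T → P (γ ++ δ) → s' δ = δ ++ [s (γ ++ δ)]) →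
      Foll P s γ (listExtend γ (inducedPlay s')) ∧
        inducedPlay s' ∈ Body (g.sub γ).T := by
    intro γ hγ s' hs' P hP
    have hi := fun n => induced_pp hs' (hnil γ hγ) n
    refine ⟨?_, fun n => by rw [(hi n).1]; exact (hi n).2⟩
    intro n hn hPn
    obtain ⟨k, rfl⟩ : ∃ k, n = γ.length + k := ⟨n - γ.length, by omega⟩
    have e1 := le_pp_add γ (inducedPlay s') k
    have e2 := le_pp_add γ (inducedPlay s') (k + 1)
    rw [← Nat.add_assoc, pp_succ, (hi (k+1)).1, e1, (hi k).1] at e2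
    have e3 : iterNode s' [] (k + 1) = s' (iterNode s' [] k) := rfl
    rw [e1, (hi k).1] at hPn ⊢
    rw [e3, hP _ (hi k).2 hPn, List.append_assoc, List.append_cancel_left_eq] at e2
    have := List.append_cancel_left e2
    simpa using this
  have hrun : ∀ γ ∈ g.T, listExtend γ (inducedPlay (subProfile γ (fun η => η ++ [s η]))) = run s γ ∧
      inducedPlay (subProfile γ (fun η => η ++ [s η])) ∈ Body (g.sub γ).T := by
    intro γ hγ
    have h := hplay γ hγ _ (hsubprof γ hγ) (fun _ => True) (fun δ _ _ => sub_profile_eq s γ δ)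
    refine ⟨runs_unique (le_pp_length _ _) fun n hn => h.1 n hn trivial, h.2⟩
  refine ⟨fun η => η ++ [s η], hprof, ?_, ?_⟩
  · rintro γ hγ ⟨a, s', hs', hd, hpref⟩
    change g.pref a (g.v (listExtend γ (inducedPlay (subProfile γ (fun η => η ++ [s η])))))
      (g.v (listExtend γ (inducedPlay s'))) at hpref
    rw [(hrun γ hγ).1] at hpref
    obtain ⟨h1, h2⟩ := hplay γ hγ s' hs' (fun η => g.d η ≠ a) (by
      intro δ hδ hne
      by_contra hc
      refine hne (hd δ hδ fun he => hc ?_)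
      rw [← he, sub_profile_eq])
    have h3 : listExtend γ (inducedPlay s') ∈ Body g.T := ext_body hT h2
    obtain ⟨G, k1, k2, k3⟩ := hs γ hγ
    by_cases hq : listExtend γ (inducedPlay s') ∈ G
    · exact (k2.2 _ hq (le_pp_length _ _) a).1 h1 hpref
    · have := k3 _ h3 (le_pp_length _ _) hq a
      have := hlin a
      exact asymm_of (g.pref a) hpref ‹_›
  · intro γ hγ
    obtain ⟨e, hb⟩ := hrun γ hγ
    refine ⟨⟨_, hb, rfl⟩, ?_⟩
    rintro y ⟨p, hp, rfl⟩ a hpref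
    change g.pref a (g.v (listExtend γ (inducedPlay (subProfile γ (fun η => η ++ [s η])))))
      (g.v (listExtend γ p)) at hpref
    change ∃ b, g.pref b (g.v (listExtend γ p))
      (g.v (listExtend γ (inducedPlay (subProfile γ (fun η => η ++ [s η])))))
    rw [e] at hpref ⊢
    have h3 : listExtend γ p ∈ Body g.T := ext_body hT hp
    obtain ⟨G, k1, k2, k3⟩ := hs γ hγ
    by_cases hq : listExtend γ p ∈ G
    · exact (k2.2 _ hq (le_pp_length _ _) a).2 hpref
    · exact ⟨a, k3 _ h3 (le_pp_length _ _) hq a⟩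

end Translate
end BD


namespace BD

open Classical in
noncomputable def rootLen {α O : Type*} (Top : List α → O) (δ : List α) : ℕ :=
  Nat.find (p := fun m => Top (δ.take m) = Top δ) ⟨δ.length, by rw [List.take_length]⟩

theorem rootLen_spec {α O : Type*} (Top : List α → O) (δ : List α) :
    Top (δ.take (rootLen Top δ)) = Top δ ∧ rootLen Top δ ≤ δ.length := by
  classical
  have h : ∃ m, Top (δ.take m) = Top δ := ⟨δ.length, by rw [List.take_length]⟩
  exact ⟨Nat.find_spec h, Nat.find_min' h (by rw [List.take_length])⟩

theorem rootLen_eq {α O : Type*} [Inhabited α] (Top : List α → O) (δ : List α) (q : ℕ → α)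
    (hq : playPrefix q δ.length = δ) {n : ℕ} (hn : δ.length ≤ n)
    (ht : Top (playPrefix q n) = Top δ) :
    (playPrefix q n).take (rootLen Top (playPrefix q n)) = δ.take (rootLen Top δ) := by
  classical
  have htake : ∀ m, m ≤ δ.length → (playPrefix q n).take m = δ.take m := by
    intro m hm
    rw [pp_take q (hm.trans hn), ← pp_take q hm, hq]
  have h : ∃ m, Top (δ.take m) = Top δ := ⟨δ.length, by rw [List.take_length]⟩
  have hl := (rootLen_spec Top δ).2
  have e : rootLen Top (playPrefix q n) = rootLen Top δ := by
    rw [rootLen, Nat.find_eq_iff]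
    refine ⟨by rw [htake _ hl, ht]; exact (rootLen_spec Top δ).1, fun k hk hc => ?_⟩
    rw [htake k (by omega), ht] at hc
    exact Nat.find_min h hk hc
  rw [e, htake _ hl]

end BD


/-- a game on a countable pruned tree over a countable alphabet, with
Borel-measurable outcome function, strict linear preferences with well-founded
inverses admitting a layered partition whose strict lower unions are quasi-difference
sets, has a global-Pareto subgame perfect equilibrium. -/
theorem stmt9 {α A O : Type*} [Inhabited α] [Countable α] [Nonempty A] [Nonempty O]
    (g : Game α A O) (hT : IsTree g.T) (hne : g.T.Nonempty) (hpr : IsPruned g.T)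
    (hTc : g.T.Countable)
    (hlin : ∀ a : A, IsStrictTotalOrder O (g.pref a))
    (hwf : ∀ a : A, WellFounded (fun x y => g.pref a y x))
    (hBorel : ∀ x : O, IsBorelIn g.T {p ∈ Body g.T | g.v p = x})
    (P : Set (Set O)) (r : Set O → Set O → Prop)
    (hpart : Setoid.IsPartition P)
    (hirr : ∀ B ∈ P, ¬ r B B)
    (htrans : ∀ B ∈ P, ∀ C ∈ P, ∀ D ∈ P, r B C → r C D → r B D)
    (htot : ∀ B ∈ P, ∀ C ∈ P, B ≠ C → r B C ∨ r C B)
    (hord : ∀ B ∈ P, ∀ C ∈ P, r B C → ∀ a : A, ∀ x ∈ B, ∀ y ∈ C, g.pref a x y)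
    (hagree : ∀ a b : A, ∀ B ∈ P,
      (∀ x ∈ B, ∀ y ∈ B, (g.pref b x y ↔ g.pref a x y)) ∨
      (∀ x ∈ B, ∀ y ∈ B, (g.pref b x y ↔ g.pref a y x)))
    (hD : ∀ B ∈ P,
      QuasiDiff g.T {p ∈ Body g.T | ∃ C ∈ P, r C B ∧ g.v p ∈ C}) :
    ∃ s, IsProfile g.T s ∧ IsGPSPE g s := by
  classical
  obtain ⟨a₀⟩ := ‹Nonempty A›
  have hblk : ∀ x : O, ∃ B, B ∈ P ∧ x ∈ B ∧ ∀ C ∈ P, x ∈ C → C = B := by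
    intro x
    obtain ⟨B, hB, huniq⟩ := hpart.2 x
    exact ⟨B, hB.1, hB.2, fun C hC hx => huniq C ⟨hC, hx⟩⟩
  choose blk blkP blkm blku using hblk
  have hsucc : ∀ δ ∈ g.T, ∃ a, δ ++ [a] ∈ g.T := by
    intro δ hδ
    obtain ⟨η, h1, ⟨c, rfl⟩, h3⟩ := hpr δ hδ
    rw [List.length_append] at h3
    obtain ⟨x, rfl⟩ := List.length_eq_one_iff.1 (show c.length = 1 by omega)
    exact ⟨x, h1⟩
  have hTop : ∀ γ, ∃ B, γ ∈ g.T → ((∃ p ∈ cylinder g.T γ, blk (g.v p) = B) ∧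
      ∀ q ∈ cylinder g.T γ, blk (g.v q) = B ∨ r (blk (g.v q)) B) := by
    intro γ
    by_cases hγ : γ ∈ g.T
    · have hk := BD.runs_kplay (BD.kfix_legal hsucc (fun _ => default)) hγ
      obtain ⟨x, ⟨p, hp, rfl⟩, hx⟩ := (hwf a₀).has_min (g.v '' cylinder g.T γ)
        ⟨_, _, ⟨hk.body hT (fun _ h => h), hk.1⟩, rfl⟩
      refine ⟨blk (g.v p), fun _ => ⟨⟨p, hp, rfl⟩, fun q hq => ?_⟩⟩
      by_cases he : blk (g.v q) = blk (g.v p)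
      · exact Or.inl he
      · right
        refine (htot _ (blkP _) _ (blkP _) he).resolve_right fun h => ?_
        exact hx _ ⟨q, hq, rfl⟩ (hord _ (blkP _) _ (blkP _) h a₀ _ (blkm _) _ (blkm _))
    · exact ⟨∅, fun h => absurd h hγ⟩
  choose Top hTop using hTop
  have hTopP : ∀ γ ∈ g.T, Top γ ∈ P := by
    intro γ hγ
    obtain ⟨⟨p, -, hp⟩, -⟩ := hTop γ hγ
    rw [← hp]; exact blkP _
  have hasym : ∀ B ∈ P, ∀ C ∈ P, r B C → r C B → False :=
    fun B hB C hC h1 h2 => hirr B hB (htrans B hB C hC B hB h1 h2)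
  have hReg : ∀ B ∈ P, BD.Reg g.T {γ | γ ∈ g.T ∧ Top γ = B} {p | p ∈ Body g.T ∧ g.v p ∈ B} := by
    intro B hB
    refine ⟨hT, fun γ h => h.1, ?_, ?_⟩
    · rintro q ⟨hq1, hq2⟩ m n hmn ⟨h1, h2⟩
      refine ⟨hq1 n, ?_⟩
      have hbq : blk (g.v q) = B := (blku _ B hB hq2).symm
      have h3 := (hTop _ (hq1 n)).2 q ⟨hq1, by rw [BD.pp_length]⟩
      obtain ⟨⟨p, hp, hpB⟩, -⟩ := hTop _ (hq1 n)
      have h4 := (hTop _ h1).2 p ⟨hp.1, by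
        have := hp.2
        rw [BD.pp_length] at this ⊢
        exact BD.pp_congr this hmn⟩
      rw [hpB, h2] at h4
      rw [hbq] at h3
      rcases h4 with h4 | h4
      · exact h4
      · rcases h3 with h3 | h3
        · exact h3.symm
        · exact (hasym _ hB _ (hTopP _ (hq1 n)) h3 h4).elim
    · rintro γ ⟨h1, h2⟩
      obtain ⟨⟨p, hp, hpB⟩, -⟩ := hTop _ h1
      refine ⟨p, ⟨hp.1, ?_⟩, hp.2⟩
      rw [← h2, ← hpB]; exact blkm _
  have hlow : ∀ γ ∈ g.T, ∀ q ∈ cylinder g.T γ, q ∉ {p | p ∈ Body g.T ∧ g.v p ∈ Top γ} →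
      r (blk (g.v q)) (Top γ) := by
    intro γ hγ q hq hn
    refine ((hTop γ hγ).2 q hq).resolve_left fun h => hn ⟨hq.1, ?_⟩
    rw [← h]; exact blkm _
  have hres : ∀ B ∈ P, ∀ S ⊆ {γ | γ ∈ g.T ∧ Top γ = B}, S.Nonempty → ∃ σ ∈ S,
      (∀ z, BD.KPlay S σ z → z ∈ {p | p ∈ Body g.T ∧ g.v p ∈ B}) ∨
      (∀ z, BD.KPlay S σ z → z ∉ {p | p ∈ Body g.T ∧ g.v p ∈ B}) := by
    intro B hB S hS hSne
    obtain ⟨σ, hσ, h⟩ := BD.resolve hT (hD B hB) S (fun γ hγ => (hS hγ).1) hSne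
    refine ⟨σ, hσ, h.symm.imp (fun h z hz => ?_) (fun h z hz => ?_)⟩
    · by_contra hc
      have hb := hz.body hT (fun γ hγ => (hS hγ).1)
      have := hlow σ (hS hσ).1 z ⟨hb, hz.1⟩ (by rw [(hS hσ).2]; exact hc)
      rw [(hS hσ).2] at this
      exact h z hz ⟨hb, blk (g.v z), blkP _, this, blkm _⟩
    · obtain ⟨hb, C, hC, hr, hv⟩ := h z hz
      rintro ⟨-, hc⟩
      have e1 := blku _ C hC hv
      have e2 := blku _ B hB hc
      rw [e1, ← e2] at hr
      exact hirr B hB hr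
  have hsol : ∀ σ, ∃ s, σ ∈ g.T → ∀ δ ∈ g.T, Top δ = Top σ → σ <+: δ →
      BD.LOK g {p | p ∈ Body g.T ∧ g.v p ∈ Top σ} s δ := by
    intro σ
    by_cases hσ : σ ∈ g.T
    · have hB := hTopP σ hσ
      by_cases hag : ∀ a b : A, ∀ x ∈ Top σ, ∀ y ∈ Top σ, (g.pref b x y ↔ g.pref a x y)
      · obtain ⟨s, hs⟩ := BD.local_agree g hwf (Top σ) hag (hReg _ hB)
        exact ⟨s, fun _ δ hδ h1 _ => hs δ ⟨hδ, h1⟩⟩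
      · push Not at hag
        obtain ⟨a, b, x, hx, y, hy, hxy⟩ := hag
        have hab : ∀ x ∈ Top σ, ∀ y ∈ Top σ, (g.pref b x y ↔ g.pref a y x) := by
          refine (hagree a b _ hB).resolve_left fun h => ?_
          have := h x hx y hy
          tauto
        obtain ⟨s, hs⟩ := BD.local_opp g hlin hwf hBorel (Top σ) a b hab
          (fun c => hagree a c _ hB) (hReg _ hB) (hres _ hB) (σ := σ) ⟨hσ, rfl⟩
        exact ⟨s, fun _ δ hδ h1 h2 => hs δ ⟨hδ, h1⟩ h2⟩
    · exact ⟨fun _ => default, fun h => absurd h hσ⟩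
  choose sx hsx using hsol
  have hrun : ∀ δ ∈ g.T, BD.LOK g {p | p ∈ Body g.T ∧ g.v p ∈ Top δ}
      (fun η => sx (η.take (BD.rootLen Top η)) η) δ := by
    intro δ hδ
    obtain ⟨r1, r2⟩ := BD.rootLen_spec Top δ
    have hpre : δ.take (BD.rootLen Top δ) <+: δ := List.take_prefix _ _
    have hok := hsx _ (hT hpre hδ) δ hδ r1.symm hpre
    rw [r1] at hok
    have key : ∀ q ∈ {p | p ∈ Body g.T ∧ g.v p ∈ Top δ}, playPrefix q δ.length = δ →
        ∀ n, δ.length ≤ n →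
        (fun η => sx (η.take (BD.rootLen Top η)) η) (playPrefix q n) =
          sx (δ.take (BD.rootLen Top δ)) (playPrefix q n) := by
      intro q hq e n hn
      have h1 := ((hReg _ (hTopP δ hδ)).stay q hq δ.length n hn (by rw [e]; exact ⟨hδ, rfl⟩)).2
      dsimp only
      rw [BD.rootLen_eq Top δ q e hn h1]
    have e : BD.run (fun η => sx (η.take (BD.rootLen Top η)) η) δ =
        BD.run (sx (δ.take (BD.rootLen Top δ))) δ := by
      symm
      have hst := BD.runs_start (sx (δ.take (BD.rootLen Top δ))) δ
      apply BD.runs_unique hst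
      intro n hn
      rw [BD.runs_step _ _ hn]
      exact (key _ hok.1 hst n hn).symm
    refine ⟨by rw [e]; exact hok.1, fun q hq hqδ a => ?_⟩
    rw [e]
    have h := hok.2 q hq hqδ a
    refine ⟨fun hf => h.1 fun n hn hP => ?_, h.2⟩
    rw [hf n hn hP]
    exact key q hq hqδ n hn
  refine BD.glue g hT hlin (fun η => sx (η.take (BD.rootLen Top η)) η) fun δ hδ =>
    ⟨_, fun p hp => hp.1, hrun δ hδ, fun q hq hqδ hn a => ?_⟩
  exact hord _ (blkP _) _ (hTopP δ hδ) (hlow δ hδ q ⟨hq, hqδ⟩ hn) a _ (blkm _) _ (hrun δ hδ).1.2
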